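/- Let 1 ≤ k ≤ n−1 and p < n−2. Let ∂Ω_t be a smooth strictly convex solution of the flow ∂h/∂t = (h²/f)ρ^{p−n}|Du|^{k+1}σ_{n−k} − η(t)h on [0,T) with uniform two-sided bounds on h, ρ, |∇h|, η(t), |Du| and |D²u| along the flow, with u(·,t) the smooth admissible solution of S_k(D²u)=1 in Ω_t and f positive smooth on S^{n−1}. Then there exists a constant C₁ > 0 independent of t such that σ_{n−k}(x,t) ≤ C₁ for all (x,t) ∈ S^{n−1} × [0,T). -/

import Mathlib

open MeasureTheory Real Filter Topology Set
open scoped RealInnerProductSpace NNReal ENNReal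

noncomputable section

/-- Euclidean space `ℝⁿ`. -/
abbrev En (n : ℕ) := EuclideanSpace ℝ (Fin n)

/-- The unit sphere `S^{n-1}` as a subtype. -/
abbrev Sph (n : ℕ) := Metric.sphere (0 : En n) 1

/-- Spherical Lebesgue measure on `S^{n-1}`. -/
def sphMeasure (n : ℕ) : Measure (Sph n) := (volume : Measure (En n)).toSphere

/-- Support function of a set. -/
def suppFun {n : ℕ} (Ω : Set (En n)) (x : En n) : ℝ :=
  sSup ((fun y => ⟪x, y⟫) '' Ω)

/-- Radial function of a set (0-homogeneous extension of degree -1). -/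
def radialFun {n : ℕ} (Ω : Set (En n)) (v : En n) : ℝ :=
  sSup {c : ℝ | 0 < c ∧ c • v ∈ Ω}

/-- The Hessian matrix of `u : ℝⁿ → ℝ` at `y`. -/
def hessMat {n : ℕ} (u : En n → ℝ) (y : En n) : Matrix (Fin n) (Fin n) ℝ :=
  Matrix.of fun i j =>
    iteratedFDeriv ℝ 2 u y ![EuclideanSpace.single i (1:ℝ), EuclideanSpace.single j (1:ℝ)]

/-- `S_k(A)`: the k-th elementary symmetric function of the eigenvalues of `A`,
expressed via the characteristic polynomial. -/
def esym (n k : ℕ) (A : Matrix (Fin n) (Fin n) ℝ) : ℝ :=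
  (-1 : ℝ) ^ k * (Matrix.charpoly A).coeff (n - k)

/-- Quadratic form of a matrix. -/
def quadForm {n : ℕ} (A : Matrix (Fin n) (Fin n) ℝ) (ξ : En n) : ℝ :=
  ∑ i, ∑ j, A i j * ξ i * ξ j

/-- A convex body in `ℝⁿ` containing the origin in its interior. -/
structure IsConvexBodyO (n : ℕ) (Ω : Set (En n)) : Prop where
  conv : Convex ℝ Ω
  comp : IsCompact Ω
  zeroInt : (0 : En n) ∈ interior Ω

/-- A smooth, closed, strictly convex hypersurface bounding a convex body that contains
the origin in its interior, encoded via the support function: the support function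
(which is the 1-homogeneous extension of its restriction to the sphere) is smooth away
from the origin and its Hessian is positive definite on tangent directions of the sphere. -/
structure IsSmoothStrictlyConvexBody (n : ℕ) (Ω : Set (En n)) : Prop where
  body : IsConvexBodyO n Ω
  suppSmooth : ContDiffOn ℝ (⊤ : ℕ∞) (suppFun Ω) {(0 : En n)}ᶜ
  strictConv : ∀ x : En n, ‖x‖ = 1 → ∀ ξ : En n, ⟪ξ, x⟫ = 0 → ξ ≠ 0 →
    0 < quadForm (hessMat (suppFun Ω) x) ξ

/-- An admissible (`k`-convex) solution of the `k`-Hessian Dirichlet problem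
`S_k(D²u) = 1` in `Ω`, `u = 0` on `∂Ω`. -/
structure IsAdmissibleSolution (n k : ℕ) (Ω : Set (En n)) (u : En n → ℝ) : Prop where
  smooth : ContDiff ℝ (⊤ : ℕ∞) u
  eqn : ∀ y ∈ interior Ω, esym n k (hessMat u y) = 1
  bd : ∀ y ∈ frontier Ω, u y = 0
  kconv : ∀ y ∈ interior Ω, ∀ j, 1 ≤ j → j ≤ k → 0 ≤ esym n j (hessMat u y)

/-- The property of being (a selection of) the radial Gauss map `α_Ω`:
`α v` is an outer unit normal to `∂Ω` at the boundary point `ρ_Ω(v)v`. -/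
def IsRadialGaussMap {n : ℕ} (Ω : Set (En n)) (α : Sph n → Sph n) : Prop :=
  ∀ v : Sph n, ⟪(α v : En n), radialFun Ω (v : En n) • (v : En n)⟫ = suppFun Ω (α v)

/-- The reverse radial Gauss image `α*_Ω(η)`: the set of `v` in the sphere such that
some outer unit normal of `∂Ω` at `ρ_Ω(v)v` belongs to `η`. -/
def revRadialGaussImage {n : ℕ} (Ω : Set (En n)) (η : Set (Sph n)) : Set (Sph n) :=
  {v | ∃ x ∈ η, ⟪(x : En n), radialFun Ω (v : En n) • (v : En n)⟫ = suppFun Ω (x : En n)}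

/-- The integrand `ρ_Ω(v)^{p+1-k} |Du(r_Ω(v))|^{k+1}` of the dual torsional quantities. -/
def QdualIntegrand (n k : ℕ) (p : ℝ) (Ω : Set (En n)) (u : En n → ℝ) (v : Sph n) : ℝ :=
  radialFun Ω (v : En n) ^ (p + 1 - (k : ℝ)) *
    ‖gradient u (radialFun Ω (v : En n) • (v : En n))‖ ^ (k + 1)

/-- The `p`-th dual `k`-torsional measure as a set function:
`Q̃_{k,n-p}(Ω,η) = (1/(n-p)) ∫_{α*_Ω(η)} ρ_Ω^{p+1-k} |Du(r_Ω(v))|^{k+1} dv`. -/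
def QdualSet (n k : ℕ) (p : ℝ) (Ω : Set (En n)) (u : En n → ℝ) (η : Set (Sph n)) : ℝ :=
  ((n : ℝ) - p)⁻¹ *
    ∫ v in revRadialGaussImage Ω η, QdualIntegrand n k p Ω u v ∂(sphMeasure n)

/-- The `p`-th dual `k`-torsional rigidity
`Q̃_{k,n-p}(Ω) = (1/(n-p)) ∫_{S^{n-1}} ρ_Ω^{p+1-k} |Du(r_Ω(v))|^{k+1} dv`. -/
def Qdual (n k : ℕ) (p : ℝ) (Ω : Set (En n)) (u : En n → ℝ) : ℝ :=
  ((n : ℝ) - p)⁻¹ * ∫ v, QdualIntegrand n k p Ω u v ∂(sphMeasure n)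

/-- The normalized `k`-torsional rigidity
`T̃_k(Ω) = (1/(k(n+2))) ∫_{S^{n-1}} ρ_Ω^{n+1-k} |Du(r_Ω(v))|^{k+1} dv`. -/
def Ttil (n k : ℕ) (Ω : Set (En n)) (u : En n → ℝ) : ℝ :=
  (1 / ((k : ℝ) * ((n : ℝ) + 2))) *
    ∫ v : Sph n, radialFun Ω (v : En n) ^ ((n : ℝ) + 1 - (k : ℝ)) *
      ‖gradient u (radialFun Ω (v : En n) • (v : En n))‖ ^ (k + 1) ∂(sphMeasure n)

/-- The normalization factor `η(t)` in the flow. -/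
def etaFn (n k : ℕ) (p : ℝ) (Ω : ℝ → Set (En n)) (u : ℝ → En n → ℝ) (f : En n → ℝ)
    (t : ℝ) : ℝ :=
  (∫ v, QdualIntegrand n k p (Ω t) (u t) v ∂(sphMeasure n)) /
    (∫ x : Sph n, f (x : En n) ∂(sphMeasure n))

/-- The scalar form of the flow equation (4.1)/(1.7):
`∂h/∂t = (h²/f)(|∇h|²+h²)^{(p-n)/2} |Du(∇̄h,t)|^{k+1} σ_{n-k} - η(t) h`,
written via the 1-homogeneous extension `H = suppFun (Ω t)` of the support function,
for which `∇̄h = gradient H`, `|∇h|²+h² = ‖gradient H‖²` and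
`σ_{n-k}(h_{ij}+hδ_{ij}) = S_{n-k}(D²H)`. -/
def SatisfiesFlow (n k : ℕ) (p : ℝ) (I : Set ℝ) (Ω : ℝ → Set (En n))
    (u : ℝ → En n → ℝ) (f : En n → ℝ) : Prop :=
  ∀ t ∈ I, ∀ x : En n, ‖x‖ = 1 →
    HasDerivAt (fun s => suppFun (Ω s) x)
      ((suppFun (Ω t) x) ^ 2 / f x * ‖gradient (suppFun (Ω t)) x‖ ^ (p - (n : ℝ)) *
          ‖gradient (u t) (gradient (suppFun (Ω t)) x)‖ ^ (k + 1) *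
          esym n (n - k) (hessMat (suppFun (Ω t)) x)
        - etaFn n k p Ω u f t * suppFun (Ω t) x) t

/-- Bundled hypotheses: a smooth strictly convex solution of the flow on `I`,
together with the admissible solutions of the `k`-Hessian equation on each `Ω_t`. -/
structure IsFlowSolution (n k : ℕ) (p : ℝ) (I : Set ℝ) (Ω : ℝ → Set (En n))
    (u : ℝ → En n → ℝ) (f : En n → ℝ) : Prop where
  bodies : ∀ t ∈ I, IsSmoothStrictlyConvexBody n (Ω t)
  adm : ∀ t ∈ I, IsAdmissibleSolution n k (Ω t) (u t)
  flow : SatisfiesFlow n k p I Ω u f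

end

section

open scoped Matrix

open Polynomial in
/-- Derivatives of real-rooted polynomials are real-rooted. -/
theorem splits_derivative_of_splits {p : ℝ[X]} (hp : p.Splits) : (derivative p).Splits := by
  rw [splits_iff_card_roots] at hp ⊢
  have h1 := p.card_roots_le_derivative
  have h2 := card_roots' (derivative p)
  have h3 := natDegree_derivative_le p
  by_cases h : p.natDegree = 0
  · rw [derivative_of_natDegree_zero h]; simp
  · omega

open Polynomial in
theorem splits_iterate_derivative_of_splits {p : ℝ[X]} (hp : p.Splits) (l : ℕ) :
    (derivative^[l] p).Splits := by
  induction l with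
  | zero => simpa
  | succ l ih => rw [Function.iterate_succ_apply']; exact splits_derivative_of_splits ih

open Polynomial in
/-- At a critical point beyond which it is increasing, a real-rooted polynomial is nonpositive. -/
theorem eval_nonpos_of_last_critical {R : ℝ[X]} (hR : R.Splits) (hdeg : R.natDegree ≠ 0) {y : ℝ}
    (hy : (derivative R).eval y = 0) (hpos : ∀ z, y < z → 0 < (derivative R).eval z) :
    R.eval y ≤ 0 := by
  by_contra hlt
  push Not at hlt
  have hmono : StrictMonoOn (fun z => R.eval z) (Set.Ici y) := by
    apply strictMonoOn_of_deriv_pos (convex_Ici y) R.continuous.continuousOn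
    intro x hx
    rw [interior_Ici] at hx
    rw [Polynomial.deriv]
    exact hpos x hx
  have hroots : ∀ z ∈ R.roots, z < y := by
    intro z hz
    by_contra hzy
    push Not at hzy
    have h0 : R.eval z = 0 := (mem_roots'.1 hz).2
    rcases hzy.eq_or_lt with h | h
    · subst h; linarith
    · have := hmono (Set.mem_Ici.2 le_rfl) (Set.mem_Ici.2 h.le) h
      simp only at this
      linarith
  have h1 := hR.eval_derivative_div_eval_of_ne_zero (x := y) hlt.ne'
  rw [hy, zero_div] at h1
  have hcard : R.roots.card = R.natDegree := splits_iff_card_roots.1 hR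
  obtain ⟨z₀, hz₀⟩ : ∃ z, z ∈ R.roots := by
    apply Multiset.exists_mem_of_ne_zero
    intro h
    rw [h] at hcard
    simp at hcard
    exact hdeg hcard.symm
  have hle : 1 / (y - z₀) ≤ (R.roots.map fun z => 1 / (y - z)).sum := by
    apply Multiset.single_le_sum
    · intro x hx
      obtain ⟨z, hz, rfl⟩ := Multiset.mem_map.1 hx
      have := hroots z hz
      exact (one_div_pos.2 (by linarith)).le
    · exact Multiset.mem_map.2 ⟨z₀, hz₀, rfl⟩
  have : 0 < 1 / (y - z₀) := one_div_pos.2 (by linarith [hroots z₀ hz₀])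
  linarith

open Polynomial in
/-- If a polynomial tending to `+∞` is negative at `t`, it has a last root, beyond `t`. -/
theorem exists_last_root {S : ℝ[X]} (hd : 0 < S.degree) (hl : 0 ≤ S.leadingCoeff) {t : ℝ}
    (ht : S.eval t < 0) : ∃ y, t < y ∧ S.eval y = 0 ∧ ∀ z, y < z → 0 < S.eval z := by
  have htop := tendsto_atTop_of_leadingCoeff_nonneg S hd hl
  have key : ∀ a, S.eval a ≤ 0 → ∃ y, a ≤ y ∧ S.eval y = 0 := by
    intro a ha
    obtain ⟨b, hb, hab⟩ := ((htop.eventually_ge_atTop 0).and (eventually_ge_atTop a)).exists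
    obtain ⟨y, hy, h0⟩ := intermediate_value_Icc hab S.continuous.continuousOn ⟨ha, hb⟩
    exact ⟨y, hy.1, h0⟩
  have hS : S ≠ 0 := by rintro rfl; simp at ht
  obtain ⟨y₀, hy₀, h0⟩ := key t ht.le
  have hmem : y₀ ∈ S.roots.toFinset := by simp [hS, h0]
  obtain ⟨y, hy, hmax⟩ := S.roots.toFinset.exists_max_image id ⟨y₀, hmem⟩
  have hy0 : S.eval y = 0 := by simpa [hS] using hy
  refine ⟨y, ?_, hy0, ?_⟩
  · have := hmax y₀ hmem
    simp only [id] at this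
    refine lt_of_le_of_ne (hy₀.trans this) ?_
    rintro rfl
    linarith
  · intro z hz
    by_contra hle
    push Not at hle
    obtain ⟨w, hw, hw0⟩ := key z hle
    have := hmax w (by simp [hS, hw0])
    simp only [id] at this
    linarith

open Polynomial in
theorem natDegree_iterate_derivative_eq {p : ℝ[X]} (l : ℕ) :
    (derivative^[l] p).natDegree = p.natDegree - l := by
  induction l with
  | zero => simp
  | succ l ih =>
    rw [Function.iterate_succ_apply', natDegree_derivative, ih]; omega

open Polynomial in
theorem leadingCoeff_iterate_derivative_pos {p : ℝ[X]} (hp : 0 < p.leadingCoeff) {l : ℕ}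
    (hl : l ≤ p.natDegree) : 0 < (derivative^[l] p).leadingCoeff := by
  rw [leadingCoeff, natDegree_iterate_derivative_eq, coeff_iterate_derivative,
    Nat.sub_add_cancel hl, nsmul_eq_mul]
  apply mul_pos _ hp
  exact_mod_cast Nat.descFactorial_pos.2 hl

open Polynomial in
/-- If an iterated derivative of `(X + a) Q` is positive on `(0, ∞)`, so is that of `Q`
on `[0, ∞)`, up to equality. -/
theorem iterate_derivative_factor_nonneg {Q : ℝ[X]} (hQ : Q.Splits) (hQm : Q.Monic) (a : ℝ)
    {l : ℕ} (hl1 : 1 ≤ l) (hl2 : l ≤ Q.natDegree)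
    (hpos : ∀ t, 0 < t → 0 < (derivative^[l] ((X + C a) * Q)).eval t) {t : ℝ} (ht : 0 ≤ t) :
    0 ≤ (derivative^[l] Q).eval t := by
  by_contra hlt
  push Not at hlt
  obtain ⟨l, rfl⟩ : ∃ m, l = m + 1 := ⟨l - 1, by omega⟩
  have hlc : 0 < (derivative^[l + 1] Q).leadingCoeff :=
    leadingCoeff_iterate_derivative_pos (by rw [hQm.leadingCoeff]; exact one_pos) hl2
  have hdeg : 0 < (derivative^[l + 1] Q).degree := by
    by_contra h
    push Not at h
    have hc := eq_C_of_degree_le_zero h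
    rw [hc] at hlt hlc
    simp at hlt hlc
    linarith
  obtain ⟨y, hty, hy0, hyp⟩ := exists_last_root hdeg hlc.le hlt
  have hle : (derivative^[l] Q).eval y ≤ 0 := by
    apply eval_nonpos_of_last_critical (splits_iterate_derivative_of_splits hQ l)
    · rw [natDegree_iterate_derivative_eq]; omega
    · rw [← Function.iterate_succ_apply' (f := derivative)]; exact hy0
    · rw [← Function.iterate_succ_apply' (f := derivative)]; exact hyp
  have h := hpos y (by linarith)
  have hexp : (X + C a) * Q = Q * X + C a * Q := by ring
  rw [hexp, iterate_map_add (derivative : ℝ[X] →ₗ[ℝ] ℝ[X]), iterate_derivative_C_mul, iterate_derivative_mul_X] at h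
  simp only [eval_add, eval_mul, eval_X, eval_C, hy0, Nat.add_sub_cancel, nsmul_eq_mul,
    eval_natCast] at h
  have : ((l + 1 : ℕ) : ℝ) * (derivative^[l] Q).eval y ≤ 0 :=
    mul_nonpos_of_nonneg_of_nonpos (Nat.cast_nonneg _) hle
  linarith

theorem charpoly_neg_eq {n : ℕ} (M : Matrix (Fin n) (Fin n) ℝ) :
    (-M).charpoly = Polynomial.C ((-1) ^ n) * M.charpoly.comp (-Polynomial.X) := by
  apply Polynomial.funext
  intro t
  rw [Matrix.eval_charpoly, Polynomial.eval_mul, Polynomial.eval_C, Polynomial.eval_comp,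
    Matrix.eval_charpoly]
  have : Matrix.scalar (Fin n) (Polynomial.eval t (-Polynomial.X : Polynomial ℝ)) - M =
      -(Matrix.scalar (Fin n) t - -M) := by
    ext i j
    by_cases h : i = j <;> simp [h, Matrix.scalar_apply]; ring
  rw [this, Matrix.det_neg, Fintype.card_fin, ← mul_assoc, ← mul_pow]
  simp

theorem esym_eq_coeff {n k : ℕ} (hk : k ≤ n) (M : Matrix (Fin n) (Fin n) ℝ) :
    esym n k M = (-M).charpoly.coeff (n - k) := by
  have hX : (-Polynomial.X : Polynomial ℝ) = Polynomial.C (-1) * Polynomial.X := by simp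
  rw [charpoly_neg_eq, Polynomial.coeff_C_mul, hX, Polynomial.comp_C_mul_X_coeff, esym,
    mul_comm (Polynomial.coeff _ _) ((-1) ^ (n - k)), ← mul_assoc, ← pow_add]
  congr 1
  have : n + (n - k) = 2 * (n - k) + k := by omega
  rw [this, pow_add, pow_mul]; simp

theorem charpoly_neg_hermitian {n : ℕ} {M : Matrix (Fin n) (Fin n) ℝ} (hM : M.IsHermitian) :
    (-M).charpoly = ∏ i, (Polynomial.X + Polynomial.C (hM.eigenvalues i)) := by
  rw [charpoly_neg_eq, hM.charpoly_eq, Polynomial.prod_comp]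
  have : (Polynomial.C ((-1 : ℝ) ^ n)) = ∏ _i : Fin n, (-1 : Polynomial ℝ) := by simp
  rw [this, ← Finset.prod_mul_distrib]
  refine Finset.prod_congr rfl fun i _ => ?_
  simp; ring

theorem esym_hermitian {n k : ℕ} (hk : k ≤ n) {M : Matrix (Fin n) (Fin n) ℝ}
    (hM : M.IsHermitian) :
    esym n k M = ∑ I ∈ Finset.univ.powersetCard k, ∏ i ∈ I, hM.eigenvalues i := by
  rw [esym_eq_coeff hk, charpoly_neg_hermitian hM, Finset.prod_X_add_C_coeff]
  · simp only [Finset.card_univ, Fintype.card_fin]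
    congr 2
    omega
  · simp

/-- Determinant of a rank-one perturbation of a diagonal matrix. -/
theorem det_diagonal_add_vecMulVec {n : ℕ} (d w : Fin n → ℝ) (hd : ∀ i, d i ≠ 0) :
    (Matrix.diagonal d + Matrix.vecMulVec w w).det =
      ∏ i, d i + ∑ i, w i ^ 2 * ∏ j ∈ Finset.univ.erase i, d j := by
  have hu : IsUnit (Matrix.diagonal d).det := by
    rw [Matrix.det_diagonal, isUnit_iff_ne_zero]
    exact Finset.prod_ne_zero_iff.2 fun i _ => hd i
  have h := Matrix.det_add_replicateCol_mul_replicateRow (ι := Unit) hu w w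
  rw [← Matrix.vecMulVec_eq] at h
  rw [h, Matrix.det_diagonal, Matrix.det_unique (n := Unit), Matrix.inv_diagonal]
  have hinv : Ring.inverse d = fun i => (d i)⁻¹ := by
    have : IsUnit d := Pi.isUnit_iff.2 fun i => isUnit_iff_ne_zero.2 (hd i)
    apply this.mul_left_cancel
    rw [Ring.mul_inverse_cancel _ this]
    ext i; simp [hd i]
  rw [hinv]
  simp only [Matrix.add_apply, Matrix.one_apply_eq, Matrix.mul_apply, Matrix.replicateRow_apply,
    Matrix.replicateCol_apply, Matrix.diagonal_apply]
  rw [mul_add, mul_one, Finset.mul_sum]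
  congr 1
  refine Finset.sum_congr rfl fun i _ => ?_
  rw [← Finset.mul_prod_erase Finset.univ d (Finset.mem_univ i)]
  simp
  field_simp [hd i]

open Polynomial in
/-- Characteristic polynomial of a rank-one perturbation of a symmetric matrix. -/
theorem charpoly_neg_add_vecMulVec {n : ℕ} {M : Matrix (Fin n) (Fin n) ℝ} (hM : M.IsHermitian)
    (v : Fin n → ℝ) : ∃ w : Fin n → ℝ, (-(M + Matrix.vecMulVec v v)).charpoly =
      (-M).charpoly + ∑ i, C (w i ^ 2) *
        ∏ j ∈ Finset.univ.erase i, (X + C (hM.eigenvalues j)) := by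
  set U : Matrix (Fin n) (Fin n) ℝ := (hM.eigenvectorUnitary : Matrix (Fin n) (Fin n) ℝ) with hU
  have hUU : star U * U = 1 := Unitary.coe_star_mul_self _
  have hUU' : U * star U = 1 := Unitary.coe_mul_star_self _
  refine ⟨star U *ᵥ v, ?_⟩
  apply Polynomial.eq_of_infinite_eval_eq
  have hfin : Set.Finite (Set.range fun i => -hM.eigenvalues i) := Set.finite_range _
  apply hfin.infinite_compl.mono
  intro t ht
  have hd : ∀ i, t + hM.eigenvalues i ≠ 0 := by
    intro i hi
    apply ht
    exact ⟨i, by linarith⟩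
  have hspec : M = U * Matrix.diagonal hM.eigenvalues * star U := by
    have := hM.spectral_theorem
    rw [Unitary.conjStarAlgAut_apply] at this
    exact this
  have hconj : t • (1 : Matrix (Fin n) (Fin n) ℝ) + M + Matrix.vecMulVec v v =
      U * (Matrix.diagonal (fun i => t + hM.eigenvalues i) +
        Matrix.vecMulVec (star U *ᵥ v) (star U *ᵥ v)) * star U := by
    have h1 : Matrix.diagonal (fun i => t + hM.eigenvalues i) =
        t • (1 : Matrix (Fin n) (Fin n) ℝ) + Matrix.diagonal hM.eigenvalues := by
      ext i j; by_cases h : i = j <;> simp [h]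
    have h2 : U * Matrix.vecMulVec (star U *ᵥ v) (star U *ᵥ v) * star U =
        Matrix.vecMulVec v v := by
      rw [Matrix.mul_vecMulVec, Matrix.vecMulVec_mul, Matrix.mulVec_mulVec, hUU',
        Matrix.one_mulVec]
      congr 1
      rw [Matrix.star_eq_conjTranspose, Matrix.conjTranspose_eq_transpose_of_trivial,
        Matrix.vecMul_transpose, Matrix.mulVec_mulVec]
      rw [Matrix.star_eq_conjTranspose, Matrix.conjTranspose_eq_transpose_of_trivial] at hUU'
      rw [hUU', Matrix.one_mulVec]
    rw [h1, mul_add, add_mul, h2, mul_add, add_mul, ← hspec]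
    simp [hUU']
  have hdetU : (U.det) * (star U).det = 1 := by rw [← Matrix.det_mul, hUU', Matrix.det_one]
  have hL : Matrix.scalar (Fin n) t - -(M + Matrix.vecMulVec v v) =
      t • (1 : Matrix (Fin n) (Fin n) ℝ) + M + Matrix.vecMulVec v v := by
    rw [sub_neg_eq_add, add_assoc]
    congr 1
    ext i j; by_cases h : i = j <;> simp [h]
  simp only [Set.mem_ofPred_eq]
  rw [Matrix.eval_charpoly, hL, hconj, Matrix.det_mul, Matrix.det_mul, mul_right_comm, hdetU,
    one_mul, det_diagonal_add_vecMulVec _ _ hd, charpoly_neg_hermitian hM]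
  simp [eval_finsetSum, eval_prod]

theorem esym_eq_iterate {n k : ℕ} (hk : k ≤ n) (M : Matrix (Fin n) (Fin n) ℝ) (t : ℝ) :
    (Polynomial.derivative^[n - k] (-M).charpoly).eval t =
      ((n - k).factorial : ℝ) * esym n k (M + t • (1 : Matrix (Fin n) (Fin n) ℝ)) := by
  have h1 : (-(M + t • (1 : Matrix (Fin n) (Fin n) ℝ))).charpoly =
      Polynomial.taylor t (-M).charpoly := by
    have : -(M + t • (1 : Matrix (Fin n) (Fin n) ℝ)) = -M - Matrix.scalar (Fin n) t := by
      rw [neg_add, sub_eq_add_neg]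
      congr 1
      ext i j; by_cases h : i = j <;> simp [h]
    rw [this, Matrix.charpoly_sub_scalar, Polynomial.taylor_apply]
  rw [esym_eq_coeff hk, h1, Polynomial.taylor_coeff, ← Polynomial.factorial_smul_hasseDeriv]
  simp

theorem isHermitian_vecMulVec_self {n : ℕ} (v : Fin n → ℝ) :
    (Matrix.vecMulVec v v).IsHermitian := by
  ext i j; simp [Matrix.vecMulVec_apply, mul_comm]

open Polynomial in
theorem esym_le_add_vecMulVec {n k : ℕ} (hk1 : 1 ≤ k) (hkn : k ≤ n - 1)
    {M : Matrix (Fin n) (Fin n) ℝ} (hM : M.IsHermitian)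
    (hpos : ∀ t : ℝ, 0 < t → 0 < esym n k (M + t • (1 : Matrix (Fin n) (Fin n) ℝ)))
    (v : Fin n → ℝ) {t : ℝ} (ht : 0 ≤ t) :
    esym n k (M + t • (1 : Matrix (Fin n) (Fin n) ℝ)) ≤
      esym n k (M + Matrix.vecMulVec v v + t • (1 : Matrix (Fin n) (Fin n) ℝ)) := by
  have hkn' : k ≤ n := by omega
  have hfac : (0 : ℝ) < ((n - k).factorial : ℝ) := by exact_mod_cast Nat.factorial_pos _
  obtain ⟨w, hw⟩ := charpoly_neg_add_vecMulVec hM v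
  have h1 := esym_eq_iterate hkn' (M + Matrix.vecMulVec v v) t
  rw [hw, iterate_map_add (derivative : ℝ[X] →ₗ[ℝ] ℝ[X])] at h1
  have h2 := esym_eq_iterate hkn' M t
  rw [eval_add, h2, Polynomial.iterate_derivative_sum, eval_finsetSum] at h1
  have hs : 0 ≤ ∑ i, eval t (derivative^[n - k] (C (w i ^ 2) *
      ∏ j ∈ Finset.univ.erase i, (X + C (hM.eigenvalues j)))) := by
    refine Finset.sum_nonneg fun i _ => ?_
    rw [iterate_derivative_C_mul, eval_mul, eval_C]
    refine mul_nonneg (sq_nonneg _) ?_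
    have hdegQ : (∏ j ∈ Finset.univ.erase i, (X + C (hM.eigenvalues j))).natDegree = n - 1 := by
      rw [natDegree_prod_of_monic _ _ fun j _ => monic_X_add_C _]
      simp
    apply iterate_derivative_factor_nonneg (a := hM.eigenvalues i) _ _ _ _ _ ht
    · exact Splits.prod fun j _ => Splits.X_add_C _
    · exact monic_prod_of_monic _ _ fun j _ => monic_X_add_C _
    · omega
    · rw [hdegQ]; omega
    · intro s hs
      rw [Finset.mul_prod_erase Finset.univ (fun j => X + C (hM.eigenvalues j))
        (Finset.mem_univ i), ← charpoly_neg_hermitian hM, esym_eq_iterate hkn']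
      exact mul_pos hfac (hpos s hs)
  have : ((n - k).factorial : ℝ) * esym n k (M + t • (1 : Matrix (Fin n) (Fin n) ℝ)) ≤
    ((n - k).factorial : ℝ) *
      esym n k (M + Matrix.vecMulVec v v + t • (1 : Matrix (Fin n) (Fin n) ℝ)) := by
    rw [← h1]; linarith
  exact le_of_mul_le_mul_left this hfac

/-- Elementary symmetric functions are monotone inside the Gårding cone. -/
theorem esym_mono {n k : ℕ} (hk1 : 1 ≤ k) (hkn : k ≤ n - 1)
    {M D : Matrix (Fin n) (Fin n) ℝ} (hM : M.IsHermitian)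
    (hpos : ∀ t : ℝ, 0 < t → 0 < esym n k (M + t • (1 : Matrix (Fin n) (Fin n) ℝ)))
    (hD : D.PosSemidef) : esym n k M ≤ esym n k (M + D) := by
  obtain ⟨m, v, rfl⟩ := Matrix.posSemidef_iff_eq_sum_vecMulVec.1 hD
  simp only [star_trivial]
  have key : ∀ s : Finset (Fin m), (M + ∑ i ∈ s, Matrix.vecMulVec (v i) (v i)).IsHermitian ∧
      ∀ t : ℝ, 0 ≤ t → esym n k (M + t • (1 : Matrix (Fin n) (Fin n) ℝ)) ≤
        esym n k (M + ∑ i ∈ s, Matrix.vecMulVec (v i) (v i) +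
          t • (1 : Matrix (Fin n) (Fin n) ℝ)) := by
    intro s
    induction s using Finset.induction_on with
    | empty => simpa using hM
    | insert a s ha ih =>
      rw [Finset.sum_insert ha, add_comm (Matrix.vecMulVec _ _), ← add_assoc]
      refine ⟨ih.1.add (isHermitian_vecMulVec_self _), fun t ht => (ih.2 t ht).trans ?_⟩
      exact esym_le_add_vecMulVec hk1 hkn ih.1
        (fun s hs => (hpos s hs).trans_le (ih.2 s hs.le)) _ ht
  simpa using (key Finset.univ).2 0 le_rfl

theorem quadForm_eq_dotProduct {n : ℕ} (A : Matrix (Fin n) (Fin n) ℝ) (ξ : En n) :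
    quadForm A ξ = (ξ.ofLp) ⬝ᵥ (A *ᵥ ξ.ofLp) := by
  simp only [quadForm, dotProduct, Matrix.mulVec, Finset.mul_sum]
  exact Finset.sum_congr rfl fun i _ => Finset.sum_congr rfl fun j _ => by ring

theorem posSemidef_of_quadForm_nonneg {n : ℕ} {A : Matrix (Fin n) (Fin n) ℝ}
    (hA : A.IsHermitian) (h : ∀ ξ : En n, 0 ≤ quadForm A ξ) : A.PosSemidef := by
  refine Matrix.PosSemidef.of_dotProduct_mulVec_nonneg hA fun x => ?_
  have := h (WithLp.toLp 2 x)
  rw [quadForm_eq_dotProduct] at this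
  simpa using this

theorem quadForm_nonneg_of_posSemidef {n : ℕ} {A : Matrix (Fin n) (Fin n) ℝ}
    (hA : A.PosSemidef) (ξ : En n) : 0 ≤ quadForm A ξ := by
  rw [quadForm_eq_dotProduct]
  simpa using hA.dotProduct_mulVec_nonneg ξ.ofLp

theorem norm_sq_eq_dotProduct {n : ℕ} (ξ : En n) : ‖ξ‖ ^ 2 = ξ.ofLp ⬝ᵥ ξ.ofLp := by
  rw [EuclideanSpace.real_norm_sq_eq, dotProduct]
  exact Finset.sum_congr rfl fun i _ => by ring

theorem quadForm_add {n : ℕ} (A B : Matrix (Fin n) (Fin n) ℝ) (ξ : En n) :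
    quadForm (A + B) ξ = quadForm A ξ + quadForm B ξ := by
  simp only [quadForm_eq_dotProduct, Matrix.add_mulVec, dotProduct_add]

theorem quadForm_sub {n : ℕ} (A B : Matrix (Fin n) (Fin n) ℝ) (ξ : En n) :
    quadForm (A - B) ξ = quadForm A ξ - quadForm B ξ := by
  simp only [quadForm_eq_dotProduct, Matrix.sub_mulVec, dotProduct_sub]

theorem quadForm_smul {n : ℕ} (c : ℝ) (A : Matrix (Fin n) (Fin n) ℝ) (ξ : En n) :
    quadForm (c • A) ξ = c * quadForm A ξ := by
  simp only [quadForm_eq_dotProduct, Matrix.smul_mulVec, dotProduct_smul, smul_eq_mul]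

theorem quadForm_one {n : ℕ} (ξ : En n) :
    quadForm (1 : Matrix (Fin n) (Fin n) ℝ) ξ = ‖ξ‖ ^ 2 := by
  simp only [quadForm_eq_dotProduct, Matrix.one_mulVec, norm_sq_eq_dotProduct]

theorem eigenvalues_eq_quadForm {n : ℕ} {A : Matrix (Fin n) (Fin n) ℝ} (hA : A.IsHermitian)
    (i : Fin n) : hA.eigenvalues i = quadForm A (hA.eigenvectorBasis i) := by
  rw [quadForm_eq_dotProduct, hA.eigenvalues_eq]
  simp

theorem abs_eigenvalues_le {n : ℕ} {A : Matrix (Fin n) (Fin n) ℝ} (hA : A.IsHermitian) {C : ℝ}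
    (h : ∀ ξ : En n, |quadForm A ξ| ≤ C * ‖ξ‖ ^ 2) (i : Fin n) : |hA.eigenvalues i| ≤ C := by
  rw [eigenvalues_eq_quadForm]
  have := h (hA.eigenvectorBasis i)
  rwa [hA.eigenvectorBasis.orthonormal.1 i, one_pow, mul_one] at this

theorem abs_esym_le {n k : ℕ} (hk : k ≤ n) {A : Matrix (Fin n) (Fin n) ℝ}
    (hA : A.IsHermitian) {C : ℝ} (h : ∀ ξ : En n, |quadForm A ξ| ≤ C * ‖ξ‖ ^ 2) :
    |esym n k A| ≤ n.choose k * C ^ k := by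
  rw [esym_hermitian hk hA]
  refine (Finset.abs_sum_le_sum_abs _ _).trans ?_
  have : ∀ I ∈ Finset.univ.powersetCard k, |∏ i ∈ I, hA.eigenvalues i| ≤ C ^ k := by
    intro I hI
    rw [Finset.abs_prod, ← (Finset.mem_powersetCard.1 hI).2]
    rw [← Finset.prod_const]
    exact Finset.prod_le_prod (fun i _ => abs_nonneg _) fun i _ => abs_eigenvalues_le hA h i
  refine (Finset.sum_le_sum this).trans ?_
  simp

theorem esym_smul {n k : ℕ} (hk : k ≤ n) (c : ℝ) (hc : c ≠ 0) (M : Matrix (Fin n) (Fin n) ℝ) :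
    esym n k (c • M) = c ^ k * esym n k M := by
  have h : (-(c • M)).charpoly.comp (Polynomial.C c * Polynomial.X) =
      Polynomial.C (c ^ n) * (-M).charpoly := by
    apply Polynomial.funext
    intro t
    rw [Polynomial.eval_comp, Matrix.eval_charpoly, Polynomial.eval_mul, Polynomial.eval_mul,
      Polynomial.eval_C, Polynomial.eval_C, Polynomial.eval_X, Matrix.eval_charpoly]
    have : Matrix.scalar (Fin n) (c * t) - -(c • M) =
        c • (Matrix.scalar (Fin n) t - -M) := by
      ext i j
      by_cases h : i = j <;> simp [h, Matrix.scalar_apply]; ring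
    rw [this, Matrix.det_smul, Fintype.card_fin]
  have h2 := congrArg (fun p => Polynomial.coeff p (n - k)) h
  simp only [Polynomial.comp_C_mul_X_coeff, Polynomial.coeff_C_mul] at h2
  rw [← esym_eq_coeff hk, ← esym_eq_coeff hk] at h2
  have h3 : c ^ n = c ^ k * c ^ (n - k) := by rw [← pow_add]; congr 1; omega
  have h4 : c ^ (n - k) ≠ 0 := pow_ne_zero _ hc
  apply mul_right_cancel₀ h4
  rw [h2, h3]; ring

theorem esym_zero {n : ℕ} (M : Matrix (Fin n) (Fin n) ℝ) : esym n 0 M = 1 := by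
  have h := M.charpoly_monic
  rw [Polynomial.Monic, Polynomial.leadingCoeff, Matrix.charpoly_natDegree_eq_dim,
    Fintype.card_fin] at h
  simp [esym, h]

theorem esym_add_smul_one {n k : ℕ} (hk : k ≤ n) (M : Matrix (Fin n) (Fin n) ℝ) (t : ℝ) :
    esym n k (M + t • (1 : Matrix (Fin n) (Fin n) ℝ)) =
      ∑ i ∈ Finset.range (k + 1), ((n - k + i).choose (n - k) : ℝ) * esym n (k - i) M * t ^ i := by
  have h := esym_eq_iterate hk M t
  rw [← Polynomial.factorial_smul_hasseDeriv] at h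
  have hfac : ((n - k).factorial : ℝ) ≠ 0 := by exact_mod_cast (Nat.factorial_pos _).ne'
  have h' : esym n k (M + t • (1 : Matrix (Fin n) (Fin n) ℝ)) =
      (Polynomial.hasseDeriv (n - k) (-M).charpoly).eval t := by
    apply mul_left_cancel₀ hfac
    rw [← h]; simp
  have hdeg : (Polynomial.hasseDeriv (n - k) (-M).charpoly).natDegree < k + 1 := by
    have := Polynomial.natDegree_hasseDeriv_le (-M).charpoly (n - k)
    rw [Matrix.charpoly_natDegree_eq_dim, Fintype.card_fin] at this
    omega
  rw [h', Polynomial.eval_eq_sum_range' hdeg]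
  refine Finset.sum_congr rfl fun i hi => ?_
  have hi' : i ≤ k := by simpa [Nat.lt_succ_iff] using hi
  rw [Polynomial.hasseDeriv_coeff, esym_eq_coeff (by omega : k - i ≤ n)]
  congr 4 <;> omega

theorem esym_pos_of_posDef {n k : ℕ} (hk : k ≤ n) {A : Matrix (Fin n) (Fin n) ℝ}
    (hA : A.PosDef) : 0 < esym n k A := by
  rw [esym_hermitian hk hA.isHermitian]
  refine Finset.sum_pos (fun I _ => Finset.prod_pos fun i _ => hA.eigenvalues_pos i) ?_
  apply Finset.powersetCard_nonempty.2
  simpa using hk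

theorem esym_nonneg_of_posSemidef {n k : ℕ} (hk : k ≤ n) {A : Matrix (Fin n) (Fin n) ℝ}
    (hA : A.PosSemidef) : 0 ≤ esym n k A := by
  rw [esym_hermitian hk hA.isHermitian]
  exact Finset.sum_nonneg fun I _ => Finset.prod_nonneg fun i _ => hA.eigenvalues_nonneg i

theorem posDef_add_smul_one {n : ℕ} {A : Matrix (Fin n) (Fin n) ℝ}
    (hA : A.PosSemidef) {t : ℝ} (ht : 0 < t) :
    (A + t • (1 : Matrix (Fin n) (Fin n) ℝ)).PosDef :=
  Matrix.PosDef.posSemidef_add hA (Matrix.PosDef.one.smul ht)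

theorem esym_mono_posSemidef {n k : ℕ} (hk1 : 1 ≤ k) (hkn : k ≤ n - 1)
    {A B : Matrix (Fin n) (Fin n) ℝ} (hA : A.PosSemidef) (hB : B.IsHermitian)
    (h : ∀ ξ : En n, quadForm A ξ ≤ quadForm B ξ) : esym n k A ≤ esym n k B := by
  have hD : (B - A).PosSemidef := posSemidef_of_quadForm_nonneg (hB.sub hA.isHermitian)
    fun ξ => by rw [quadForm_sub]; linarith [h ξ]
  have := esym_mono hk1 hkn hA.isHermitian
    (fun t ht => esym_pos_of_posDef (by omega) (posDef_add_smul_one hA ht)) hD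
  simpa using this

theorem spectral_decomposition {n : ℕ} {A : Matrix (Fin n) (Fin n) ℝ} (hA : A.IsHermitian) :
    A = (hA.eigenvectorUnitary : Matrix (Fin n) (Fin n) ℝ) * Matrix.diagonal hA.eigenvalues *
      star (hA.eigenvectorUnitary : Matrix (Fin n) (Fin n) ℝ) := by
  have := hA.spectral_theorem
  rw [Unitary.conjStarAlgAut_apply] at this
  exact this

theorem exists_conjTranspose_mul_self {n : ℕ} {A : Matrix (Fin n) (Fin n) ℝ}
    (hA : A.PosSemidef) : ∃ C : Matrix (Fin n) (Fin n) ℝ, A = Cᴴ * C := by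
  set U : Matrix (Fin n) (Fin n) ℝ :=
    (hA.isHermitian.eigenvectorUnitary : Matrix (Fin n) (Fin n) ℝ) with hU
  refine ⟨Matrix.diagonal (fun i => √(hA.isHermitian.eigenvalues i)) * star U, ?_⟩
  conv_lhs => rw [spectral_decomposition hA.isHermitian]
  rw [Matrix.conjTranspose_mul, Matrix.star_eq_conjTranspose, Matrix.conjTranspose_conjTranspose,
    Matrix.diagonal_conjTranspose]
  have : Matrix.diagonal hA.isHermitian.eigenvalues =
      Matrix.diagonal (star fun i => √(hA.isHermitian.eigenvalues i)) *
        Matrix.diagonal (fun i => √(hA.isHermitian.eigenvalues i)) := by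
    rw [Matrix.diagonal_mul_diagonal]
    congr 1
    ext i
    simp [Real.mul_self_sqrt (hA.eigenvalues_nonneg i)]
  rw [this, ← hU]
  simp only [Matrix.mul_assoc]

/-- Conjugation by a symmetric contraction decreases elementary symmetric functions. -/
theorem esym_conj_le {n k : ℕ} (hk1 : 1 ≤ k) (hkn : k ≤ n - 1)
    {A E : Matrix (Fin n) (Fin n) ℝ} (hA : A.PosSemidef) (hE : E.IsHermitian)
    (h : (1 - E * E).PosSemidef) : esym n k (E * A * E) ≤ esym n k A := by
  obtain ⟨C, rfl⟩ := exists_conjTranspose_mul_self hA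
  have h1 : (E * (Cᴴ * C) * E).charpoly = (C * (E * E) * Cᴴ).charpoly := by
    rw [show E * (Cᴴ * C) * E = (E * Cᴴ) * (C * E) by simp only [Matrix.mul_assoc],
      Matrix.charpoly_mul_comm]
    simp only [Matrix.mul_assoc]
  have h2 : (Cᴴ * C).charpoly = (C * Cᴴ).charpoly := Matrix.charpoly_mul_comm _ _
  have e1 : esym n k (E * (Cᴴ * C) * E) = esym n k (C * (E * E) * Cᴴ) := by
    simp only [esym, h1]
  have e2 : esym n k (Cᴴ * C) = esym n k (C * Cᴴ) := by simp only [esym, h2]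
  rw [e1, e2]
  have hp : (C * (E * E) * Cᴴ).PosSemidef := by
    have : C * (E * E) * Cᴴ = (C * E) * (C * E)ᴴ := by
      rw [Matrix.conjTranspose_mul, hE.eq]; simp only [Matrix.mul_assoc]
    rw [this]
    exact Matrix.posSemidef_self_mul_conjTranspose _
  apply esym_mono_posSemidef hk1 hkn hp (Matrix.posSemidef_self_mul_conjTranspose _).isHermitian
  intro ξ
  have := quadForm_nonneg_of_posSemidef (h.mul_mul_conjTranspose_same C) ξ
  rw [show C * (1 - E * E) * Cᴴ = C * Cᴴ - C * (E * E) * Cᴴ by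
    rw [mul_sub, sub_mul, mul_one], quadForm_sub] at this
  linarith

theorem esym_conj_diagonal {n k : ℕ} (hk : k ≤ n) {U V : Matrix (Fin n) (Fin n) ℝ}
    (hUV : V * U = 1) (d : Fin n → ℝ) :
    esym n k (U * Matrix.diagonal d * V) = ∑ I ∈ Finset.univ.powersetCard k, ∏ i ∈ I, d i := by
  have h : (-(U * Matrix.diagonal d * V)).charpoly =
      ∏ i, (Polynomial.X + Polynomial.C (d i)) := by
    have h1 : -(U * Matrix.diagonal d * V) = U * (Matrix.diagonal (-d) * V) := by
      have : Matrix.diagonal (-d) = -Matrix.diagonal d := by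
        ext i j; by_cases h : i = j <;> simp [h]
      rw [this, Matrix.neg_mul, Matrix.mul_neg, Matrix.mul_assoc]
    rw [h1, Matrix.charpoly_mul_comm, Matrix.mul_assoc, hUV, Matrix.mul_one,
      Matrix.charpoly_diagonal]
    simp
  rw [esym_eq_coeff hk, h, Finset.prod_X_add_C_coeff]
  · simp only [Finset.card_univ, Fintype.card_fin]
    congr 2
    omega
  · simp

theorem quadForm_conj_diagonal {n : ℕ} (U : Matrix (Fin n) (Fin n) ℝ) (d : Fin n → ℝ) (ξ : En n) :
    quadForm (U * Matrix.diagonal d * Uᵀ) ξ = ∑ i, d i * (Uᵀ *ᵥ ξ.ofLp) i ^ 2 := by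
  rw [quadForm_eq_dotProduct, ← Matrix.mulVec_mulVec, ← Matrix.mulVec_mulVec,
    Matrix.dotProduct_mulVec, ← Matrix.mulVec_transpose, dotProduct]
  refine Finset.sum_congr rfl fun i _ => ?_
  rw [Matrix.mulVec_diagonal]; ring

/-- Comparison of elementary symmetric functions under a parallel-sum type inequality. -/
theorem esym_le_of_parallel_sum {n m : ℕ} (hm1 : 1 ≤ m) (hmn : m ≤ n - 1)
    {A B : Matrix (Fin n) (Fin n) ℝ} (hA : A.PosSemidef) (hB : B.PosSemidef) {s R c : ℝ}
    (hs : 0 < s) (hR : 0 < R) (hc : 0 ≤ c)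
    (h : ∀ ξ ω : En n, s * quadForm B ξ ≤ R * ‖ξ - R⁻¹ • ω‖ ^ 2 + c * quadForm A ω) :
    esym n m B ≤ ∑ I ∈ Finset.univ.powersetCard m, ∏ i ∈ I,
      (R ^ 2 * c / s * hA.isHermitian.eigenvalues i /
        (1 + R * c * hA.isHermitian.eigenvalues i)) := by
  set lam := hA.isHermitian.eigenvalues with hlam
  set U : Matrix (Fin n) (Fin n) ℝ :=
    (hA.isHermitian.eigenvectorUnitary : Matrix (Fin n) (Fin n) ℝ) with hU
  have hUU : Uᵀ * U = 1 := by
    have : star U * U = 1 := Unitary.coe_star_mul_self _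
    rwa [Matrix.star_eq_conjTranspose, Matrix.conjTranspose_eq_transpose_of_trivial] at this
  have hUU' : U * Uᵀ = 1 := by
    have : U * star U = 1 := Unitary.coe_mul_star_self _
    rwa [Matrix.star_eq_conjTranspose, Matrix.conjTranspose_eq_transpose_of_trivial] at this
  have hAdec : A = U * Matrix.diagonal lam * Uᵀ := by
    have := spectral_decomposition hA.isHermitian
    rwa [Matrix.star_eq_conjTranspose, Matrix.conjTranspose_eq_transpose_of_trivial] at this
  have hlam0 : ∀ i, 0 ≤ lam i := fun i => hA.eigenvalues_nonneg i
  have hden : ∀ i, 0 < 1 + R * c * lam i := fun i => by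
    have := hlam0 i; positivity
  set g : Fin n → ℝ := fun i => R ^ 2 * c / s * lam i / (1 + R * c * lam i) with hg
  rw [← esym_conj_diagonal (by omega : m ≤ n) hUU g]
  have hherm : (U * Matrix.diagonal g * Uᵀ).IsHermitian := by
    rw [Matrix.IsHermitian, Matrix.conjTranspose_eq_transpose_of_trivial, Matrix.transpose_mul,
      Matrix.transpose_mul, Matrix.transpose_transpose, Matrix.diagonal_transpose,
      Matrix.mul_assoc]
  apply esym_mono_posSemidef hm1 hmn hB hherm
  intro ξ
  set z := Uᵀ *ᵥ ξ.ofLp with hz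
  set q : Fin n → ℝ := fun i => R / (1 + R * c * lam i) * z i with hq
  set ω : En n := WithLp.toLp 2 (U *ᵥ q) with hω
  have hnorm : ∀ v : En n, ‖v‖ ^ 2 = ∑ i, (Uᵀ *ᵥ v.ofLp) i ^ 2 := by
    intro v
    have : (1 : Matrix (Fin n) (Fin n) ℝ) = U * Matrix.diagonal (fun _ => 1) * Uᵀ := by
      rw [Matrix.diagonal_one, Matrix.mul_one, hUU']
    rw [← quadForm_one, this, quadForm_conj_diagonal]
    simp
  have hUω : Uᵀ *ᵥ ω.ofLp = q := by
    rw [hω]; simp [hUU]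
  have hξω := h ξ ω
  have e1 : ‖ξ - R⁻¹ • ω‖ ^ 2 = ∑ i, (z i - R⁻¹ * q i) ^ 2 := by
    rw [hnorm]
    refine Finset.sum_congr rfl fun i _ => ?_
    rw [WithLp.ofLp_sub, WithLp.ofLp_smul, Matrix.mulVec_sub, Matrix.mulVec_smul, hUω]
    simp [hz]
  have e2 : quadForm A ω = ∑ i, lam i * q i ^ 2 := by
    conv_lhs => rw [hAdec]
    rw [quadForm_conj_diagonal, hUω]
  rw [quadForm_conj_diagonal]
  rw [e1, e2, Finset.mul_sum, Finset.mul_sum, ← Finset.sum_add_distrib] at hξω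
  have e3 : ∀ i, R * (z i - R⁻¹ * q i) ^ 2 + c * (lam i * q i ^ 2) = s * (g i * z i ^ 2) := by
    intro i
    have := (hden i).ne'
    simp only [hq, hg]
    field_simp
    ring
  simp only [e3] at hξω
  rw [← Finset.mul_sum] at hξω
  exact le_of_mul_le_mul_left hξω hs

theorem one_add_mul_pow_le (a b : ℝ) (ha : 0 ≤ a) (hb : 0 ≤ b) (m : ℕ) :
    ∃ C, 0 ≤ C ∧ ∀ τ : ℝ, 0 ≤ τ → τ ≤ 1 → (1 + a * τ) * (1 + b * τ) ^ m ≤ 1 + C * τ := by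
  induction m with
  | zero => exact ⟨a, ha, fun τ _ _ => by simp⟩
  | succ m ih =>
    obtain ⟨C, hC, h⟩ := ih
    refine ⟨C + b + C * b, by positivity, fun τ h0 h1 => ?_⟩
    have := h τ h0 h1
    have h2 : C * b * (τ * τ) ≤ C * b * τ := by
      apply mul_le_mul_of_nonneg_left _ (by positivity); nlinarith
    calc (1 + a * τ) * (1 + b * τ) ^ (m + 1) = ((1 + a * τ) * (1 + b * τ) ^ m) * (1 + b * τ) := by
          ring
      _ ≤ (1 + C * τ) * (1 + b * τ) := by gcongr
      _ ≤ _ := by nlinarith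

theorem prod_div_one_add_le (m : ℕ) (a b c : ℝ) (ha : 0 ≤ a) (hb : 0 ≤ b)
    (hc : 0 < c) : ∃ C, 0 ≤ C ∧ ∀ (n : ℕ) (lam : Fin n → ℝ) (I : Finset (Fin n)) (τ q r : ℝ),
      (∀ i, 0 ≤ lam i) → I.card = m → 0 ≤ τ → τ ≤ 1 → 0 ≤ q → q ≤ 1 + b * τ → c * τ ≤ r →
      (1 + a * τ) * ∏ i ∈ I, (q * lam i / (1 + r * lam i)) ≤ ∏ i ∈ I, lam i + C * τ := by
  obtain ⟨C, hC, hCτ⟩ := one_add_mul_pow_le a b ha hb m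
  refine ⟨C * (C / c) ^ m, by positivity, ?_⟩
  intro n lam I τ q r hlam hI hτ0 hτ1 hq hq1 hr
  have hr0 : 0 ≤ r := le_trans (by positivity) hr
  have hC1 : (1 + a * τ) * q ^ m ≤ 1 + C * τ :=
    le_trans (by gcongr) (hCτ τ hτ0 hτ1)
  have hP0 : 0 ≤ ∏ i ∈ I, lam i := Finset.prod_nonneg fun i _ => hlam i
  have hsplit : (1 + a * τ) * ∏ i ∈ I, (q * lam i / (1 + r * lam i)) =
      ((1 + a * τ) * q ^ m) * ∏ i ∈ I, (lam i / (1 + r * lam i)) := by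
    rw [mul_assoc, ← hI, ← Finset.prod_const, ← Finset.prod_mul_distrib]
    congr 1
    refine Finset.prod_congr rfl fun i _ => by ring
  have hfac : ∀ i, lam i / (1 + r * lam i) ≤ lam i := fun i =>
    div_le_self (hlam i) (by have := hlam i; nlinarith [mul_nonneg hr0 this])
  have hfac0 : ∀ i, 0 ≤ lam i / (1 + r * lam i) := fun i => by
    have := hlam i; positivity
  rw [hsplit]
  by_cases hbig : ∃ i ∈ I, C / c ≤ lam i
  · obtain ⟨i, hiI, hi⟩ := hbig
    have h1 : ∏ j ∈ I, (lam j / (1 + r * lam j)) ≤ (∏ j ∈ I, lam j) / (1 + r * lam i) := by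
      rw [← Finset.mul_prod_erase I _ hiI, ← Finset.mul_prod_erase I lam hiI, div_mul_eq_mul_div]
      have := hlam i
      gcongr with j hj
      · exact fun j _ => hfac0 j
      · exact hfac j
    have h2 : 1 + C * τ ≤ 1 + r * lam i := by
      have : C ≤ c * lam i := by rwa [div_le_iff₀' hc] at hi
      have h3 : C * τ ≤ c * τ * lam i := by nlinarith
      nlinarith [hlam i]
    have h3 : 0 < 1 + r * lam i := by have := hlam i; positivity
    calc _ ≤ (1 + C * τ) * ((∏ j ∈ I, lam j) / (1 + r * lam i)) := by
          apply mul_le_mul hC1 h1 (Finset.prod_nonneg fun j _ => hfac0 j) (by positivity)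
      _ ≤ (1 + r * lam i) * ((∏ j ∈ I, lam j) / (1 + r * lam i)) := by gcongr
      _ = ∏ j ∈ I, lam j := by field_simp
      _ ≤ _ := by have : 0 ≤ C * (C / c) ^ m * τ := by positivity
                  linarith
  · push Not at hbig
    have h1 : ∏ j ∈ I, (lam j / (1 + r * lam j)) ≤ ∏ j ∈ I, lam j :=
      Finset.prod_le_prod (fun j _ => hfac0 j) fun j _ => hfac j
    have h2 : ∏ j ∈ I, lam j ≤ (C / c) ^ m := by
      rw [← hI, ← Finset.prod_const]
      exact Finset.prod_le_prod (fun j _ => hlam j) fun j hj => (hbig j hj).le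
    calc _ ≤ (1 + C * τ) * ∏ j ∈ I, lam j := by
          apply mul_le_mul hC1 h1 (Finset.prod_nonneg fun j _ => hfac0 j) (by positivity)
      _ = ∏ j ∈ I, lam j + C * (∏ j ∈ I, lam j) * τ := by ring
      _ ≤ _ := by gcongr

theorem esym_comparison (n m : ℕ) (hm1 : 1 ≤ m) (hmn : m ≤ n - 1) (a b c₀ : ℝ) (ha : 0 ≤ a)
    (hb : 0 ≤ b) (hc₀ : 0 < c₀) : ∃ C, 0 ≤ C ∧ ∀ (A B : Matrix (Fin n) (Fin n) ℝ)
      (s R c τ : ℝ), A.PosSemidef → B.PosSemidef → 0 < s → 0 < R → 0 ≤ c → 0 ≤ τ → τ ≤ 1 →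
      R ^ 2 * c / s ≤ 1 + b * τ → c₀ * τ ≤ R * c →
      (∀ ξ ω : En n, s * quadForm B ξ ≤ R * ‖ξ - R⁻¹ • ω‖ ^ 2 + c * quadForm A ω) →
      (1 + a * τ) * esym n m B ≤ esym n m A + C * τ := by
  obtain ⟨C, hC, h⟩ := prod_div_one_add_le m a b c₀ ha hb hc₀
  refine ⟨n.choose m * C, by positivity, ?_⟩
  intro A B s R c τ hA hB hs hR hc hτ0 hτ1 hq hr hAB
  have h1 := esym_le_of_parallel_sum hm1 hmn hA hB hs hR hc hAB
  calc (1 + a * τ) * esym n m B ≤ (1 + a * τ) * _ := by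
        apply mul_le_mul_of_nonneg_left h1; positivity
    _ = ∑ I ∈ Finset.univ.powersetCard m, (1 + a * τ) * ∏ i ∈ I, _ := by rw [Finset.mul_sum]
    _ ≤ ∑ I ∈ Finset.univ.powersetCard m,
        (∏ i ∈ I, hA.isHermitian.eigenvalues i + C * τ) := by
        refine Finset.sum_le_sum fun I hI => ?_
        exact h n _ I τ _ _ (fun i => hA.eigenvalues_nonneg i) (Finset.mem_powersetCard.1 hI).2
          hτ0 hτ1 (by positivity) hq hr
    _ = _ := by
        rw [Finset.sum_add_distrib, esym_hermitian (by omega) hA.isHermitian]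
        simp; ring

theorem esym_shift_lower_bound (n k : ℕ) (hk : k ≤ n) (C : ℝ) (hC : 0 ≤ C) :
    ∃ D, 0 ≤ D ∧ ∀ (M : Matrix (Fin n) (Fin n) ℝ), M.IsHermitian →
      (∀ ξ : En n, |quadForm M ξ| ≤ C * ‖ξ‖ ^ 2) →
      (∀ j, 1 ≤ j → j ≤ k → 0 ≤ esym n j M) → esym n k M = 1 →
      ∀ τ t : ℝ, 0 ≤ τ → τ ≤ 1 → 0 ≤ t →
        1 - D * τ ≤ esym n k (M + (t - τ) • (1 : Matrix (Fin n) (Fin n) ℝ)) := by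
  set B : ℕ → ℝ := fun i => ((n - k + (i + 1)).choose (n - k) : ℝ) *
    (n.choose (k - (i + 1)) * C ^ (k - (i + 1))) with hB
  refine ⟨∑ i ∈ Finset.range k, B i, Finset.sum_nonneg fun i _ => by positivity, ?_⟩
  intro M hM hMC hpos h1 τ t hτ0 hτ1 ht
  rw [esym_add_smul_one hk, Finset.sum_range_succ']
  simp only [add_zero, Nat.choose_self, Nat.cast_one, Nat.sub_zero, h1, pow_zero, mul_one]
  have hnn : ∀ i ∈ Finset.range k, 0 ≤ esym n (k - (i + 1)) M := by
    intro i hi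
    rcases Nat.eq_zero_or_pos (k - (i + 1)) with h | h
    · rw [h, esym_zero]; exact zero_le_one
    · exact hpos _ h (by omega)
  have hterm : ∀ i ∈ Finset.range k, -(B i * τ) ≤ ((n - k + (i + 1)).choose (n - k) : ℝ) *
      esym n (k - (i + 1)) M * (t - τ) ^ (i + 1) := by
    intro i hi
    have hb : 0 ≤ ((n - k + (i + 1)).choose (n - k) : ℝ) * esym n (k - (i + 1)) M :=
      mul_nonneg (Nat.cast_nonneg _) (hnn i hi)
    have hbB : ((n - k + (i + 1)).choose (n - k) : ℝ) * esym n (k - (i + 1)) M ≤ B i := by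
      rw [hB]
      apply mul_le_mul_of_nonneg_left _ (Nat.cast_nonneg _)
      exact (le_abs_self _).trans (abs_esym_le (by omega) hM hMC)
    have hB0 : 0 ≤ B i := hb.trans hbB
    rcases le_total τ t with h | h
    · have : 0 ≤ (t - τ) ^ (i + 1) := pow_nonneg (by linarith) _
      have := mul_nonneg hb this
      have := mul_nonneg hB0 hτ0
      linarith
    · have habs : |(t - τ) ^ (i + 1)| ≤ τ := by
        rw [abs_pow]
        have h1 : |t - τ| ≤ τ := abs_le.2 ⟨by linarith, by linarith⟩
        calc |t - τ| ^ (i + 1) ≤ τ ^ (i + 1) := by gcongr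
          _ ≤ τ ^ 1 := pow_le_pow_of_le_one hτ0 hτ1 (by omega)
          _ = τ := pow_one τ
      have h2 := neg_abs_le ((t - τ) ^ (i + 1))
      have h3 : ((n - k + (i + 1)).choose (n - k) : ℝ) * esym n (k - (i + 1)) M * τ ≤ B i * τ :=
        mul_le_mul_of_nonneg_right hbB hτ0
      nlinarith
  have := Finset.sum_le_sum hterm
  rw [Finset.sum_neg_distrib, ← Finset.sum_mul] at this
  linarith

/-- A quantitative strict monotonicity of the `k`-Hessian operator at admissible matrices. -/
theorem one_lt_esym_of_quadForm_ge (n k : ℕ) (hk1 : 1 ≤ k) (hkn : k ≤ n - 1) (C b : ℝ)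
    (hC : 0 ≤ C) (hb : 0 ≤ b) :
    ∃ a τ₀ : ℝ, 0 < a ∧ 0 < τ₀ ∧ τ₀ ≤ 1 ∧ ∀ (M N : Matrix (Fin n) (Fin n) ℝ),
      M.IsHermitian → N.IsHermitian →
      (∀ ξ : En n, |quadForm M ξ| ≤ C * ‖ξ‖ ^ 2) →
      (∀ j, 1 ≤ j → j ≤ k → 0 ≤ esym n j M) → esym n k M = 1 →
      ∀ τ : ℝ, 0 < τ → τ ≤ τ₀ →
      (∀ ξ : En n, (1 + a * τ) * (quadForm M ξ - b * τ * ‖ξ‖ ^ 2) ≤ quadForm N ξ) →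
      1 < esym n k N := by
  have hkn' : k ≤ n := by omega
  obtain ⟨D', hD', hD⟩ := esym_shift_lower_bound n k hkn' C hC
  set D := D' * b with hDdef
  have hD0 : 0 ≤ D := by positivity
  set a := 2 * D + 1 with ha
  refine ⟨a, 1 / ((a + 1) * (D + 1) * (b + 1)), by positivity, by positivity, ?_, ?_⟩
  · rw [div_le_one (by positivity)]
    have : 1 ≤ (a + 1) := by linarith
    have : 1 ≤ (D + 1) := by linarith
    have : 1 ≤ (b + 1) := by linarith
    have : 1 ≤ (a + 1) * (D + 1) := by nlinarith
    nlinarith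
  intro M N hM hN hMC hpos h1 τ hτ hττ₀ h
  rw [le_div_iff₀ (by positivity)] at hττ₀
  have hexp : τ * ((a + 1) * (D + 1) * (b + 1)) =
      (τ * (a + 1) * (D + 1)) * b + τ * (a + 1) * (D + 1) := by ring
  have hbτ : b * τ ≤ 1 := by
    have : τ * b ≤ (τ * (a + 1) * (D + 1)) * b := by
      apply mul_le_mul_of_nonneg_right _ hb
      have : 1 ≤ (a + 1) * (D + 1) := by nlinarith
      nlinarith
    have : 0 ≤ τ * (a + 1) * (D + 1) := by positivity
    nlinarith
  have haD : τ * (a + 1) * (D + 1) ≤ 1 := by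
    have : 0 ≤ (τ * (a + 1) * (D + 1)) * b := by positivity
    nlinarith
  have hlow : ∀ t : ℝ, 0 ≤ t →
      1 - D * τ ≤ esym n k (M + (t - b * τ) • (1 : Matrix (Fin n) (Fin n) ℝ)) := by
    intro t ht
    have := hD M hM hMC hpos h1 (b * τ) t (by positivity) hbτ ht
    rw [hDdef]; linarith
  have hDτ : D * τ < 1 := by nlinarith [mul_pos hτ (by positivity : 0 < a * (D + 1) + 1)]
  have hL : 0 < 1 + a * τ := by positivity
  set P : Matrix (Fin n) (Fin n) ℝ :=
    (1 + a * τ) • (M + (-(b * τ)) • (1 : Matrix (Fin n) (Fin n) ℝ)) with hP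
  have hone : (1 : Matrix (Fin n) (Fin n) ℝ).IsHermitian := Matrix.isHermitian_one
  have hPh : P.IsHermitian := by
    have h1 : ∀ (c : ℝ) {Q : Matrix (Fin n) (Fin n) ℝ}, Q.IsHermitian → (c • Q).IsHermitian := by
      intro c Q hQ
      rw [Matrix.IsHermitian, Matrix.conjTranspose_smul, hQ.eq]; simp
    exact h1 _ (hM.add (h1 _ hone))
  have hPt : ∀ t : ℝ, 0 ≤ t → (1 + a * τ) ^ k * (1 - D * τ) ≤
      esym n k (P + t • (1 : Matrix (Fin n) (Fin n) ℝ)) := by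
    intro t ht
    have : P + t • (1 : Matrix (Fin n) (Fin n) ℝ) =
        (1 + a * τ) • (M + (t / (1 + a * τ) - b * τ) • (1 : Matrix (Fin n) (Fin n) ℝ)) := by
      rw [hP, smul_add, smul_add, add_assoc, smul_smul, smul_smul, ← add_smul]
      congr 2
      field_simp; ring
    rw [this, esym_smul hkn' _ hL.ne']
    apply mul_le_mul_of_nonneg_left _ (by positivity)
    exact hlow _ (by positivity)
  have hPN : (N - P).PosSemidef := by
    apply posSemidef_of_quadForm_nonneg (hN.sub hPh)
    intro ξ
    rw [quadForm_sub, hP, quadForm_smul, quadForm_add, quadForm_smul, quadForm_one]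
    have := h ξ
    nlinarith
  have hfin := esym_mono hk1 hkn hPh (fun t ht =>
    lt_of_lt_of_le (by have : 0 < 1 - D * τ := by linarith
                       positivity) (hPt t ht.le)) hPN
  have h0 := hPt 0 le_rfl
  simp only [zero_smul, add_zero] at h0
  rw [add_sub_cancel] at hfin
  have hpow : 1 + a * τ ≤ (1 + a * τ) ^ k := by
    conv_lhs => rw [← pow_one (1 + a * τ)]
    exact pow_le_pow_right₀ (by nlinarith [mul_pos hτ (by positivity : 0 < a)]) hk1
  have h4 : (1 + a * τ) * (1 - D * τ) ≤ (1 + a * τ) ^ k * (1 - D * τ) :=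
    mul_le_mul_of_nonneg_right hpow (by linarith)
  have h5 : 1 < (1 + a * τ) * (1 - D * τ) := by
    have : a * τ * D < D + 1 := by nlinarith
    nlinarith
  linarith

/-- `φ` is differentiable near `0` and twice differentiable at `0`, with first and second
derivatives `a` and `b` at `0`. -/
def HasJetTwo {F : Type*} [NormedAddCommGroup F] [NormedSpace ℝ F] (φ : ℝ → F) (a b : F) : Prop :=
  ∃ φ' : ℝ → F, (∀ᶠ r in 𝓝 0, HasDerivAt φ (φ' r) r) ∧ φ' 0 = a ∧ HasDerivAt φ' b 0

namespace HasJetTwo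

variable {F : Type*} [NormedAddCommGroup F] [NormedSpace ℝ F]

theorem hasDerivAt {φ : ℝ → F} {a b : F} (h : HasJetTwo φ a b) : HasDerivAt φ a 0 := by
  obtain ⟨φ', h1, h2, h3⟩ := h
  rw [← h2]; exact h1.self_of_nhds

theorem const (c : F) : HasJetTwo (fun _ => c) 0 0 :=
  ⟨fun _ => 0, Eventually.of_forall fun r => hasDerivAt_const r c, rfl, hasDerivAt_const _ _⟩

theorem add {φ ψ : ℝ → F} {a b c d : F} (h : HasJetTwo φ a b) (g : HasJetTwo ψ c d) :
    HasJetTwo (fun r => φ r + ψ r) (a + c) (b + d) := by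
  obtain ⟨φ', h1, h2, h3⟩ := h
  obtain ⟨ψ', g1, g2, g3⟩ := g
  exact ⟨fun r => φ' r + ψ' r, by filter_upwards [h1, g1] with r hr gr using hr.add gr,
    by simp [h2, g2], h3.add g3⟩

theorem sub {φ ψ : ℝ → F} {a b c d : F} (h : HasJetTwo φ a b) (g : HasJetTwo ψ c d) :
    HasJetTwo (fun r => φ r - ψ r) (a - c) (b - d) := by
  obtain ⟨φ', h1, h2, h3⟩ := h
  obtain ⟨ψ', g1, g2, g3⟩ := g
  exact ⟨fun r => φ' r - ψ' r, by filter_upwards [h1, g1] with r hr gr using hr.sub gr,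
    by simp [h2, g2], h3.sub g3⟩

theorem const_mul {φ : ℝ → ℝ} {a b : ℝ} (h : HasJetTwo φ a b) (k : ℝ) :
    HasJetTwo (fun r => k * φ r) (k * a) (k * b) := by
  obtain ⟨φ', h1, h2, h3⟩ := h
  exact ⟨fun r => k * φ' r, by filter_upwards [h1] with r hr using hr.const_mul k,
    by simp [h2], h3.const_mul k⟩

theorem smul {φ : ℝ → ℝ} {ψ : ℝ → F} {a b : ℝ} {c d : F} (h : HasJetTwo φ a b)
    (g : HasJetTwo ψ c d) :
    HasJetTwo (fun r => φ r • ψ r) (φ 0 • c + a • ψ 0)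
      (φ 0 • d + (2 * a) • c + b • ψ 0) := by
  have hφ := h.hasDerivAt
  have hψ := g.hasDerivAt
  obtain ⟨φ', h1, rfl, h3⟩ := h
  obtain ⟨ψ', g1, rfl, g3⟩ := g
  refine ⟨fun r => φ r • ψ' r + φ' r • ψ r,
    by filter_upwards [h1, g1] with r hr gr using hr.smul gr, rfl, ?_⟩
  refine ((hφ.smul g3).add (h3.smul hψ)).congr_deriv ?_
  rw [two_mul, add_smul]; abel

theorem mul {φ ψ : ℝ → ℝ} {a b c d : ℝ} (h : HasJetTwo φ a b)
    (g : HasJetTwo ψ c d) :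
    HasJetTwo (fun r => φ r * ψ r) (φ 0 * c + a * ψ 0)
      (φ 0 * d + 2 * a * c + b * ψ 0) := h.smul g

theorem inv {φ : ℝ → ℝ} {a b : ℝ} (h : HasJetTwo φ a b) (h0 : φ 0 ≠ 0) :
    HasJetTwo (fun r => (φ r)⁻¹) (-a / φ 0 ^ 2) (2 * a ^ 2 / φ 0 ^ 3 - b / φ 0 ^ 2) := by
  have hφ := h.hasDerivAt
  obtain ⟨φ', h1, rfl, h3⟩ := h
  refine ⟨fun r => -φ' r / φ r ^ 2, ?_, rfl, ?_⟩
  · filter_upwards [h1, hφ.continuousAt.eventually_ne h0] with r hr hr0 using hr.inv hr0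
  · refine (h3.neg.div (hφ.pow 2) (pow_ne_zero 2 h0)).congr_deriv ?_
    simp only [Pi.neg_apply, Pi.pow_apply]
    field_simp; ring

theorem inner {E : Type*} [NormedAddCommGroup E] [InnerProductSpace ℝ E] {φ ψ : ℝ → E}
    {a b c d : E} (h : HasJetTwo φ a b) (g : HasJetTwo ψ c d) :
    HasJetTwo (fun r => ⟪φ r, ψ r⟫) (⟪φ 0, c⟫ + ⟪a, ψ 0⟫)
      (⟪φ 0, d⟫ + 2 * ⟪a, c⟫ + ⟪b, ψ 0⟫) := by
  have hφ := h.hasDerivAt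
  have hψ := g.hasDerivAt
  obtain ⟨φ', h1, rfl, h3⟩ := h
  obtain ⟨ψ', g1, rfl, g3⟩ := g
  refine ⟨fun r => ⟪φ r, ψ' r⟫ + ⟪φ' r, ψ r⟫,
    by filter_upwards [h1, g1] with r hr gr using hr.inner ℝ gr, rfl, ?_⟩
  refine ((hφ.inner ℝ g3).add (h3.inner ℝ hψ)).congr_deriv ?_
  ring

theorem line (x ξ : F) : HasJetTwo (fun r : ℝ => x + r • ξ) ξ 0 := by
  refine ⟨fun _ => ξ, Eventually.of_forall fun r => ?_, rfl, hasDerivAt_const _ _⟩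
  simpa using ((hasDerivAt_id r).smul_const ξ).const_add x

theorem comp {E : Type*} [NormedAddCommGroup E] [NormedSpace ℝ E] {u : E → ℝ} {γ : ℝ → E}
    {a b : E} (h : HasJetTwo γ a b) (hu : ContDiffAt ℝ 2 u (γ 0)) :
    HasJetTwo (fun r => u (γ r)) (fderiv ℝ u (γ 0) a)
      (fderiv ℝ (fderiv ℝ u) (γ 0) a a + fderiv ℝ u (γ 0) b) := by
  have hγ := h.hasDerivAt
  obtain ⟨γ', h1, rfl, h3⟩ := h
  have hdu : ∀ᶠ y in 𝓝 (γ 0), DifferentiableAt ℝ u y := by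
    filter_upwards [hu.eventually (by simp)] with y hy using hy.differentiableAt (by simp)
  refine ⟨fun r => fderiv ℝ u (γ r) (γ' r), ?_, rfl, ?_⟩
  · filter_upwards [h1, hγ.continuousAt.eventually hdu] with r hr hur
    exact hur.hasFDerivAt.comp_hasDerivAt r hr
  · have h2 : DifferentiableAt ℝ (fderiv ℝ u) (γ 0) :=
      (hu.fderiv_right (m := 1) (by norm_num)).differentiableAt (by simp)
    exact (h2.hasFDerivAt.comp_hasDerivAt (0 : ℝ) hγ).clm_apply h3

/-- The second derivative test. -/
theorem nonneg_of_isLocalMin {φ : ℝ → ℝ} {a b : ℝ} (h : HasJetTwo φ a b)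
    (hmin : IsLocalMin φ 0) : a = 0 ∧ 0 ≤ b := by
  have hφ := h.hasDerivAt
  have ha : a = 0 := hmin.hasDerivAt_eq_zero hφ
  refine ⟨ha, ?_⟩
  by_contra hb
  push Not at hb
  obtain ⟨φ', h1, h2, h3⟩ := h
  have hd : ∀ᶠ r in 𝓝 (0 : ℝ), HasDerivAt (fun r => -φ r + (b / 4) * r ^ 2)
      (-φ' r + (b / 4) * (2 * r)) r := by
    filter_upwards [h1] with r hr
    refine (hr.neg.add (((hasDerivAt_id r).pow 2).const_mul (b / 4))).congr_deriv ?_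
    simp
  have hdd : HasDerivAt (fun r => -φ' r + (b / 4) * (2 * r)) (-b + b / 4 * 2) 0 := by
    refine (h3.neg.add (((hasDerivAt_id (0:ℝ)).const_mul 2).const_mul (b / 4))).congr_deriv ?_
    simp
  have hderiv : deriv (fun r => -φ r + (b / 4) * r ^ 2) =ᶠ[𝓝 0]
      fun r => -φ' r + (b / 4) * (2 * r) := by
    filter_upwards [hd] with r hr using hr.deriv
  have hmin2 : IsLocalMin (fun r => -φ r + (b / 4) * r ^ 2) 0 := by
    apply isLocalMin_of_deriv_deriv_pos
    · rw [hderiv.deriv_eq, hdd.deriv]; linarith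
    · rw [hderiv.self_of_nhds]; simp [h2, ha]
    · exact hd.self_of_nhds.continuousAt
  have hboth := (hmin.and hmin2)
  obtain ⟨δ, hδ, hball⟩ := Metric.eventually_nhds_iff.1 hboth
  have := hball (y := δ / 2) (by rw [Real.dist_eq, sub_zero, abs_of_pos (by linarith)]; linarith)
  have hsq : 0 < (δ / 2) ^ 2 := by positivity
  nlinarith [this.1, this.2]

end HasJetTwo

theorem hessMat_apply {n : ℕ} (u : En n → ℝ) (y : En n) (i j : Fin n) :
    hessMat u y i j = fderiv ℝ (fderiv ℝ u) y (EuclideanSpace.single i (1:ℝ))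
      (EuclideanSpace.single j (1:ℝ)) := by
  simp [hessMat, iteratedFDeriv_two_apply]

theorem sum_smul_single {n : ℕ} (ξ : En n) :
    ∑ i, ξ i • EuclideanSpace.single i (1:ℝ) = ξ := by
  simpa using (EuclideanSpace.basisFun (Fin n) ℝ).sum_repr ξ

theorem quadForm_hessMat {n : ℕ} (u : En n → ℝ) (y ξ : En n) :
    quadForm (hessMat u y) ξ = fderiv ℝ (fderiv ℝ u) y ξ ξ := by
  conv_rhs => rw [← sum_smul_single ξ]
  simp only [quadForm, hessMat_apply, map_sum, map_smul, sum_apply,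
    smul_apply, smul_eq_mul]
  rw [Finset.sum_comm]
  refine Finset.sum_congr rfl fun i _ => ?_
  rw [Finset.mul_sum]
  refine Finset.sum_congr rfl fun j _ => ?_
  ring

theorem isHermitian_hessMat {n : ℕ} {u : En n → ℝ} {y : En n} (hu : ContDiffAt ℝ 2 u y) :
    (hessMat u y).IsHermitian := by
  ext i j
  have := hu.isSymmSndFDerivAt (by simp)
  simp [Matrix.conjTranspose_apply, hessMat_apply, this.eq]

theorem abs_fderiv_fderiv_le {n : ℕ} (u : En n → ℝ) (y : En n) (ξ ζ : En n) :
    |fderiv ℝ (fderiv ℝ u) y ξ ζ| ≤ ‖iteratedFDeriv ℝ 2 u y‖ * (‖ξ‖ * ‖ζ‖) := by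
  have h := (iteratedFDeriv ℝ 2 u y).le_opNorm ![ξ, ζ]
  simpa [iteratedFDeriv_two_apply, Fin.prod_univ_two] using h

theorem abs_quadForm_hessMat_le {n : ℕ} (u : En n → ℝ) (y ξ : En n) :
    |quadForm (hessMat u y) ξ| ≤ ‖iteratedFDeriv ℝ 2 u y‖ * ‖ξ‖ ^ 2 := by
  rw [quadForm_hessMat, sq]
  exact abs_fderiv_fderiv_le u y ξ ξ

theorem fderiv_eq_inner_gradient {n : ℕ} (u : En n → ℝ) (y ξ : En n) :
    fderiv ℝ u y ξ = ⟪gradient u y, ξ⟫ := by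
  simp [gradient]

theorem two_le_coe_top : (2 : WithTop ℕ∞) ≤ ((⊤ : ℕ∞) : WithTop ℕ∞) :=
  WithTop.coe_le_coe.2 (le_top (a := (2:ℕ∞)))

section SupportFunction

variable {n : ℕ} {K : Set (En n)}

theorem inner_le_suppFun (hK : IsCompact K) (x : En n) {z : En n} (hz : z ∈ K) :
    ⟪x, z⟫ ≤ suppFun K x :=
  le_csSup (hK.image (by fun_prop)).bddAbove (mem_image_of_mem _ hz)

theorem exists_inner_eq_suppFun (hK : IsCompact K) (hne : K.Nonempty) (x : En n) :
    ∃ y ∈ K, ⟪x, y⟫ = suppFun K x := by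
  have h := (hK.image (f := fun y => ⟪x, y⟫) (by fun_prop)).sSup_mem (hne.image _)
  obtain ⟨y, hy, h⟩ := h
  exact ⟨y, hy, h⟩

theorem suppFun_le_of_forall (hne : K.Nonempty) {x : En n} {c : ℝ}
    (h : ∀ z ∈ K, ⟪x, z⟫ ≤ c) : suppFun K x ≤ c :=
  csSup_le (hne.image _) (by rintro _ ⟨z, hz, rfl⟩; exact h z hz)

theorem suppFun_smul (hK : IsCompact K) (hne : K.Nonempty) {r : ℝ} (hr : 0 ≤ r) (x : En n) :
    suppFun K (r • x) = r * suppFun K x := by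
  apply le_antisymm
  · refine suppFun_le_of_forall hne fun z hz => ?_
    rw [real_inner_smul_left]
    exact mul_le_mul_of_nonneg_left (inner_le_suppFun hK x hz) hr
  · obtain ⟨y, hy, h⟩ := exists_inner_eq_suppFun hK hne x
    rw [← h, ← real_inner_smul_left]
    exact inner_le_suppFun hK _ hy

theorem mem_of_forall_inner_le (hK : IsCompact K) (hc : Convex ℝ K) (hne : K.Nonempty) {z : En n}
    (h : ∀ x : En n, ‖x‖ = 1 → ⟪x, z⟫ ≤ suppFun K x) : z ∈ K := by
  by_contra hz
  obtain ⟨g, c, hg, hgz⟩ := geometric_hahn_banach_closed_point hc hK.isClosed hz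
  set w := (InnerProductSpace.toDual ℝ (En n)).symm g with hw
  have hgw : ∀ y, g y = ⟪w, y⟫ := fun y => by simp [hw]
  have hw0 : w ≠ 0 := by
    intro h0
    obtain ⟨y, hy⟩ := hne
    have h1 := hg y hy
    rw [hgw, h0, inner_zero_left] at h1
    rw [hgw, h0, inner_zero_left] at hgz
    linarith
  have hwn : 0 < ‖w‖ := norm_pos_iff.2 hw0
  have h1 := h (‖w‖⁻¹ • w) (by rw [norm_smul, norm_inv, norm_norm, inv_mul_cancel₀ hwn.ne'])
  rw [suppFun_smul hK hne (by positivity), real_inner_smul_left] at h1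
  have h2 : ⟪w, z⟫ ≤ suppFun K w := le_of_mul_le_mul_left h1 (by positivity)
  have h3 : suppFun K w ≤ c := suppFun_le_of_forall hne fun y hy => by
    rw [← hgw]; exact (hg y hy).le
  rw [hgw] at hgz
  linarith

theorem eq_gradient_of_inner_eq (hK : IsCompact K) {x y : En n}
    (hd : DifferentiableAt ℝ (suppFun K) x) (hy : y ∈ K) (hxy : ⟪x, y⟫ = suppFun K x) :
    y = gradient (suppFun K) x := by
  have hmin : IsLocalMin (fun z => suppFun K z - ⟪y, z⟫) x := by
    refine Eventually.of_forall fun z => ?_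
    have := inner_le_suppFun hK z hy
    simp only [real_inner_comm z y, real_inner_comm x y, hxy, sub_self, ge_iff_le]
    linarith
  have h1 : HasFDerivAt (fun z => suppFun K z - ⟪y, z⟫)
      (fderiv ℝ (suppFun K) x - innerSL ℝ y) x :=
    hd.hasFDerivAt.sub (innerSL ℝ y).hasFDerivAt
  have h2 := hmin.hasFDerivAt_eq_zero h1
  have h3 : fderiv ℝ (suppFun K) x = InnerProductSpace.toDual ℝ (En n) y := by
    ext z
    simpa [sub_eq_zero] using congrArg (fun L => L z) h2
  rw [gradient, h3, LinearIsometryEquiv.symm_apply_apply]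

theorem gradient_suppFun_mem (hK : IsCompact K) (hne : K.Nonempty) {x : En n}
    (hd : DifferentiableAt ℝ (suppFun K) x) : gradient (suppFun K) x ∈ K := by
  obtain ⟨y, hy, h⟩ := exists_inner_eq_suppFun hK hne x
  rwa [← eq_gradient_of_inner_eq hK hd hy h]

theorem inner_gradient_suppFun (hK : IsCompact K) (hne : K.Nonempty) {x : En n}
    (hd : DifferentiableAt ℝ (suppFun K) x) :
    ⟪x, gradient (suppFun K) x⟫ = suppFun K x := by
  obtain ⟨y, hy, h⟩ := exists_inner_eq_suppFun hK hne x
  rwa [← eq_gradient_of_inner_eq hK hd hy h]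

end SupportFunction

section SmoothBody

variable {n : ℕ} {K : Set (En n)}

theorem IsConvexBodyO.nonempty (h : IsConvexBodyO n K) : K.Nonempty :=
  ⟨0, interior_subset h.zeroInt⟩

theorem IsSmoothStrictlyConvexBody.contDiffAt (h : IsSmoothStrictlyConvexBody n K) {x : En n}
    (hx : x ≠ 0) : ContDiffAt ℝ 2 (suppFun K) x :=
  ((h.suppSmooth x hx).contDiffAt (isOpen_compl_singleton.mem_nhds hx)).of_le
    two_le_coe_top

theorem IsSmoothStrictlyConvexBody.differentiableAt (h : IsSmoothStrictlyConvexBody n K) {x : En n}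
    (hx : x ≠ 0) : DifferentiableAt ℝ (suppFun K) x :=
  (h.contDiffAt hx).differentiableAt (by simp)

theorem IsSmoothStrictlyConvexBody.gradient_mem (h : IsSmoothStrictlyConvexBody n K) {x : En n}
    (hx : x ≠ 0) : gradient (suppFun K) x ∈ K :=
  gradient_suppFun_mem h.body.comp h.body.nonempty (h.differentiableAt hx)

theorem IsSmoothStrictlyConvexBody.inner_gradient (h : IsSmoothStrictlyConvexBody n K) {x : En n}
    (hx : x ≠ 0) : ⟪x, gradient (suppFun K) x⟫ = suppFun K x :=
  inner_gradient_suppFun h.body.comp h.body.nonempty (h.differentiableAt hx)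

theorem IsSmoothStrictlyConvexBody.gradient_smul (h : IsSmoothStrictlyConvexBody n K) {x : En n}
    (hx : x ≠ 0) {r : ℝ} (hr : 0 < r) :
    gradient (suppFun K) (r • x) = gradient (suppFun K) x := by
  have hrx : r • x ≠ 0 := smul_ne_zero hr.ne' hx
  refine eq_gradient_of_inner_eq h.body.comp (h.differentiableAt hx) (h.gradient_mem hrx) ?_
  have h1 := h.inner_gradient hrx
  rw [suppFun_smul h.body.comp h.body.nonempty hr.le, real_inner_smul_left] at h1
  exact mul_left_cancel₀ hr.ne' h1

theorem IsSmoothStrictlyConvexBody.fderiv_fderiv_self (h : IsSmoothStrictlyConvexBody n K)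
    {x : En n} (hx : x ≠ 0) : fderiv ℝ (fderiv ℝ (suppFun K)) x x = 0 := by
  have h2 : DifferentiableAt ℝ (fderiv ℝ (suppFun K)) x :=
    ((h.contDiffAt hx).fderiv_right (m := 1) (by norm_num)).differentiableAt (by simp)
  have hl : HasDerivAt (fun r : ℝ => r • x) x 1 := by
    simpa using (hasDerivAt_id (1:ℝ)).smul_const x
  have h2' : HasFDerivAt (fderiv ℝ (suppFun K)) (fderiv ℝ (fderiv ℝ (suppFun K)) x)
      ((1:ℝ) • x) := by rw [one_smul]; exact h2.hasFDerivAt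
  have h3 := h2'.comp_hasDerivAt (1:ℝ) hl
  have h4 : HasDerivAt (fun _ : ℝ => fderiv ℝ (suppFun K) x)
      (fderiv ℝ (fderiv ℝ (suppFun K)) x x) 1 := by
    refine h3.congr_of_eventuallyEq ?_
    filter_upwards [lt_mem_nhds (zero_lt_one' ℝ)] with r hr
    have := h.gradient_smul hx hr
    rw [gradient, gradient] at this
    exact ((InnerProductSpace.toDual ℝ (En n)).symm.injective this).symm
  exact h4.unique (hasDerivAt_const _ _)

theorem IsSmoothStrictlyConvexBody.fderiv_fderiv_symm (h : IsSmoothStrictlyConvexBody n K)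
    {x : En n} (hx : x ≠ 0) (ξ ζ : En n) :
    fderiv ℝ (fderiv ℝ (suppFun K)) x ξ ζ = fderiv ℝ (fderiv ℝ (suppFun K)) x ζ ξ :=
  ((h.contDiffAt hx).isSymmSndFDerivAt (by simp)).eq ξ ζ

theorem IsSmoothStrictlyConvexBody.quadForm_add_smul (h : IsSmoothStrictlyConvexBody n K)
    {x : En n} (hx : x ≠ 0) (ξ : En n) (a : ℝ) :
    quadForm (hessMat (suppFun K) x) (ξ + a • x) = quadForm (hessMat (suppFun K) x) ξ := by
  have h1 := h.fderiv_fderiv_self hx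
  have h2 := h.fderiv_fderiv_symm hx ξ x
  simp only [quadForm_hessMat, map_add, map_smul, add_apply, smul_apply, h1, h2]
  simp

theorem IsSmoothStrictlyConvexBody.quadForm_nonneg (h : IsSmoothStrictlyConvexBody n K)
    {x : En n} (hx : x ≠ 0) (ξ : En n) : 0 ≤ quadForm (hessMat (suppFun K) x) ξ := by
  have hY := h.gradient_mem hx
  have hin := h.inner_gradient hx
  set Y := gradient (suppFun K) x
  have hj := (HasJetTwo.line x ξ).comp (u := suppFun K) (by simpa using h.contDiffAt hx)
  have hl := HasJetTwo.inner (HasJetTwo.line x ξ) (HasJetTwo.const Y)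
  have hs := hj.sub hl
  have hm : IsLocalMin (fun r : ℝ => suppFun K (x + r • ξ) - ⟪x + r • ξ, Y⟫) 0 := by
    refine Eventually.of_forall fun r => ?_
    have := inner_le_suppFun h.body.comp (x + r • ξ) hY
    simp only [zero_smul, add_zero, hin, sub_self]
    linarith
  have := (hs.nonneg_of_isLocalMin hm).2
  rw [quadForm_hessMat]
  simpa using this

theorem IsSmoothStrictlyConvexBody.posSemidef (h : IsSmoothStrictlyConvexBody n K)
    {x : En n} (hx : x ≠ 0) : (hessMat (suppFun K) x).PosSemidef :=
  posSemidef_of_quadForm_nonneg (isHermitian_hessMat (h.contDiffAt hx)) (h.quadForm_nonneg hx)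

end SmoothBody

section Bounds

variable {n : ℕ} {K : Set (En n)} {C : ℝ}

theorem norm_le_of_suppFun_le (hK : IsCompact K) (hC : 0 ≤ C)
    (h : ∀ x : En n, ‖x‖ = 1 → suppFun K x ≤ C) {z : En n} (hz : z ∈ K) : ‖z‖ ≤ C := by
  rcases eq_or_ne z 0 with rfl | h0
  · simpa using hC
  have hp : 0 < ‖z‖ := norm_pos_iff.2 h0
  have h1 := inner_le_suppFun hK (‖z‖⁻¹ • z) hz
  have h2 := h (‖z‖⁻¹ • z) (by rw [norm_smul, norm_inv, norm_norm, inv_mul_cancel₀ hp.ne'])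
  rw [real_inner_smul_left, real_inner_self_eq_norm_sq, sq, ← mul_assoc,
    inv_mul_cancel₀ hp.ne', one_mul] at h1
  linarith

theorem abs_suppFun_sub_le (hK : IsCompact K) (hne : K.Nonempty)
    (h : ∀ z ∈ K, ‖z‖ ≤ C) (x x' : En n) : |suppFun K x - suppFun K x'| ≤ C * ‖x - x'‖ := by
  have key : ∀ a b : En n, suppFun K a - suppFun K b ≤ C * ‖a - b‖ := by
    intro a b
    obtain ⟨y, hy, hay⟩ := exists_inner_eq_suppFun hK hne a
    have h1 := inner_le_suppFun hK b hy
    have h2 := real_inner_le_norm (a - b) y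
    rw [inner_sub_left] at h2
    have h3 := mul_le_mul_of_nonneg_left (h y hy) (norm_nonneg (a - b))
    linarith
  rw [abs_le]
  have := key x' x
  rw [norm_sub_rev] at this
  exact ⟨by linarith, key x x'⟩

end Bounds

theorem quadForm_conj {n : ℕ} {A E : Matrix (Fin n) (Fin n) ℝ} (hE : E.IsHermitian) (ω : En n) :
    quadForm (E * A * E) ω = quadForm A (WithLp.toLp 2 (E *ᵥ ω.ofLp)) := by
  have hEt : Eᵀ = E := by rw [← Matrix.conjTranspose_eq_transpose_of_trivial]; exact hE.eq
  rw [quadForm_eq_dotProduct, quadForm_eq_dotProduct, mul_assoc, ← Matrix.mulVec_mulVec,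
    ← Matrix.mulVec_mulVec, Matrix.dotProduct_mulVec]
  conv_lhs => rw [← hEt, Matrix.vecMul_transpose, hEt]

theorem inner_eq_dotProduct {n : ℕ} (x y : En n) : ⟪x, y⟫ = x.ofLp ⬝ᵥ y.ofLp := by
  simp [PiLp.inner_apply, dotProduct, mul_comm]

theorem one_sub_smul_vecMulVec_mulVec {n : ℕ} (δ : ℝ) (Y ω : En n) :
    WithLp.toLp 2 ((1 - δ • Matrix.vecMulVec Y.ofLp Y.ofLp) *ᵥ ω.ofLp) =
      ω - (δ * ⟪Y, ω⟫) • Y := by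
  ext i
  simp [Matrix.sub_mulVec, Matrix.smul_mulVec, Matrix.vecMulVec_mulVec, inner_eq_dotProduct]
  ring

theorem isHermitian_one_sub_smul_vecMulVec {n : ℕ} (δ : ℝ) (Y : En n) :
    (1 - δ • Matrix.vecMulVec Y.ofLp Y.ofLp : Matrix (Fin n) (Fin n) ℝ).IsHermitian := by
  ext i j
  simp [Matrix.vecMulVec_apply, Matrix.one_apply, eq_comm, mul_comm]

theorem posSemidef_one_sub_sq {n : ℕ} {δ : ℝ} {Y : En n} (h0 : 0 ≤ δ) (h : δ * ‖Y‖ ^ 2 ≤ 2) :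
    (1 - (1 - δ • Matrix.vecMulVec Y.ofLp Y.ofLp) * (1 - δ • Matrix.vecMulVec Y.ofLp Y.ofLp) :
      Matrix (Fin n) (Fin n) ℝ).PosSemidef := by
  set E : Matrix (Fin n) (Fin n) ℝ := 1 - δ • Matrix.vecMulVec Y.ofLp Y.ofLp with hEdef
  have hE : E.IsHermitian := isHermitian_one_sub_smul_vecMulVec δ Y
  have hEE : (E * E).IsHermitian := by
    rw [Matrix.IsHermitian, Matrix.conjTranspose_mul, hE.eq]
  refine posSemidef_of_quadForm_nonneg (Matrix.isHermitian_one.sub hEE) fun ξ => ?_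
  have h1 := quadForm_conj (A := 1) hE ξ
  rw [mul_one] at h1
  rw [quadForm_sub, quadForm_one, h1, quadForm_one, hEdef, one_sub_smul_vecMulVec_mulVec,
    norm_sub_sq_real, real_inner_smul_right, norm_smul, Real.norm_eq_abs, mul_pow, sq_abs,
    real_inner_comm Y ξ]
  have : 0 ≤ δ * ⟪Y, ξ⟫ ^ 2 * (2 - δ * ‖Y‖ ^ 2) :=
    mul_nonneg (by positivity) (by linarith)
  nlinarith

section Touching

variable {n : ℕ} {K L : Set (En n)} {ε θ : ℝ} {x x' : En n}

theorem two_point_homogeneous (hK : IsConvexBodyO n K) (hL : IsConvexBodyO n L)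
    (hF : ∀ a b : En n, ‖a‖ = 1 → ‖b‖ = 1 →
      0 ≤ √(1 + 4 * ε * (θ * suppFun K b) ^ 2) - ⟪a, b⟫ - 2 * ε * (θ * suppFun K b) * suppFun L a)
    (hε : 0 ≤ ε) {R : ℝ} (hR : 0 < R) {a b : En n} (ha : a ≠ 0) (hb : b ≠ 0) :
    0 ≤ 1 / 2 * (R * ‖a‖ ^ 2 + R⁻¹ * (‖b‖ ^ 2 + 4 * ε * (θ * suppFun K b) ^ 2)) - ⟪a, b⟫
      - 2 * ε * (θ * suppFun K b) * suppFun L a := by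
  have ha' : 0 < ‖a‖ := norm_pos_iff.2 ha
  have hb' : 0 < ‖b‖ := norm_pos_iff.2 hb
  obtain ⟨r, hr⟩ : ∃ r, r = ‖a‖ := ⟨_, rfl⟩
  obtain ⟨s, hs⟩ : ∃ s, s = ‖b‖ := ⟨_, rfl⟩
  obtain ⟨a1, ha1⟩ : ∃ a1 : En n, a1 = r⁻¹ • a := ⟨_, rfl⟩
  obtain ⟨b1, hb1⟩ : ∃ b1 : En n, b1 = s⁻¹ • b := ⟨_, rfl⟩
  rw [← hr] at ha'
  rw [← hs] at hb'
  have hna : ‖a1‖ = 1 := by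
    rw [ha1, norm_smul, norm_inv, Real.norm_eq_abs, abs_of_pos ha', ← hr, inv_mul_cancel₀ ha'.ne']
  have hnb : ‖b1‖ = 1 := by
    rw [hb1, norm_smul, norm_inv, Real.norm_eq_abs, abs_of_pos hb', ← hs, inv_mul_cancel₀ hb'.ne']
  have hae : a = r • a1 := by rw [ha1, smul_smul, mul_inv_cancel₀ ha'.ne', one_smul]
  have hbe : b = s • b1 := by rw [hb1, smul_smul, mul_inv_cancel₀ hb'.ne', one_smul]
  have h := hF a1 b1 hna hnb
  rw [← hr, ← hs, hae, hbe, suppFun_smul hL.comp hL.nonempty ha'.le,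
    suppFun_smul hK.comp hK.nonempty hb'.le, real_inner_smul_left, real_inner_smul_right]
  set κ := θ * suppFun K b1
  set Q := √(1 + 4 * ε * κ ^ 2) with hQ
  have hQ2 : Q ^ 2 = 1 + 4 * ε * κ ^ 2 := Real.sq_sqrt (by positivity)
  have h1 : 0 ≤ r * s * (Q - ⟪a1, b1⟫ - 2 * ε * κ * suppFun L a1) := by positivity
  have h2 : r * s * Q ≤ 1 / 2 * (R * r ^ 2 + R⁻¹ * (s ^ 2 * Q ^ 2)) := by
    have : 0 ≤ R⁻¹ * (R * r - s * Q) ^ 2 := by positivity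
    have h3 : R⁻¹ * (R * r - s * Q) ^ 2
        = R * r ^ 2 + R⁻¹ * (s ^ 2 * Q ^ 2) - 2 * (r * s * Q) := by field_simp; ring
    linarith
  have h4 : s ^ 2 + 4 * ε * (θ * (s * suppFun K b1)) ^ 2 = s ^ 2 * Q ^ 2 := by
    rw [hQ2]; simp only [κ]; ring
  have h5 : 2 * ε * (θ * (s * suppFun K b1)) * (r * suppFun L a1)
      = r * s * (2 * ε * κ * suppFun L a1) := by simp only [κ]; ring
  rw [h4, h5]
  nlinarith

theorem two_point_jets (hK : IsSmoothStrictlyConvexBody n K) (hL : IsSmoothStrictlyConvexBody n L)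
    (hx : ‖x‖ = 1) (hx' : ‖x'‖ = 1) (hε : 0 ≤ ε)
    (hF : ∀ a b : En n, ‖a‖ = 1 → ‖b‖ = 1 →
      0 ≤ √(1 + 4 * ε * (θ * suppFun K b) ^ 2) - ⟪a, b⟫ - 2 * ε * (θ * suppFun K b) * suppFun L a)
    (h0 : √(1 + 4 * ε * (θ * suppFun K x') ^ 2) - ⟪x, x'⟫
      - 2 * ε * (θ * suppFun K x') * suppFun L x = 0)
    {R κ h : ℝ} (hR : R = √(1 + 4 * ε * (θ * suppFun K x') ^ 2)) (hκ : κ = θ * suppFun K x')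
    (hh : h = suppFun L x) {X Y : En n} (hX : X = gradient (suppFun K) x')
    (hY : Y = gradient (suppFun L) x) (ξ ζ : En n) :
    R * ⟪x, ξ⟫ + R⁻¹ * (⟪x', ζ⟫ + 4 * ε * κ * (θ * ⟪X, ζ⟫)) - ⟪x, ζ⟫ - ⟪ξ, x'⟫
      - 2 * ε * (κ * ⟪Y, ξ⟫ + θ * ⟪X, ζ⟫ * h) = 0 ∧
    0 ≤ R * ‖ξ‖ ^ 2 + R⁻¹ * (‖ζ‖ ^ 2 + 4 * ε * ((θ * ⟪X, ζ⟫) ^ 2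
        + κ * (θ * quadForm (hessMat (suppFun K) x') ζ))) - 2 * ⟪ξ, ζ⟫
      - 2 * ε * (κ * quadForm (hessMat (suppFun L) x) ξ + 2 * (θ * ⟪X, ζ⟫) * ⟪Y, ξ⟫
        + θ * quadForm (hessMat (suppFun K) x') ζ * h) := by
  have hx0 : x ≠ 0 := norm_ne_zero_iff.1 (by rw [hx]; exact one_ne_zero)
  have hx0' : x' ≠ 0 := norm_ne_zero_iff.1 (by rw [hx']; exact one_ne_zero)
  have hR2 : R ^ 2 = 1 + 4 * ε * κ ^ 2 := by rw [hR, hκ]; exact Real.sq_sqrt (by positivity)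
  have hRp : 0 < R := by rw [hR]; exact Real.sqrt_pos.2 (by positivity)
  have jL := (HasJetTwo.line x ξ).comp (u := suppFun L) (by simpa using hL.contDiffAt hx0)
  have jK := ((HasJetTwo.line x' ζ).comp (u := suppFun K)
    (by simpa using hK.contDiffAt hx0')).const_mul θ
  have jxx := HasJetTwo.inner (HasJetTwo.line x ξ) (HasJetTwo.line x ξ)
  have jzz := HasJetTwo.inner (HasJetTwo.line x' ζ) (HasJetTwo.line x' ζ)
  have jxz := HasJetTwo.inner (HasJetTwo.line x ξ) (HasJetTwo.line x' ζ)
  have J := ((((jxx.const_mul R).add ((jzz.add ((jK.mul jK).const_mul (4 * ε))).const_mul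
    R⁻¹)).const_mul (1 / 2)).sub jxz).sub ((jK.mul jL).const_mul (2 * ε))
  have hmin := J.nonneg_of_isLocalMin (by
    have e1 : ∀ᶠ r : ℝ in 𝓝 0, x + r • ξ ≠ 0 := by
      refine ContinuousAt.eventually_ne (by fun_prop) (by simpa using hx0)
    have e2 : ∀ᶠ r : ℝ in 𝓝 0, x' + r • ζ ≠ 0 := by
      refine ContinuousAt.eventually_ne (by fun_prop) (by simpa using hx0')
    filter_upwards [e1, e2] with r h1 h2
    have h3 := two_point_homogeneous hK.body hL.body hF hε hRp h1 h2
    simp only [zero_smul, add_zero, real_inner_self_eq_norm_sq, hx, hx', ← hκ, ← hh]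
    rw [← hR, ← hκ, ← hh] at h0
    have h4 : 1 / 2 * (R * 1 ^ 2 + R⁻¹ * (1 ^ 2 + 4 * ε * (κ * κ))) = R := by
      rw [show (1:ℝ) ^ 2 + 4 * ε * (κ * κ) = R ^ 2 by rw [hR2]; ring]
      field_simp; norm_num
    rw [h4]
    calc R - ⟪x, x'⟫ - 2 * ε * (κ * h) = 0 := by linarith
      _ ≤ _ := by linarith)
  simp only [zero_smul, add_zero, ← hκ, ← hh, fderiv_eq_inner_gradient, ← hX, ← hY, 
    ← quadForm_hessMat, map_zero, inner_zero_left, inner_zero_right,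
    real_inner_self_eq_norm_sq] at hmin
  obtain ⟨hm1, hm2⟩ := hmin
  rw [real_inner_comm x ξ, real_inner_comm x' ζ] at hm1
  constructor
  · linarith
  · linarith

end Touching

/-- The geometric relations at a zero of the two-point function. -/
structure TouchingData (n : ℕ) (K L : Set (En n)) (ε θ : ℝ) (x x' : En n) (R κ h y : ℝ)
    (X Y : En n) : Prop where
  xdir : R • x = x' + (2 * ε * κ) • Y
  parallel : Y = ((1 - y) * θ) • X
  height : R * h = κ * (1 + y)
  hess : ∀ ξ ω : En n, 2 * ε * κ * quadForm (hessMat (suppFun L) x) ξ ≤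
    R * ‖ξ - R⁻¹ • ω‖ ^ 2 + 2 * ε * h * (1 - y) / (1 + y) * θ *
      quadForm (hessMat (suppFun K) x') (ω - (2 * ε / (1 + y) * ⟪Y, ω⟫) • Y)

section Touching

variable {n : ℕ} {K L : Set (En n)} {ε θ : ℝ} {x x' : En n}

theorem touchingData (hK : IsSmoothStrictlyConvexBody n K) (hL : IsSmoothStrictlyConvexBody n L)
    (hx : ‖x‖ = 1) (hx' : ‖x'‖ = 1) (hε' : 0 < ε)
    (hF : ∀ a b : En n, ‖a‖ = 1 → ‖b‖ = 1 →
      0 ≤ √(1 + 4 * ε * (θ * suppFun K b) ^ 2) - ⟪a, b⟫ - 2 * ε * (θ * suppFun K b) * suppFun L a)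
    (h0 : √(1 + 4 * ε * (θ * suppFun K x') ^ 2) - ⟪x, x'⟫
      - 2 * ε * (θ * suppFun K x') * suppFun L x = 0)
    {R κ h y : ℝ} (hR : R = √(1 + 4 * ε * (θ * suppFun K x') ^ 2)) (hκ : κ = θ * suppFun K x')
    (hh : h = suppFun L x) {X Y : En n} (hX : X = gradient (suppFun K) x')
    (hY : Y = gradient (suppFun L) x) (hy : y = ε * ‖Y‖ ^ 2) (hy1 : y < 1) (hκp : 0 < κ)
    (hhp : 0 < h) :
    TouchingData n K L ε θ x x' R κ h y X Y := by
  have hε : 0 ≤ ε := hε'.le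
  have hx0 : x ≠ 0 := norm_ne_zero_iff.1 (by rw [hx]; exact one_ne_zero)
  have hx0' : x' ≠ 0 := norm_ne_zero_iff.1 (by rw [hx']; exact one_ne_zero)
  have hR2 : R ^ 2 = 1 + 4 * ε * κ ^ 2 := by rw [hR, hκ]; exact Real.sq_sqrt (by positivity)
  have hRp : 0 < R := by rw [hR]; exact Real.sqrt_pos.2 (by positivity)
  have hR0 := hRp.ne'
  have hJ := two_point_jets hK hL hx hx' hε hF h0 hR hκ hh hX hY
  have hxY : ⟪x, Y⟫ = h := by rw [hY, hL.inner_gradient hx0, hh]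
  have hxX : ⟪x', X⟫ * θ = κ := by rw [hX, hK.inner_gradient hx0', hκ, mul_comm]
  have hy0 : 0 ≤ y := by rw [hy]; positivity
  have e1 : R • x = x' + (2 * ε * κ) • Y := by
    refine ext_inner_right ℝ fun ξ => ?_
    have := (hJ ξ 0).1
    simp only [inner_zero_right, mul_zero, add_zero, zero_mul, sub_zero] at this
    rw [inner_add_left, real_inner_smul_left, real_inner_smul_left, real_inner_comm ξ x']
    linarith
  have e2 : x' + (4 * ε * κ * θ) • X = R • x + (2 * ε * θ * h * R) • X := by
    refine ext_inner_right ℝ fun ζ => ?_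
    have := (hJ 0 ζ).1
    simp only [inner_zero_right, inner_zero_left, mul_zero, zero_add, sub_zero] at this
    simp only [inner_add_left, real_inner_smul_left]
    field_simp at this
    linarith
  have e3 : (2 * ε) • (κ • Y) = (2 * ε) • (((2 * κ - h * R) * θ) • X) := by
    have : x' + (4 * ε * κ * θ) • X = x' + (2 * ε * κ) • Y + (2 * ε * θ * h * R) • X := by
      rw [e2, e1]
    have h2 : (2 * ε * κ) • Y = (4 * ε * κ * θ) • X - (2 * ε * θ * h * R) • X := by
      rw [add_assoc] at this
      rw [eq_sub_iff_add_eq]; exact (add_left_cancel this).symm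
    rw [smul_smul, h2, ← sub_smul, smul_smul]
    congr 1; ring
  have i1 : R * h = ⟪x', Y⟫ + 2 * ε * κ * ‖Y‖ ^ 2 := by
    have := congrArg (fun v => ⟪v, Y⟫) e1
    simp only [inner_add_left, real_inner_smul_left, hxY, real_inner_self_eq_norm_sq] at this
    exact this
  have e4 : κ • Y = ((2 * κ - h * R) * θ) • X :=
    smul_right_injective _ (by positivity : 2 * ε ≠ 0) e3
  have i2 : ⟪x', Y⟫ = 2 * κ - h * R := by
    have := congrArg (fun v => ⟪x', v⟫) e4
    simp only [real_inner_smul_right] at this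
    refine mul_left_cancel₀ hκp.ne' ?_
    calc κ * ⟪x', Y⟫ = (2 * κ - h * R) * (⟪x', X⟫ * θ) := by rw [this]; ring
      _ = _ := by rw [hxX]; ring
  have i3 : R * h = κ * (1 + y) := by rw [hy]; linarith
  have e5 : Y = ((1 - y) * θ) • X := by
    refine smul_right_injective _ hκp.ne' ?_
    simp only [e4, smul_smul]
    congr 1
    rw [mul_comm h R, i3]; ring
  refine ⟨e1, e5, i3, fun ξ ω => ?_⟩
  obtain ⟨γ, hγ⟩ : ∃ γ, γ = -⟪Y, ω⟫ / h := ⟨_, rfl⟩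
  have hγh : γ * h = -⟪Y, ω⟫ := by rw [hγ]; field_simp
  have hYζ : ⟪Y, ω + γ • x⟫ = 0 := by
    rw [inner_add_right, real_inner_smul_right, real_inner_comm x Y, hxY, hγh]; ring
  have hXζ : θ * ⟪X, ω + γ • x⟫ = 0 := by
    rw [e5, real_inner_smul_left, mul_assoc] at hYζ
    exact (mul_eq_zero.1 hYζ).resolve_left (by linarith)
  have hq := (hJ (ξ + (R⁻¹ * γ) • x) (ω + γ • x)).2
  have hsub : ξ + (R⁻¹ * γ) • x - R⁻¹ • (ω + γ • x) = ξ - R⁻¹ • ω := by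
    rw [smul_add, smul_smul]; abel
  have hnorm : R * ‖ξ - R⁻¹ • ω‖ ^ 2 = R * ‖ξ + (R⁻¹ * γ) • x‖ ^ 2
      + R⁻¹ * ‖ω + γ • x‖ ^ 2 - 2 * ⟪ξ + (R⁻¹ * γ) • x, ω + γ • x⟫ := by
    rw [← hsub, norm_sub_sq_real, real_inner_smul_right, norm_smul, norm_inv, Real.norm_eq_abs,
      abs_of_pos hRp]
    field_simp
    ring
  have hζ : ω + γ • x = (ω - (2 * ε / (1 + y) * ⟪Y, ω⟫) • Y) + (γ * R⁻¹) • x' := by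
    have h1 : x = R⁻¹ • (x' + (2 * ε * κ) • Y) := by
      rw [← e1, smul_smul, inv_mul_cancel₀ hR0, one_smul]
    have h2 : γ * (R⁻¹ * (2 * ε * κ)) = -(2 * ε / (1 + y) * ⟪Y, ω⟫) := by
      have h1y : 1 + y ≠ 0 := by positivity
      have h3 : ⟪Y, ω⟫ = -(γ * h) := by linarith
      rw [h3]
      field_simp
      linear_combination (-γ) * i3
    conv_lhs => rw [h1]
    rw [smul_smul, smul_add, smul_smul, mul_assoc, h2, neg_smul]
    abel
  rw [hXζ, hL.quadForm_add_smul hx0] at hq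
  rw [hnorm]
  rw [show quadForm (hessMat (suppFun K) x') (ω + γ • x)
    = quadForm (hessMat (suppFun K) x') (ω - (2 * ε / (1 + y) * ⟪Y, ω⟫) • Y) by
      rw [hζ, hK.quadForm_add_smul hx0']] at hq
  set q := quadForm (hessMat (suppFun K) x') (ω - (2 * ε / (1 + y) * ⟪Y, ω⟫) • Y)
  have hc : 2 * ε * h * (1 - y) / (1 + y) * θ * q
      = R⁻¹ * (4 * ε * (κ * (θ * q))) - 2 * ε * (θ * q * h) := by
    have h1y : 1 + y ≠ 0 := by positivity
    field_simp
    linear_combination 4 * θ * q * i3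
  rw [hc]
  linarith

end Touching

theorem esym_le_of_touchingData (n m : ℕ) (hm1 : 1 ≤ m) (hmn : m ≤ n - 1) (a b c₀ : ℝ)
    (ha : 0 ≤ a) (hb : 0 ≤ b) (hc₀ : 0 < c₀) :
    ∃ C : ℝ, 0 ≤ C ∧ ∀ (K L : Set (En n)) (ε θ : ℝ) (x x' : En n) (R κ h y : ℝ) (X Y : En n)
      (τ : ℝ), IsSmoothStrictlyConvexBody n K → IsSmoothStrictlyConvexBody n L → x ≠ 0 → x' ≠ 0 →
      TouchingData n K L ε θ x x' R κ h y X Y → 0 < ε → 0 < θ → 0 < κ → 0 < h → 0 < R →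
      y = ε * ‖Y‖ ^ 2 → y ≤ 1 / 4 → 0 ≤ τ → τ ≤ 1 → R * (1 - y) * θ ≤ 1 + b * τ →
      c₀ * τ ≤ R * (2 * ε * h * (1 - y) / (1 + y) * θ) →
      (1 + a * τ) * esym n m (hessMat (suppFun L) x) ≤
        esym n m (hessMat (suppFun K) x') + C * τ := by
  obtain ⟨C, hC, H⟩ := esym_comparison n m hm1 hmn a b c₀ ha hb hc₀
  refine ⟨C, hC, ?_⟩
  intro K L ε θ x x' R κ h y X Y τ hK hL hx hx' D hε hθ hκ hh hR hy hy4 hτ hτ1 h1 h2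
  have hy0 : 0 ≤ y := by rw [hy]; positivity
  have hδ : 0 ≤ 2 * ε / (1 + y) := by positivity
  have hδY : 2 * ε / (1 + y) * ‖Y‖ ^ 2 ≤ 2 := by
    rw [div_mul_eq_mul_div, div_le_iff₀ (by positivity), mul_assoc, ← hy]; linarith
  have hA := hK.posSemidef hx'
  have hE := isHermitian_one_sub_smul_vecMulVec (2 * ε / (1 + y)) Y
  have hle := esym_conj_le hm1 hmn hA hE (posSemidef_one_sub_sq hδ hδY)
  set E : Matrix (Fin n) (Fin n) ℝ :=
    1 - (2 * ε / (1 + y)) • Matrix.vecMulVec Y.ofLp Y.ofLp with hEdef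
  have hEA : (E * hessMat (suppFun K) x' * E).PosSemidef := by
    have := hA.mul_mul_conjTranspose_same E
    rwa [hE.eq] at this
  have h1y : 0 < 1 - y := by linarith
  have hc : 0 ≤ 2 * ε * h * (1 - y) / (1 + y) * θ := by positivity
  have hcomp := H (E * hessMat (suppFun K) x' * E) (hessMat (suppFun L) x) (2 * ε * κ) R
    (2 * ε * h * (1 - y) / (1 + y) * θ) τ hEA (hL.posSemidef hx) (by positivity) hR hc hτ hτ1
    (by
      have : R ^ 2 * (2 * ε * h * (1 - y) / (1 + y) * θ) / (2 * ε * κ) = R * (1 - y) * θ := by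
        have hp := D.height
        have h1y : 1 + y ≠ 0 := by positivity
        field_simp
        linear_combination hp
      rw [this]; exact h1) h2
    (fun ξ ω => by
      rw [quadForm_conj hE, hEdef, one_sub_smul_vecMulVec_mulVec]
      exact D.hess ξ ω)
  linarith

theorem esym_one_eq_trace {n : ℕ} (hn : 1 ≤ n) (M : Matrix (Fin n) (Fin n) ℝ) :
    esym n 1 M = M.trace := by
  have : Nonempty (Fin n) := ⟨⟨0, hn⟩⟩
  have h := Matrix.trace_eq_neg_charpoly_coeff M
  rw [Fintype.card_fin] at h
  rw [esym, h]; ring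

theorem trace_eq_sum_quadForm {n : ℕ} (M : Matrix (Fin n) (Fin n) ℝ) :
    M.trace = ∑ i, quadForm M (EuclideanSpace.single i (1:ℝ)) := by
  simp [Matrix.trace, quadForm, mul_ite]

theorem IsAdmissibleSolution.nonpos {n k : ℕ} (hk1 : 1 ≤ k) (hkn : k ≤ n - 1) {K : Set (En n)}
    {u : En n → ℝ} (hK : IsConvexBodyO n K) (h : IsAdmissibleSolution n k K u) {z : En n}
    (hz : z ∈ K) : u z ≤ 0 := by
  by_contra hu
  push Not at hu
  obtain ⟨C, hC⟩ := hK.comp.isBounded.exists_norm_le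
  obtain ⟨δ, hδ, hδC⟩ : ∃ δ : ℝ, 0 < δ ∧ δ * C ^ 2 < u z := by
    refine ⟨u z / (C ^ 2 + 1), by positivity, ?_⟩
    rw [div_mul_eq_mul_div, div_lt_iff₀ (by positivity)]
    nlinarith
  have hcu : Continuous u := h.smooth.continuous
  obtain ⟨w, hw, hmax⟩ := hK.comp.exists_isMaxOn ⟨z, hz⟩
    (f := fun y => u y + δ * ‖y‖ ^ 2) (by fun_prop)
  have hwz : u z + δ * ‖z‖ ^ 2 ≤ u w + δ * ‖w‖ ^ 2 := hmax hz
  have hw2 : ‖w‖ ^ 2 ≤ C ^ 2 := by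
    have := hC w hw
    gcongr
  have hwi : w ∈ interior K := by
    by_contra hwi
    have hfr : w ∈ frontier K := ⟨subset_closure hw, hwi⟩
    have := h.bd w hfr
    have h1 : 0 ≤ δ * ‖z‖ ^ 2 := by positivity
    nlinarith [mul_le_mul_of_nonneg_left hw2 hδ.le]
  have hmin : ∀ ξ : En n, quadForm (hessMat u w) ξ ≤ -(2 * δ) * ‖ξ‖ ^ 2 := by
    intro ξ
    have hl := HasJetTwo.line w ξ
    have j1 := hl.comp (u := u)
      (by simpa using (h.smooth.contDiffAt (x := w)).of_le two_le_coe_top)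
    have j2 := (hl.inner hl).const_mul δ
    have j := (HasJetTwo.const (0:ℝ)).sub (j1.add j2)
    have hloc : IsLocalMin (fun r : ℝ => (0:ℝ) - (u (w + r • ξ) +
        δ * ⟪w + r • ξ, w + r • ξ⟫)) 0 := by
      have hev : ∀ᶠ r : ℝ in 𝓝 0, w + r • ξ ∈ K := by
        have hc : ContinuousAt (fun r : ℝ => w + r • ξ) 0 := by fun_prop
        exact hc.eventually_mem (by simpa using mem_interior_iff_mem_nhds.1 hwi)
      filter_upwards [hev] with r hr
      have := hmax hr
      simp only [mem_ofPred_eq] at this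
      simp only [real_inner_self_eq_norm_sq, zero_smul, add_zero]
      linarith
    have := (j.nonneg_of_isLocalMin hloc).2
    simp only [zero_smul, add_zero, map_zero, inner_zero_right, inner_zero_left,
      real_inner_self_eq_norm_sq, ← quadForm_hessMat] at this
    linarith
  have hn : 1 ≤ n := by omega
  have h1 := h.kconv w hwi 1 le_rfl hk1
  rw [esym_one_eq_trace hn, trace_eq_sum_quadForm] at h1
  have : Nonempty (Fin n) := ⟨⟨0, hn⟩⟩
  have h2 : ∑ i : Fin n, quadForm (hessMat u w) (EuclideanSpace.single i (1:ℝ)) < 0 := by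
    refine Finset.sum_neg (fun i _ => ?_) Finset.univ_nonempty
    have := hmin (EuclideanSpace.single i (1:ℝ))
    simp at this
    linarith
  linarith

theorem norm_fderiv_fderiv_le {n : ℕ} (u : En n → ℝ) (y : En n) :
    ‖fderiv ℝ (fderiv ℝ u) y‖ ≤ ‖iteratedFDeriv ℝ 2 u y‖ := by
  refine ContinuousLinearMap.opNorm_le_bound₂ _ (norm_nonneg _) fun ξ ζ => ?_
  rw [mul_assoc]
  exact abs_fderiv_fderiv_le u y ξ ζ

theorem norm_gradient_sub_le {n : ℕ} {u : En n → ℝ} {K : Set (En n)} {C : ℝ}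
    (hu : ContDiff ℝ (⊤ : ℕ∞) u) (hK : Convex ℝ K)
    (hC : ∀ y ∈ K, ‖iteratedFDeriv ℝ 2 u y‖ ≤ C) {y z : En n} (hy : y ∈ K) (hz : z ∈ K) :
    ‖gradient u z - gradient u y‖ ≤ C * ‖z - y‖ := by
  have h2 : ContDiff ℝ 1 (fderiv ℝ u) :=
    (hu.of_le two_le_coe_top).fderiv_right (m := 1) (by norm_num)
  have := hK.norm_image_sub_le_of_norm_fderiv_le (f := fderiv ℝ u) (𝕜 := ℝ)
    (fun w _ => (h2.differentiable (by simp)) w)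
    (fun w hw => (norm_fderiv_fderiv_le u w).trans (hC w hw)) hy hz
  simpa [gradient, ← map_sub] using this

theorem projective_jet {n : ℕ} {C c ε τ : ℝ} {Z : En n} (ξ : En n) (hC : ‖Z‖ ≤ C) (hε : 0 ≤ ε)
    (hετ : ε ≤ τ) (hτ : τ ≤ 1) (hc : |c - 1| ≤ τ) (hεC : ε * C ^ 2 ≤ 1 / 2) :
    ∃ a b, HasJetTwo (fun r : ℝ => (c * (1 - ε * ⟪Z + r • ξ, Z + r • ξ⟫)⁻¹) • (Z + r • ξ)) a b ∧
      ‖a - ξ‖ ≤ (2 + 18 * C ^ 2) * τ * ‖ξ‖ ∧ ‖b‖ ≤ 112 * C * τ * ‖ξ‖ ^ 2 := by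
  have hl := HasJetTwo.line Z ξ
  have hq := (HasJetTwo.const (1:ℝ)).sub ((hl.inner hl).const_mul ε)
  have hC0 : 0 ≤ C := (norm_nonneg _).trans hC
  have hZ2 : ε * ‖Z‖ ^ 2 ≤ ε * C ^ 2 := by gcongr
  have hq0 : (1:ℝ) - ε * ⟪Z + (0:ℝ) • ξ, Z + (0:ℝ) • ξ⟫ ≠ 0 := by
    rw [zero_smul, add_zero, real_inner_self_eq_norm_sq]; linarith
  have hj := ((hq.inv hq0).const_mul c).smul hl
  obtain ⟨q, hq⟩ : ∃ q, q = 1 - ε * ‖Z‖ ^ 2 := ⟨_, rfl⟩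
  obtain ⟨w, hw⟩ : ∃ w, w = ⟪Z, ξ⟫ := ⟨_, rfl⟩
  have hqh : 1 / 2 ≤ q := by linarith
  have hqp : 0 < q := by linarith
  have hq1 : q ≤ 1 := by
    have : 0 ≤ ε * ‖Z‖ ^ 2 := by positivity
    linarith
  have hqi : q⁻¹ ≤ 2 := by
    rw [inv_le_comm₀ hqp (by norm_num)]; linarith
  have hqi0 : 0 ≤ q⁻¹ := by positivity
  have hwC : |w| ≤ C * ‖ξ‖ := by
    rw [hw]
    exact (abs_real_inner_le_norm _ _).trans (by gcongr)
  have hc2 : |c| ≤ 2 := by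
    have := abs_le.1 hc
    rw [abs_le]; constructor <;> linarith
  have hτ0 : 0 ≤ τ := hε.trans hετ
  refine ⟨(c * q⁻¹) • ξ + (2 * c * ε * w * q⁻¹ ^ 2) • Z,
    (4 * c * ε * w * q⁻¹ ^ 2) • ξ
      + (c * (8 * ε * (ε * w ^ 2) * q⁻¹ ^ 3 + 2 * ε * ‖ξ‖ ^ 2 * q⁻¹ ^ 2)) • Z, ?_, ?_, ?_⟩
  · convert hj using 1
    · simp only [zero_smul, add_zero, real_inner_self_eq_norm_sq]
      rw [real_inner_comm Z ξ, ← hq, ← hw]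
      congr 2
      field_simp; ring
    · simp only [zero_smul, add_zero, real_inner_self_eq_norm_sq, inner_zero_left,
        inner_zero_right, zero_add, smul_zero]
      rw [real_inner_comm Z ξ, ← hq, ← hw]
      congr 2
      · field_simp; ring
      · field_simp; ring
  · have h1 : (c * q⁻¹) • ξ + (2 * c * ε * w * q⁻¹ ^ 2) • Z - ξ
        = (c * q⁻¹ - 1) • ξ + (2 * c * ε * w * q⁻¹ ^ 2) • Z := by
      rw [sub_smul, one_smul]; abel
    have h2 : |c * q⁻¹ - 1| ≤ 2 * (τ + τ * C ^ 2) := by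
      have h3 : c * q⁻¹ - 1 = ((c - 1) + ε * ‖Z‖ ^ 2) * q⁻¹ := by
        field_simp; rw [hq]; ring
      rw [h3, abs_mul, abs_of_nonneg hqi0, mul_comm]
      have h4 : |c - 1 + ε * ‖Z‖ ^ 2| ≤ τ + τ * C ^ 2 := by
        refine (abs_add_le _ _).trans (add_le_add hc ?_)
        rw [abs_of_nonneg (by positivity)]
        gcongr
      gcongr
    have h5 : |2 * c * ε * w * q⁻¹ ^ 2| * ‖Z‖ ≤ 16 * C ^ 2 * τ * ‖ξ‖ := by
      rw [abs_mul, abs_mul, abs_mul, abs_mul, abs_of_nonneg hε, abs_of_nonneg (sq_nonneg q⁻¹), abs_two]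
      calc 2 * |c| * ε * |w| * q⁻¹ ^ 2 * ‖Z‖ ≤ 2 * 2 * τ * (C * ‖ξ‖) * 2 ^ 2 * C := by gcongr
        _ = _ := by ring
    rw [h1]
    refine (norm_add_le _ _).trans ?_
    rw [norm_smul, norm_smul, Real.norm_eq_abs, Real.norm_eq_abs]
    have h6 : |c * q⁻¹ - 1| * ‖ξ‖ ≤ 2 * (τ + τ * C ^ 2) * ‖ξ‖ := by gcongr
    linarith
  · refine (norm_add_le _ _).trans ?_
    rw [norm_smul, norm_smul, Real.norm_eq_abs, Real.norm_eq_abs]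
    have h1 : |4 * c * ε * w * q⁻¹ ^ 2| * ‖ξ‖ ≤ 32 * C * τ * ‖ξ‖ ^ 2 := by
      rw [abs_mul, abs_mul, abs_mul, abs_mul, abs_of_nonneg hε, abs_of_nonneg (sq_nonneg q⁻¹),
        abs_of_pos (by norm_num : (0:ℝ) < 4)]
      calc 4 * |c| * ε * |w| * q⁻¹ ^ 2 * ‖ξ‖ ≤ 4 * 2 * τ * (C * ‖ξ‖) * 2 ^ 2 * ‖ξ‖ := by gcongr
        _ = _ := by ring
    have h2 : ε * w ^ 2 ≤ 1 / 2 * ‖ξ‖ ^ 2 := by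
      have : w ^ 2 ≤ (C * ‖ξ‖) ^ 2 := by rw [← sq_abs]; gcongr
      calc ε * w ^ 2 ≤ ε * (C * ‖ξ‖) ^ 2 := by gcongr
        _ = ε * C ^ 2 * ‖ξ‖ ^ 2 := by ring
        _ ≤ _ := by gcongr
    have h3 : |c * (8 * ε * (ε * w ^ 2) * q⁻¹ ^ 3 + 2 * ε * ‖ξ‖ ^ 2 * q⁻¹ ^ 2)| * ‖Z‖ ≤
        80 * C * τ * ‖ξ‖ ^ 2 := by
      have hnn : 0 ≤ 8 * ε * (ε * w ^ 2) * q⁻¹ ^ 3 + 2 * ε * ‖ξ‖ ^ 2 * q⁻¹ ^ 2 := by positivity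
      rw [abs_mul, abs_of_nonneg hnn]
      calc |c| * (8 * ε * (ε * w ^ 2) * q⁻¹ ^ 3 + 2 * ε * ‖ξ‖ ^ 2 * q⁻¹ ^ 2) * ‖Z‖
          ≤ 2 * (8 * τ * (1 / 2 * ‖ξ‖ ^ 2) * 2 ^ 3 + 2 * τ * ‖ξ‖ ^ 2 * 2 ^ 2) * C := by gcongr
        _ = _ := by ring
    linarith

theorem quadForm_hessMat_add_ge {n : ℕ} {u : En n → ℝ} {y : En n} {C : ℝ}
    (hu : ContDiffAt ℝ 2 u y) (hC : ‖iteratedFDeriv ℝ 2 u y‖ ≤ C) (ξ d : En n) :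
    quadForm (hessMat u y) ξ - (2 * C * ‖ξ‖ * ‖d‖ + C * ‖d‖ ^ 2) ≤
      quadForm (hessMat u y) (ξ + d) := by
  have hs := (hu.isSymmSndFDerivAt (by simp)).eq ξ d
  have h1 := (abs_le.1 (abs_fderiv_fderiv_le u y ξ d)).1
  have h2 := (abs_le.1 (abs_fderiv_fderiv_le u y d d)).1
  have h3 : ‖iteratedFDeriv ℝ 2 u y‖ * (‖ξ‖ * ‖d‖) ≤ C * (‖ξ‖ * ‖d‖) := by gcongr
  have h4 : ‖iteratedFDeriv ℝ 2 u y‖ * (‖d‖ * ‖d‖) ≤ C * (‖d‖ * ‖d‖) := by gcongr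
  simp only [quadForm_hessMat, map_add, add_apply, hs]
  rw [hs] at h1
  nlinarith

theorem mem_interior_of_smul_mem {n : ℕ} {K : Set (En n)} (hK : IsConvexBodyO n K) {s : ℝ}
    (hs : 1 < s) {z : En n} (hz : s • z ∈ K) : z ∈ interior K := by
  have h := hK.conv.combo_interior_closure_mem_interior hK.zeroInt (subset_closure hz)
    (a := 1 - s⁻¹) (b := s⁻¹) (by rw [sub_pos]; exact inv_lt_one_of_one_lt₀ hs) (by positivity)
    (by ring)
  rwa [smul_zero, zero_add, smul_smul, inv_mul_cancel₀ (by positivity), one_smul] at h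

theorem exists_hessian_comparison (n k : ℕ) (hk1 : 1 ≤ k) (hkn : k ≤ n - 1) (C : ℝ) (hC : 0 ≤ C) :
    ∃ A τ₀ : ℝ, 0 < A ∧ 0 < τ₀ ∧ τ₀ ≤ 1 ∧ ∀ (K L : Set (En n)) (v u : En n → ℝ) (c ε τ : ℝ),
      IsConvexBodyO n K → IsConvexBodyO n L → IsAdmissibleSolution n k K v →
      IsAdmissibleSolution n k L u → (∀ z ∈ L, ‖z‖ ≤ C) →
      (∀ z ∈ K, ‖iteratedFDeriv ℝ 2 v z‖ ≤ C) → (∀ z ∈ K, ‖gradient v z‖ ≤ C) →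
      |c - 1| ≤ τ → 0 ≤ ε → ε ≤ τ → 0 < τ → τ ≤ τ₀ →
      (∀ z ∈ L, (c * (1 - ε * ⟪z, z⟫)⁻¹) • z ∈ K) →
      ∀ z ∈ L, (1 + A * τ) * v ((c * (1 - ε * ⟪z, z⟫)⁻¹) • z) ≤ u z := by
  obtain ⟨c₁, hc₁⟩ : ∃ c₁, c₁ = 2 + 18 * C ^ 2 := ⟨_, rfl⟩
  have hc₁0 : 0 ≤ c₁ := by rw [hc₁]; positivity
  obtain ⟨b, hb⟩ : ∃ b, b = C * (2 * c₁ + c₁ ^ 2) + 112 * C ^ 2 := ⟨_, rfl⟩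
  have hb0 : 0 ≤ b := by rw [hb]; positivity
  obtain ⟨A, τ₁, hA, hτ₁, hτ₁1, H⟩ := one_lt_esym_of_quadForm_ge n k hk1 hkn C b hC hb0
  refine ⟨A, min τ₁ (1 / (2 * (C ^ 2 + 1))), hA, by positivity, (min_le_left _ _).trans hτ₁1, ?_⟩
  intro K L v u c ε τ hK hL hv hu hLC hKC hgC hc hε hετ hτ hττ hmap z hz
  have hτ1 : τ ≤ τ₁ := hττ.trans (min_le_left _ _)
  have hεC : ε * C ^ 2 ≤ 1 / 2 := by
    have h1 : τ ≤ 1 / (2 * (C ^ 2 + 1)) := hττ.trans (min_le_right _ _)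
    rw [le_div_iff₀ (by positivity)] at h1
    nlinarith [sq_nonneg C, mul_le_mul_of_nonneg_right hετ (sq_nonneg C)]
  have hq : ∀ w ∈ L, 0 < 1 - ε * ⟪w, w⟫ := by
    intro w hw
    have : ε * ⟪w, w⟫ ≤ ε * C ^ 2 := by
      rw [real_inner_self_eq_norm_sq]; have := hLC w hw; gcongr
    linarith
  by_contra hcon
  push Not at hcon
  set Ψ : En n → En n := fun w => (c * (1 - ε * ⟪w, w⟫)⁻¹) • w with hΨ
  have hΨc : ContinuousOn Ψ L := by
    refine ContinuousOn.smul (continuousOn_const.mul (ContinuousOn.inv₀ (by fun_prop)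
      fun w hw => (hq w hw).ne')) continuousOn_id
  obtain ⟨w, hw, hmax⟩ := hL.comp.exists_isMaxOn ⟨z, hz⟩
    (f := fun w => (1 + A * τ) * v (Ψ w) - u w)
    ((continuousOn_const.mul (hv.smooth.continuous.comp_continuousOn hΨc)).sub
      hu.smooth.continuous.continuousOn)
  have hwz : (1 + A * τ) * v (Ψ z) - u z ≤ (1 + A * τ) * v (Ψ w) - u w := hmax hz
  have hpos : 0 < (1 + A * τ) * v (Ψ w) - u w := by linarith
  have hwi : w ∈ interior L := by
    by_contra hwi
    have hfr : w ∈ frontier L := ⟨subset_closure hw, hwi⟩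
    have h1 := hu.bd w hfr
    have h2 := hv.nonpos hk1 hkn hK (hmap w hw)
    have : (1 + A * τ) * v (Ψ w) ≤ 0 := mul_nonpos_of_nonneg_of_nonpos (by positivity) h2
    linarith
  have hqw := hq w hw
  have hΨi : Ψ w ∈ interior K := by
    obtain ⟨s, hs, hsL⟩ : ∃ s : ℝ, 1 < s ∧ s • w ∈ L := by
      have hca : ContinuousAt (fun s : ℝ => s • w) 1 := by fun_prop
      have hev := hca.eventually_mem (s := L) (by simpa using mem_interior_iff_mem_nhds.1 hwi)
      obtain ⟨δ, hδ, hball⟩ := Metric.eventually_nhds_iff.1 hev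
      refine ⟨1 + δ / 2, by linarith, hball ?_⟩
      rw [Real.dist_eq, add_sub_cancel_left, abs_of_pos (by linarith)]; linarith
    have hm := hmap _ hsL
    have hqs := hq _ hsL
    rw [real_inner_smul_left, real_inner_smul_right] at hm hqs
    have hww : 0 ≤ ⟪w, w⟫ := real_inner_self_nonneg
    refine mem_interior_of_smul_mem hK (s := s * ((1 - ε * ⟪w, w⟫) * (1 - ε * (s * (s * ⟪w, w⟫)))⁻¹))
      ?_ ?_
    · have h1 : 1 - ε * (s * (s * ⟪w, w⟫)) ≤ 1 - ε * ⟪w, w⟫ := by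
        have : ⟪w, w⟫ ≤ s * (s * ⟪w, w⟫) := by nlinarith [mul_nonneg (sub_nonneg.2 hs.le) hww]
        have := mul_le_mul_of_nonneg_left this hε
        linarith
      have h2 : 1 ≤ (1 - ε * ⟪w, w⟫) * (1 - ε * (s * (s * ⟪w, w⟫)))⁻¹ := by
        rw [← div_eq_mul_inv, one_le_div hqs]; exact h1
      nlinarith
    · convert hm using 1
      simp only [hΨ, smul_smul]
      congr 1
      field_simp
  have hΨK := interior_subset hΨi
  have hvd : ContDiffAt ℝ 2 v (Ψ w) := (hv.smooth.contDiffAt).of_le two_le_coe_top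
  have hud : ContDiffAt ℝ 2 u w := (hu.smooth.contDiffAt).of_le two_le_coe_top
  have hlt := H (hessMat v (Ψ w)) (hessMat u w) (isHermitian_hessMat hvd) (isHermitian_hessMat hud)
    (fun ξ => (abs_quadForm_hessMat_le v _ ξ).trans (by gcongr; exact hKC _ hΨK))
    (hv.kconv _ hΨi) (hv.eqn _ hΨi) τ hτ hτ1 ?_
  · rw [hu.eqn w hwi] at hlt
    exact lt_irrefl _ hlt
  intro ξ
  have hτ11 : τ ≤ 1 := hτ1.trans hτ₁1
  obtain ⟨a, e, hj, ha, he⟩ := projective_jet ξ (hLC w hw) hε hετ hτ11 hc hεC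
  rw [← hc₁] at ha
  have jv := (hj.comp (u := v) (by simp only [zero_smul, add_zero]; exact hvd)).const_mul (1 + A * τ)
  have ju := (HasJetTwo.line w ξ).comp (u := u) (by simpa using hud)
  have hloc : IsLocalMin (fun r : ℝ => u (w + r • ξ) - (1 + A * τ) *
      v ((c * (1 - ε * ⟪w + r • ξ, w + r • ξ⟫)⁻¹) • (w + r • ξ))) 0 := by
    have hev : ∀ᶠ r : ℝ in 𝓝 0, w + r • ξ ∈ L := by
      have hca : ContinuousAt (fun r : ℝ => w + r • ξ) 0 := by fun_prop
      exact hca.eventually_mem (by simpa using mem_interior_iff_mem_nhds.1 hwi)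
    filter_upwards [hev] with r hr
    have := hmax hr
    simp only [mem_ofPred_eq, hΨ] at this
    simp only [zero_smul, add_zero]
    linarith
  have h2 := ((ju.sub jv).nonneg_of_isLocalMin hloc).2
  simp only [zero_smul, add_zero, map_zero, ← quadForm_hessMat] at h2
  have h3 : fderiv ℝ v (Ψ w) e ≥ -(C * ‖e‖) := by
    rw [fderiv_eq_inner_gradient]
    have := (abs_le.1 (abs_real_inner_le_norm (gradient v (Ψ w)) e)).1
    have h4 : ‖gradient v (Ψ w)‖ * ‖e‖ ≤ C * ‖e‖ := by gcongr; exact hgC _ hΨK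
    linarith
  have h5 := quadForm_hessMat_add_ge hvd (hKC _ hΨK) ξ (a - ξ)
  rw [add_sub_cancel] at h5
  have h6 : quadForm (hessMat v (Ψ w)) ξ - b * τ * ‖ξ‖ ^ 2 ≤
      quadForm (hessMat v (Ψ w)) a + fderiv ℝ v (Ψ w) e := by
    have h7 : 2 * C * ‖ξ‖ * ‖a - ξ‖ ≤ 2 * C * ‖ξ‖ * (c₁ * τ * ‖ξ‖) := by gcongr
    have h8 : C * ‖a - ξ‖ ^ 2 ≤ C * (c₁ ^ 2 * τ * ‖ξ‖ ^ 2) := by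
      have : ‖a - ξ‖ ^ 2 ≤ (c₁ * τ * ‖ξ‖) ^ 2 := by gcongr
      have h9 : (c₁ * τ * ‖ξ‖) ^ 2 ≤ c₁ ^ 2 * τ * ‖ξ‖ ^ 2 := by
        have : τ ^ 2 ≤ τ := by nlinarith
        calc (c₁ * τ * ‖ξ‖) ^ 2 = c₁ ^ 2 * τ ^ 2 * ‖ξ‖ ^ 2 := by ring
          _ ≤ _ := by gcongr
      gcongr; linarith
    have h10 : C * ‖e‖ ≤ C * (112 * C * τ * ‖ξ‖ ^ 2) := by gcongr
    have h11 : b * τ * ‖ξ‖ ^ 2 = 2 * C * ‖ξ‖ * (c₁ * τ * ‖ξ‖) + C * (c₁ ^ 2 * τ * ‖ξ‖ ^ 2)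
        + C * (112 * C * τ * ‖ξ‖ ^ 2) := by rw [hb]; ring
    linarith
  have h12 : (1 + A * τ) * (quadForm (hessMat v (Ψ w)) ξ - b * τ * ‖ξ‖ ^ 2) ≤
      (1 + A * τ) * (quadForm (hessMat v (Ψ w)) a + fderiv ℝ v (Ψ w) e) := by gcongr
  linarith

theorem HasDerivAt.nonpos_of_eventually_right {φ : ℝ → ℝ} {d a : ℝ} (h : HasDerivAt φ d a)
    (hle : ∀ᶠ r in 𝓝[>] (0:ℝ), φ (a + r) ≤ φ a) : d ≤ 0 := by
  refine le_of_tendsto h.tendsto_slope_zero_right ?_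
  filter_upwards [hle, self_mem_nhdsWithin] with r hr hr0
  have : (0:ℝ) ≤ r⁻¹ := inv_nonneg.2 (le_of_lt hr0)
  exact mul_nonpos_of_nonneg_of_nonpos this (by linarith)

theorem HasDerivAt.nonpos_of_eventually_left {φ : ℝ → ℝ} {d a : ℝ} (h : HasDerivAt φ d a)
    (hle : ∀ᶠ r in 𝓝[<] (0:ℝ), φ a ≤ φ (a + r)) : d ≤ 0 := by
  refine le_of_tendsto h.tendsto_slope_zero_left ?_
  filter_upwards [hle, self_mem_nhdsWithin] with r hr hr0
  have : r⁻¹ ≤ (0:ℝ) := inv_nonpos.2 (le_of_lt hr0)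
  exact mul_nonpos_of_nonpos_of_nonneg this (by linarith)

theorem mem_frontier_of_inner_eq {n : ℕ} {K : Set (En n)} (hK : IsCompact K) {x Y : En n}
    (hx : x ≠ 0) (hY : Y ∈ K) (h : ⟪x, Y⟫ = suppFun K x) : Y ∈ frontier K := by
  refine ⟨subset_closure hY, fun hi => ?_⟩
  have hca : ContinuousAt (fun s : ℝ => Y + s • x) 0 := by fun_prop
  have hev := hca.eventually_mem (s := K) (by simpa using mem_interior_iff_mem_nhds.1 hi)
  obtain ⟨δ, hδ, hball⟩ := Metric.eventually_nhds_iff.1 hev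
  have hm := hball (y := δ / 2)
    (by rw [Real.dist_eq, sub_zero, abs_of_pos (by linarith)]; linarith)
  have h1 := inner_le_suppFun hK x hm
  rw [inner_add_right, real_inner_smul_right, real_inner_self_eq_norm_sq, h] at h1
  have : 0 < ‖x‖ := norm_pos_iff.2 hx
  have : 0 < δ / 2 * ‖x‖ ^ 2 := by positivity
  linarith

theorem IsSmoothStrictlyConvexBody.eq_smul_of_suppFun_eq {n : ℕ} {K : Set (En n)}
    (hK : IsSmoothStrictlyConvexBody n K) {x w : En n} (hx : ‖x‖ = 1)
    (hw : suppFun K w = ⟪w, gradient (suppFun K) x⟫) : w = ⟪w, x⟫ • x := by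
  have hx0 : x ≠ 0 := norm_ne_zero_iff.1 (by rw [hx]; exact one_ne_zero)
  have hY := hK.gradient_mem hx0
  have hin := hK.inner_gradient hx0
  have hne : ∀ᶠ r : ℝ in 𝓝 0, x + r • w ≠ 0 :=
    ContinuousAt.eventually_ne (by fun_prop) (by simpa using hx0)
  have heq : ∀ᶠ r : ℝ in 𝓝[≥] 0, fderiv ℝ (suppFun K) (x + r • w) = fderiv ℝ (suppFun K) x := by
    filter_upwards [nhdsWithin_le_nhds hne, self_mem_nhdsWithin] with r hr hr0
    have h1 : ⟪x + r • w, gradient (suppFun K) x⟫ = suppFun K (x + r • w) := by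
      apply le_antisymm (inner_le_suppFun hK.body.comp _ hY)
      refine suppFun_le_of_forall hK.body.nonempty fun z hz => ?_
      rw [inner_add_left, inner_add_left, real_inner_smul_left, real_inner_smul_left, hin, ← hw]
      exact add_le_add (inner_le_suppFun hK.body.comp _ hz)
        (mul_le_mul_of_nonneg_left (inner_le_suppFun hK.body.comp _ hz) hr0)
    have h2 := eq_gradient_of_inner_eq hK.body.comp (hK.differentiableAt hr) hY h1
    rw [gradient, gradient] at h2
    exact ((InnerProductSpace.toDual ℝ (En n)).symm.injective h2).symm
  have hd2 : DifferentiableAt ℝ (fderiv ℝ (suppFun K)) x :=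
    ((hK.contDiffAt hx0).fderiv_right (m := 1) (by norm_num)).differentiableAt (by simp)
  have hd2' : HasFDerivAt (fderiv ℝ (suppFun K)) (fderiv ℝ (fderiv ℝ (suppFun K)) x)
      (x + (0:ℝ) • w) := by simpa using hd2.hasFDerivAt
  have hl : HasDerivAt (fun r : ℝ => x + r • w) w 0 := by
    simpa using ((hasDerivAt_id (0:ℝ)).smul_const w).const_add x
  have h3 := (hd2'.comp_hasDerivAt (0:ℝ) hl).hasDerivWithinAt (s := Ici 0)
  have h4 : HasDerivWithinAt (fun r : ℝ => fderiv ℝ (suppFun K) (x + r • w)) 0 (Ici 0) 0 := by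
    refine (hasDerivWithinAt_const (0:ℝ) (Ici 0) (fderiv ℝ (suppFun K) x)).congr_of_eventuallyEq
      heq ?_
    simp
  have h5 : fderiv ℝ (fderiv ℝ (suppFun K)) x w = 0 :=
    (uniqueDiffWithinAt_Ici (0:ℝ)).eq_deriv _ h3 h4
  have h6 : quadForm (hessMat (suppFun K) x) (w + (-⟪w, x⟫) • x) = 0 := by
    rw [hK.quadForm_add_smul hx0, quadForm_hessMat, h5]; simp
  by_contra hcon
  have h7 := hK.strictConv x hx (w + (-⟪w, x⟫) • x) (by
    rw [inner_add_left, real_inner_smul_left, real_inner_self_eq_norm_sq, hx]; ring) (by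
    intro h0
    apply hcon
    rw [neg_smul, ← sub_eq_add_neg, sub_eq_zero] at h0
    exact h0)
  linarith

theorem IsAdmissibleSolution.gradient_eq {n k : ℕ} (hk1 : 1 ≤ k) (hkn : k ≤ n - 1)
    {K : Set (En n)} {u : En n → ℝ} (hK : IsSmoothStrictlyConvexBody n K)
    (h : IsAdmissibleSolution n k K u) {x : En n} (hx : ‖x‖ = 1) (hpos : 0 < suppFun K x) :
    gradient u (gradient (suppFun K) x) = ‖gradient u (gradient (suppFun K) x)‖ • x := by
  have hx0 : x ≠ 0 := norm_ne_zero_iff.1 (by rw [hx]; exact one_ne_zero)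
  have hY := hK.gradient_mem hx0
  have hin := hK.inner_gradient hx0
  have hfr := mem_frontier_of_inner_eq hK.body.comp hx0 hY hin
  set Y := gradient (suppFun K) x with hYd
  set w := gradient u Y with hwd
  have hle : ∀ z ∈ K, ⟪w, z - Y⟫ ≤ 0 := by
    intro z hz
    have hl : HasDerivAt (fun r : ℝ => Y + r • (z - Y)) (z - Y) 0 := by
      simpa using ((hasDerivAt_id (0:ℝ)).smul_const (z - Y)).const_add Y
    have hu : HasFDerivAt u (fderiv ℝ u Y) (Y + (0:ℝ) • (z - Y)) := by
      simpa using ((h.smooth.differentiable (by simp)) Y).hasFDerivAt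
    have hd := hu.comp_hasDerivAt (0:ℝ) hl
    rw [fderiv_eq_inner_gradient] at hd
    refine hd.nonpos_of_eventually_right ?_
    have h1 : ∀ᶠ r in 𝓝[>] (0:ℝ), r < 1 := nhdsWithin_le_nhds (gt_mem_nhds one_pos)
    filter_upwards [h1, self_mem_nhdsWithin] with r hr1 hr0
    have hr0' : 0 < r := hr0
    have hmem : Y + r • (z - Y) ∈ K := hK.body.conv.add_smul_sub_mem hY hz ⟨hr0'.le, hr1.le⟩
    have := h.nonpos hk1 hkn hK.body hmem
    simpa [h.bd Y hfr] using this
  have hw : suppFun K w = ⟪w, Y⟫ := by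
    apply le_antisymm
    · refine suppFun_le_of_forall hK.body.nonempty fun z hz => ?_
      have := hle z hz
      rw [inner_sub_right] at this
      linarith
    · exact inner_le_suppFun hK.body.comp w hY
  have hwx := hK.eq_smul_of_suppFun_eq hx hw
  have h0 := hle 0 (interior_subset hK.body.zeroInt)
  have hs : 0 ≤ ⟪w, x⟫ := by
    rw [zero_sub, inner_neg_right, hwx, real_inner_smul_left, hin] at h0
    exact nonneg_of_mul_nonneg_left (by linarith) hpos
  have hn : ‖w‖ = ⟪w, x⟫ := by
    conv_lhs => rw [hwx, norm_smul, hx, mul_one, Real.norm_eq_abs, abs_of_nonneg hs]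
  rw [hn]; exact hwx

theorem projective_image_mem {n : ℕ} {K L : Set (En n)} (hK : IsConvexBodyO n K)
    (hL : IsConvexBodyO n L) {ε θ : ℝ} (hε : 0 < ε) (hθ : 0 < θ)
    (hpos : ∀ x : En n, ‖x‖ = 1 → 0 < suppFun K x)
    (hF : ∀ a b : En n, ‖a‖ = 1 → ‖b‖ = 1 →
      0 ≤ √(1 + 4 * ε * (θ * suppFun K b) ^ 2) - ⟪a, b⟫ - 2 * ε * (θ * suppFun K b) * suppFun L a)
    {z : En n} (hz : z ∈ L) (hq : 0 < 1 - ε * ⟪z, z⟫) :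
    (θ⁻¹ * (1 - ε * ⟪z, z⟫)⁻¹) • z ∈ K := by
  refine mem_of_forall_inner_le hK.comp hK.conv hK.nonempty fun b hb => ?_
  have hκ : 0 < θ * suppFun K b := mul_pos hθ (hpos b hb)
  obtain ⟨κ, hκd⟩ : ∃ κ, κ = θ * suppFun K b := ⟨_, rfl⟩
  rw [← hκd] at hκ
  have h1 : ‖b + (2 * ε * κ) • z‖ ≤ √(1 + 4 * ε * κ ^ 2) := by
    rcases eq_or_ne (b + (2 * ε * κ) • z) 0 with h0 | h0
    · rw [h0, norm_zero]; positivity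
    have hvp : 0 < ‖b + (2 * ε * κ) • z‖ := norm_pos_iff.2 h0
    set a := ‖b + (2 * ε * κ) • z‖⁻¹ • (b + (2 * ε * κ) • z) with ha
    have han : ‖a‖ = 1 := by
      rw [ha, norm_smul, norm_inv, norm_norm, inv_mul_cancel₀ hvp.ne']
    have h2 := hF a b han hb
    rw [← hκd] at h2
    have h3 := mul_le_mul_of_nonneg_left (inner_le_suppFun hL.comp a hz)
      (by positivity : 0 ≤ 2 * ε * κ)
    have h4 : ⟪a, b + (2 * ε * κ) • z⟫ = ‖b + (2 * ε * κ) • z‖ := by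
      rw [ha, real_inner_smul_left, real_inner_self_eq_norm_sq]; field_simp
    rw [inner_add_right, real_inner_smul_right] at h4
    linarith
  have h2 : ‖b + (2 * ε * κ) • z‖ ^ 2 ≤ 1 + 4 * ε * κ ^ 2 := by
    rw [← Real.sq_sqrt (by positivity : 0 ≤ 1 + 4 * ε * κ ^ 2)]; gcongr
  rw [norm_add_sq_real, hb, real_inner_smul_right, norm_smul, mul_pow, Real.norm_eq_abs, sq_abs,
    ← real_inner_self_eq_norm_sq z] at h2
  have h3 : ⟪b, z⟫ ≤ κ * (1 - ε * ⟪z, z⟫) := by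
    have : 4 * ε * κ * (⟪b, z⟫ - κ * (1 - ε * ⟪z, z⟫)) ≤ 0 := by linarith
    have h4 : 0 < 4 * ε * κ := by positivity
    by_contra hcon
    push Not at hcon
    have := mul_pos h4 (sub_pos.2 hcon)
    linarith
  rw [real_inner_smul_right, ← mul_inv, inv_mul_le_iff₀ (by positivity)]
  rw [hκd] at h3
  linarith

theorem TouchingData.norm_gradient_mul_le {n k : ℕ} (hk1 : 1 ≤ k) (hkn : k ≤ n - 1)
    {K L : Set (En n)} {u v : En n → ℝ} {ε θ R κ h y : ℝ} {x x' X Y : En n}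
    (hK : IsSmoothStrictlyConvexBody n K) (hL : IsSmoothStrictlyConvexBody n L)
    (hv : IsAdmissibleSolution n k K v) (hu : IsAdmissibleSolution n k L u)
    (D : TouchingData n K L ε θ x x' R κ h y X Y) (hx : ‖x‖ = 1) (hx' : ‖x'‖ = 1)
    (hX : X = gradient (suppFun K) x') (hY : Y = gradient (suppFun L) x)
    (hKp : 0 < suppFun K x') (hLp : 0 < suppFun L x) (hθ : 0 < θ)
    (hy : y = ε * ‖Y‖ ^ 2) (hy1 : y < 1) {Λ : ℝ}
    (hcmp : ∀ z ∈ L, Λ * v ((θ⁻¹ * (1 - ε * ⟪z, z⟫)⁻¹) • z) ≤ u z) :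
    ‖gradient u Y‖ * suppFun L x ≤ Λ * ((1 + y) / (1 - y)) * (‖gradient v X‖ * suppFun K x') := by
  have hx0 : x ≠ 0 := norm_ne_zero_iff.1 (by rw [hx]; exact one_ne_zero)
  have hx0' : x' ≠ 0 := norm_ne_zero_iff.1 (by rw [hx']; exact one_ne_zero)
  have hYL : Y ∈ L := hY ▸ hL.gradient_mem hx0
  have hXK : X ∈ K := hX ▸ hK.gradient_mem hx0'
  have hYi : ⟪x, Y⟫ = suppFun L x := hY ▸ hL.inner_gradient hx0
  have hXi : ⟪x', X⟫ = suppFun K x' := hX ▸ hK.inner_gradient hx0'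
  have hYb : u Y = 0 := hu.bd Y (mem_frontier_of_inner_eq hL.body.comp hx0 hYL hYi)
  have hXb : v X = 0 := hv.bd X (mem_frontier_of_inner_eq hK.body.comp hx0' hXK hXi)
  have hgu : gradient u Y = ‖gradient u Y‖ • x := by
    rw [hY]; exact hu.gradient_eq hk1 hkn hL hx hLp
  have hgv : gradient v X = ‖gradient v X‖ • x' := by
    rw [hX]; exact hv.gradient_eq hk1 hkn hK hx' hKp
  have h1y : 0 < 1 - y := by linarith
  have hsX : (θ⁻¹ * (1 - y)⁻¹) • Y = X := by
    conv_lhs => rw [D.parallel]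
    rw [smul_smul]
    rw [show θ⁻¹ * (1 - y)⁻¹ * ((1 - y) * θ) = 1 by field_simp, one_smul]
  have hl : HasDerivAt (fun r : ℝ => r • Y) Y 1 := by
    simpa using (hasDerivAt_id (1:ℝ)).smul_const Y
  have hud : HasFDerivAt u (fderiv ℝ u Y) ((1:ℝ) • Y) := by
    rw [one_smul]; exact ((hu.smooth.differentiable (by simp)) Y).hasFDerivAt
  have d1 := hud.comp_hasDerivAt (1:ℝ) hl
  have hs : HasDerivAt (fun r : ℝ => θ⁻¹ * (1 - y * (r * r))⁻¹ * r)
      (θ⁻¹ * ((1 + y) / (1 - y) ^ 2)) 1 := by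
    have h1 : HasDerivAt (fun r : ℝ => 1 - y * (r * r)) (-(y * 2)) 1 := by
      refine ((((hasDerivAt_id (1:ℝ)).mul (hasDerivAt_id (1:ℝ))).const_mul y).const_sub
        1).congr_deriv ?_
      simp only [id_eq]; ring
    have h2 := ((h1.inv (by simpa using h1y.ne')).const_mul θ⁻¹).mul (hasDerivAt_id (1:ℝ))
    refine h2.congr_deriv ?_
    simp only [Pi.inv_apply, id_eq, mul_one]
    field_simp
    ring
  have hsY := hs.smul_const Y
  have hvd : HasFDerivAt v (fderiv ℝ v X) ((θ⁻¹ * (1 - y * (1 * 1))⁻¹ * 1) • Y) := by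
    rw [mul_one, mul_one, mul_one, hsX]
    exact ((hv.smooth.differentiable (by simp)) X).hasFDerivAt
  have d2 := hvd.comp_hasDerivAt (1:ℝ) hsY
  have d := d1.sub (d2.const_mul Λ)
  have hd := d.nonpos_of_eventually_left ?_
  · rw [fderiv_eq_inner_gradient, fderiv_eq_inner_gradient, hgu, hgv, real_inner_smul_left,
      real_inner_smul_left, real_inner_smul_right, hYi] at hd
    have h3 : ⟪x', Y⟫ = (1 - y) * θ * suppFun K x' := by
      conv_lhs => rw [D.parallel]
      rw [real_inner_smul_right, hXi]
    rw [h3] at hd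
    have h4 : Λ * (‖gradient v X‖ * (θ⁻¹ * ((1 + y) / (1 - y) ^ 2) * ((1 - y) * θ * suppFun K x')))
        = Λ * ((1 + y) / (1 - y)) * (‖gradient v X‖ * suppFun K x') := by
      field_simp
    rw [h4] at hd
    linarith
  · have h1 : ∀ᶠ r in 𝓝[<] (0:ℝ), -1 < r := nhdsWithin_le_nhds (lt_mem_nhds (by norm_num))
    filter_upwards [h1, self_mem_nhdsWithin] with r hr1 hr0
    have hr0' : r < 0 := hr0
    have hm : (1 + r) • Y ∈ L := by
      have := hL.body.conv.add_smul_sub_mem (interior_subset hL.body.zeroInt) hYL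
        (t := 1 + r) ⟨by linarith, by linarith⟩
      simpa using this
    have h2 := hcmp _ hm
    rw [smul_smul, real_inner_smul_left, real_inner_smul_right, real_inner_self_eq_norm_sq,
      show ε * ((1 + r) * ((1 + r) * ‖Y‖ ^ 2)) = y * ((1 + r) * (1 + r)) by rw [hy]; ring] at h2
    simp only [Pi.sub_apply, Function.comp]
    rw [one_smul, mul_one, mul_one, mul_one, hsX, hYb, hXb]
    simp only [mul_zero, sub_zero]
    linarith

/-- A smooth strictly convex solution of the flow on `[0, T)` together with the uniform bounds
on the support function, the radial function, the position vector, `|Du|`, `η` and `|D²u|`. -/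
structure BoundedFlow (n k : ℕ) (p T C₀ : ℝ) (Ω : ℝ → Set (En n)) (u : ℝ → En n → ℝ)
    (f : En n → ℝ) : Prop where
  one_le : 1 ≤ k
  le_sub_one : k ≤ n - 1
  pos : 0 < C₀
  f_pos : ∀ x : En n, ‖x‖ = 1 → 0 < f x
  f_smooth : ContDiffOn ℝ (⊤ : ℕ∞) f {(0 : En n)}ᶜ
  flow : IsFlowSolution n k p (Set.Ico 0 T) Ω u f
  bounds : ∀ t ∈ Set.Ico (0 : ℝ) T, ∀ x : En n, ‖x‖ = 1 →
      (1 / C₀ ≤ suppFun (Ω t) x ∧ suppFun (Ω t) x ≤ C₀) ∧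
      (1 / C₀ ≤ radialFun (Ω t) x ∧ radialFun (Ω t) x ≤ C₀) ∧
      ‖gradient (suppFun (Ω t)) x - suppFun (Ω t) x • x‖ ≤ C₀ ∧
      (1 / C₀ ≤ ‖gradient (u t) (gradient (suppFun (Ω t)) x)‖ ∧
        ‖gradient (u t) (gradient (suppFun (Ω t)) x)‖ ≤ C₀)
  eta_bounds : ∀ t ∈ Set.Ico (0 : ℝ) T,
      1 / C₀ ≤ etaFn n k p Ω u f t ∧ etaFn n k p Ω u f t ≤ C₀
  hess_le : ∀ t ∈ Set.Ico (0 : ℝ) T, ∀ y ∈ Ω t, ‖iteratedFDeriv ℝ 2 (u t) y‖ ≤ C₀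

namespace BoundedFlow

variable {n k : ℕ} {p T C₀ : ℝ} {Ω : ℝ → Set (En n)} {u : ℝ → En n → ℝ} {f : En n → ℝ} {t : ℝ}

theorem smooth (B : BoundedFlow n k p T C₀ Ω u f) (ht : t ∈ Ico 0 T) :
    IsSmoothStrictlyConvexBody n (Ω t) := B.flow.bodies t ht

theorem adm (B : BoundedFlow n k p T C₀ Ω u f) (ht : t ∈ Ico 0 T) :
    IsAdmissibleSolution n k (Ω t) (u t) := B.flow.adm t ht

theorem body (B : BoundedFlow n k p T C₀ Ω u f) (ht : t ∈ Ico 0 T) :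
    IsConvexBodyO n (Ω t) := (B.smooth ht).body

theorem exists_unit (B : BoundedFlow n k p T C₀ Ω u f) : ∃ x : En n, ‖x‖ = 1 := by
  have h1 := B.one_le
  have h2 := B.le_sub_one
  exact ⟨EuclideanSpace.single ⟨0, by omega⟩ (1 : ℝ), by simp⟩

theorem supp_pos (B : BoundedFlow n k p T C₀ Ω u f) (ht : t ∈ Ico 0 T) {x : En n} (hx : ‖x‖ = 1) :
    0 < suppFun (Ω t) x :=
  (one_div_pos.2 B.pos).trans_le (B.bounds t ht x hx).1.1

theorem norm_le (B : BoundedFlow n k p T C₀ Ω u f) (ht : t ∈ Ico 0 T) {z : En n} (hz : z ∈ Ω t) :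
    ‖z‖ ≤ C₀ :=
  norm_le_of_suppFun_le (B.body ht).comp B.pos.le (fun x hx => (B.bounds t ht x hx).1.2) hz

theorem abs_supp_sub_le (B : BoundedFlow n k p T C₀ Ω u f) (ht : t ∈ Ico 0 T) (x x' : En n) :
    |suppFun (Ω t) x - suppFun (Ω t) x'| ≤ C₀ * ‖x - x'‖ :=
  abs_suppFun_sub_le (B.body ht).comp (B.body ht).nonempty (fun _ hz => B.norm_le ht hz) x x'

theorem norm_gradient_le (B : BoundedFlow n k p T C₀ Ω u f) (ht : t ∈ Ico 0 T) {z : En n}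
    (hz : z ∈ Ω t) : ‖gradient (u t) z‖ ≤ C₀ + 2 * C₀ ^ 2 := by
  obtain ⟨x, hx⟩ := B.exists_unit
  have hx0 : x ≠ 0 := norm_ne_zero_iff.1 (by rw [hx]; exact one_ne_zero)
  have hY := (B.smooth ht).gradient_mem hx0
  have h1 := norm_gradient_sub_le (B.adm ht).smooth (B.body ht).conv (B.hess_le t ht) hY hz
  have h2 := (B.bounds t ht x hx).2.2.2.2
  have h3 := norm_sub_le z (gradient (suppFun (Ω t)) x)
  have h4 := B.norm_le ht hz
  have h5 := B.norm_le ht hY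
  have h6 := norm_le_norm_add_norm_sub' (gradient (u t) z)
    (gradient (u t) (gradient (suppFun (Ω t)) x))
  have h7 := mul_le_mul_of_nonneg_left (h3.trans (add_le_add h4 h5)) B.pos.le
  nlinarith

theorem continuousAt_supp (B : BoundedFlow n k p T C₀ Ω u f) (ht : t ∈ Ico 0 T) {x : En n}
    (hx : ‖x‖ = 1) : ContinuousAt (fun s => suppFun (Ω s) x) t :=
  (B.flow.flow t ht x hx).continuousAt

theorem eventually_abs_supp_sub_le (B : BoundedFlow n k p T C₀ Ω u f) (ht : t ∈ Ico 0 T) {δ : ℝ}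
    (hδ : 0 < δ) : ∀ᶠ s in 𝓝[Ico 0 T] t, ∀ x : En n, ‖x‖ = 1 →
      |suppFun (Ω s) x - suppFun (Ω t) x| ≤ δ := by
  have hC := B.pos
  have key : ∀ᶠ s in 𝓝 t, ∀ x ∈ Metric.sphere (0 : En n) 1, s ∈ Ico 0 T →
      |suppFun (Ω s) x - suppFun (Ω t) x| ≤ δ := by
    refine (isCompact_sphere (0 : En n) 1).eventually_forall_of_forall_eventually fun x hx => ?_
    have h1 : ∀ᶠ s in 𝓝 t, |suppFun (Ω s) x - suppFun (Ω t) x| < δ / 3 := by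
      have := (B.continuousAt_supp ht (mem_sphere_zero_iff_norm.1 hx)).eventually
        (Metric.ball_mem_nhds _ (by positivity : 0 < δ / 3))
      simpa [Real.dist_eq] using this
    have h2 : ∀ᶠ z in 𝓝 x, ‖z - x‖ < δ / (3 * C₀) := by
      have := Metric.ball_mem_nhds x (by positivity : 0 < δ / (3 * C₀))
      filter_upwards [this] with z hz
      simpa [dist_eq_norm] using hz
    filter_upwards [h1.prod_inl_nhds x, h2.prod_inr_nhds t] with z hz1 hz2 hz
    have h3 := B.abs_supp_sub_le hz z.2 x
    have h4 := B.abs_supp_sub_le ht z.2 x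
    rw [lt_div_iff₀ (by positivity)] at hz2
    rw [abs_le] at h3 h4 ⊢
    rw [abs_lt] at hz1
    constructor <;> nlinarith
  rw [eventually_nhdsWithin_iff]
  filter_upwards [key] with s hs hsI x hx
  exact hs x (mem_sphere_zero_iff_norm.2 hx) hsI

theorem inv_smul_mem_of_forall_le {K L : Set (En n)} (hK : IsConvexBodyO n K)
    (hL : IsConvexBodyO n L) {r : ℝ} (hr : 0 < r)
    (h : ∀ x : En n, ‖x‖ = 1 → suppFun L x ≤ r * suppFun K x) {z : En n} (hz : z ∈ L) :
    r⁻¹ • z ∈ K := by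
  refine mem_of_forall_inner_le hK.comp hK.conv hK.nonempty fun x hx => ?_
  rw [real_inner_smul_right, inv_mul_le_iff₀ hr]
  exact (inner_le_suppFun hL.comp x hz).trans (h x hx)

theorem eventually_inv_smul_mem (B : BoundedFlow n k p T C₀ Ω u f) (ht : t ∈ Ico 0 T) {r : ℝ}
    (hr : 1 < r) : ∀ᶠ s in 𝓝[Ico 0 T] t,
      (∀ z ∈ Ω s, r⁻¹ • z ∈ Ω t) ∧ (∀ z ∈ Ω t, r⁻¹ • z ∈ Ω s) := by
  have hC := B.pos
  filter_upwards [B.eventually_abs_supp_sub_le ht (δ := (r - 1) * (1 / C₀))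
    (mul_pos (by linarith) (by positivity)), self_mem_nhdsWithin] with s hs hsI
  constructor
  · refine fun z hz => inv_smul_mem_of_forall_le (B.body ht) (B.body hsI) (by linarith) ?_ hz
    intro x hx
    have h1 := (abs_le.1 (hs x hx)).2
    have h2 := (B.bounds t ht x hx).1.1
    nlinarith
  · refine fun z hz => inv_smul_mem_of_forall_le (B.body hsI) (B.body ht) (by linarith) ?_ hz
    intro x hx
    have h1 := (abs_le.1 (hs x hx)).1
    have h2 := (B.bounds s hsI x hx).1.1
    nlinarith

end BoundedFlow

section Radial

variable {n : ℕ} {K : Set (En n)} {v : En n}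

theorem radialFun_bddAbove (hK : IsCompact K) (hv : ‖v‖ = 1) :
    BddAbove {c : ℝ | 0 < c ∧ c • v ∈ K} := by
  obtain ⟨C, hC⟩ := hK.isBounded.exists_norm_le
  refine ⟨C, fun c hc => ?_⟩
  have := hC _ hc.2
  rwa [norm_smul, hv, mul_one, Real.norm_of_nonneg hc.1.le] at this

theorem le_radialFun (hK : IsCompact K) (hv : ‖v‖ = 1) {c : ℝ} (hc : 0 < c) (h : c • v ∈ K) :
    c ≤ radialFun K v :=
  le_csSup (radialFun_bddAbove hK hv) ⟨hc, h⟩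

theorem IsConvexBodyO.exists_pos_smul_mem (hK : IsConvexBodyO n K) (v : En n) :
    ∃ c : ℝ, 0 < c ∧ c • v ∈ K := by
  have h : Tendsto (fun c : ℝ => c • v) (𝓝[>] 0) (𝓝 0) := by
    have : ContinuousAt (fun c : ℝ => c • v) 0 := by fun_prop
    simpa using this.tendsto.mono_left nhdsWithin_le_nhds
  obtain ⟨c, h1, h2⟩ := ((h.eventually (mem_interior_iff_mem_nhds.1 hK.zeroInt)).and
    self_mem_nhdsWithin).exists
  exact ⟨c, h2, h1⟩

theorem radialFun_pos (hK : IsConvexBodyO n K) (hv : ‖v‖ = 1) : 0 < radialFun K v := by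
  obtain ⟨c, hc, h⟩ := hK.exists_pos_smul_mem v
  exact hc.trans_le (le_radialFun hK.comp hv hc h)

theorem radialFun_smul_mem (hK : IsConvexBodyO n K) (hv : ‖v‖ = 1) : radialFun K v • v ∈ K := by
  have hne : {c : ℝ | 0 < c ∧ c • v ∈ K}.Nonempty := hK.exists_pos_smul_mem v
  have hcl : IsClosed {c : ℝ | c • v ∈ K} := hK.comp.isClosed.preimage (by fun_prop)
  have h1 := csSup_mem_closure hne (radialFun_bddAbove hK.comp hv)
  exact (closure_minimal (fun c hc => hc.2) hcl) h1

theorem radialFun_eq_inv_gauge (hK : IsConvexBodyO n K) (hv : ‖v‖ = 1) :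
    radialFun K v = (gauge K v)⁻¹ := by
  have hp := radialFun_pos hK hv
  have h1 : gauge K v ≤ (radialFun K v)⁻¹ := by
    refine gauge_le_of_mem (by positivity) ?_
    rw [mem_smul_set_iff_inv_smul_mem₀ (by positivity), inv_inv]
    exact radialFun_smul_mem hK hv
  have h2 : (radialFun K v)⁻¹ ≤ gauge K v := by
    obtain ⟨c, hc, hcv⟩ := hK.exists_pos_smul_mem v
    refine le_csInf ⟨c⁻¹, inv_pos.2 hc, ?_⟩ fun r hr => ?_
    · rw [mem_smul_set_iff_inv_smul_mem₀ (by positivity), inv_inv]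
      exact hcv
    · have hr2 := hr.2
      rw [mem_smul_set_iff_inv_smul_mem₀ hr.1.ne'] at hr2
      exact inv_le_of_inv_le₀ hr.1 (le_radialFun hK.comp hv (inv_pos.2 hr.1) hr2)
  rw [le_antisymm h1 h2, inv_inv]

theorem continuous_radialFun_sphere (hK : IsConvexBodyO n K) :
    Continuous fun v : Sph n => radialFun K (v : En n) := by
  have h1 : (fun v : Sph n => radialFun K (v : En n)) = fun v : Sph n => (gauge K (v : En n))⁻¹ := by
    funext v
    exact radialFun_eq_inv_gauge hK (mem_sphere_zero_iff_norm.1 v.2)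
  have h2 : Continuous (gauge K) := continuous_gauge hK.conv (mem_interior_iff_mem_nhds.1 hK.zeroInt)
  rw [h1]
  refine (h2.comp continuous_subtype_val).inv₀ fun v hv => ?_
  have hv1 := mem_sphere_zero_iff_norm.1 v.2
  have := radialFun_pos hK hv1
  rw [radialFun_eq_inv_gauge hK hv1] at this
  have := inv_pos.1 this
  exact this.ne' hv

end Radial

theorem abs_taylor_le {n : ℕ} {u : En n → ℝ} {K : Set (En n)} {C : ℝ}
    (hu : ContDiff ℝ (⊤ : ℕ∞) u) (hK : Convex ℝ K) (hC0 : 0 ≤ C)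
    (hC : ∀ y ∈ K, ‖iteratedFDeriv ℝ 2 u y‖ ≤ C) {y z : En n} (hy : y ∈ K) (hz : z ∈ K) :
    |u z - u y - ⟪gradient u y, z - y⟫| ≤ C * ‖z - y‖ ^ 2 := by
  have hd : Differentiable ℝ u := hu.differentiable (by simp)
  have h := (convex_segment y z).norm_image_sub_le_of_norm_fderiv_le' (𝕜 := ℝ) (f := u)
    (φ := fderiv ℝ u y) (C := C * ‖z - y‖) (fun w _ => hd w) (fun w hw => ?_)
    (left_mem_segment ℝ y z) (right_mem_segment ℝ y z)
  · rw [fderiv_eq_inner_gradient] at h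
    rw [Real.norm_eq_abs] at h
    linarith
  · have h1 := norm_gradient_sub_le hu hK hC hy (hK.segment_subset hy hz hw)
    have h2 : ‖w - y‖ ≤ ‖z - y‖ := by
      obtain ⟨r, hr, rfl⟩ := (segment_eq_image' ℝ y z ▸ hw)
      have h3 : y + r • (z - y) - y = r • (z - y) := by abel
      simp only [h3, norm_smul, Real.norm_of_nonneg hr.1]
      exact mul_le_of_le_one_left (norm_nonneg _) hr.2
    have h4 : ‖fderiv ℝ u w - fderiv ℝ u y‖ ≤ C * ‖w - y‖ := by
      simpa [gradient, ← map_sub] using h1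
    exact h4.trans (mul_le_mul_of_nonneg_left h2 hC0)

namespace BoundedFlow

variable {n k : ℕ} {p T C₀ : ℝ} {Ω : ℝ → Set (En n)} {u : ℝ → En n → ℝ} {f : En n → ℝ} {t : ℝ}

theorem tendsto_solution (B : BoundedFlow n k p T C₀ Ω u f) (ht : t ∈ Ico 0 T) {Q : En n}
    (hQ : Q ∈ interior (Ω t)) : Tendsto (fun s => u s Q) (𝓝[Ico 0 T] t) (𝓝 (u t Q)) := by
  have hC := B.pos
  obtain ⟨A, τ₀, hA, hτ₀, -, H⟩ := exists_hessian_comparison n k B.one_le B.le_sub_one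
    (C₀ + 2 * C₀ ^ 2) (by positivity)
  have hle : C₀ ≤ C₀ + 2 * C₀ ^ 2 := by nlinarith
  have hcomp : ∀ a ∈ Ico 0 T, ∀ b ∈ Ico 0 T, ∀ r : ℝ, 1 < r → r - 1 ≤ τ₀ →
      (∀ z ∈ Ω b, r⁻¹ • z ∈ Ω a) → ∀ z ∈ Ω b, (1 + A * (r - 1)) * u a (r⁻¹ • z) ≤ u b z := by
    intro a ha b hb r hr hrτ hz z hzb
    have := H (Ω a) (Ω b) (u a) (u b) r⁻¹ 0 (r - 1) (B.body ha) (B.body hb) (B.adm ha) (B.adm hb)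
      (fun z hz => (B.norm_le hb hz).trans hle) (fun z hz => (B.hess_le a ha z hz).trans hle)
      (fun z hz => B.norm_gradient_le ha hz) ?_ le_rfl (by linarith) (by linarith) hrτ
      (by simpa using hz) z hzb
    · simpa using this
    · have h1 : r⁻¹ ≤ 1 := inv_le_one_of_one_le₀ hr.le
      have h2 : r⁻¹ * r = 1 := inv_mul_cancel₀ (by linarith)
      rw [abs_le]
      constructor <;> nlinarith [inv_pos.2 (zero_lt_one.trans hr)]
  have hu : Continuous (u t) := (B.adm ht).smooth.continuous
  rw [Metric.tendsto_nhds]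
  intro δ hδ
  have c1 : ContinuousAt (fun r : ℝ => (1 + A * (r - 1)) * u t (r⁻¹ • Q)) 1 := by
    fun_prop (disch := norm_num)
  have c2 : ContinuousAt (fun r : ℝ => u t (r • Q) / (1 + A * (r - 1))) 1 := by
    fun_prop (disch := simp)
  have c3 : ContinuousAt (fun r : ℝ => r • Q) 1 := by fun_prop
  have e1 : ∀ᶠ r in 𝓝 (1 : ℝ), u t Q - δ < (1 + A * (r - 1)) * u t (r⁻¹ • Q) :=
    c1.eventually_const_lt (by simp; linarith)
  have e2 : ∀ᶠ r in 𝓝 (1 : ℝ), u t (r • Q) / (1 + A * (r - 1)) < u t Q + δ :=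
    c2.eventually_lt_const (by simp; linarith)
  have e3 : ∀ᶠ r in 𝓝 (1 : ℝ), r • Q ∈ interior (Ω t) :=
    c3.eventually (isOpen_interior.mem_nhds (by simpa using hQ))
  have e4 : ∀ᶠ r in 𝓝 (1 : ℝ), r < 1 + τ₀ := eventually_lt_nhds (by linarith)
  obtain ⟨r, ⟨⟨⟨h1, h2⟩, h3⟩, h4⟩, h5⟩ :=
    (((((e1.and e2).and e3).and e4).filter_mono (nhdsWithin_le_nhds (s := Ioi 1))).and
      self_mem_nhdsWithin).exists
  have h5' : 1 < r := h5
  filter_upwards [B.eventually_inv_smul_mem ht h5', self_mem_nhdsWithin] with s hs hsI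
  have hr0 : r ≠ 0 := by linarith
  have hQs : Q ∈ Ω s := by
    have := hs.2 _ (interior_subset h3)
    rwa [inv_smul_smul₀ hr0] at this
  have k1 := hcomp t ht s hsI r h5' (by linarith) hs.1 Q hQs
  have k2 := hcomp s hsI t ht r h5' (by linarith) hs.2 (r • Q) (interior_subset h3)
  rw [inv_smul_smul₀ hr0] at k2
  have hA1 : 0 < 1 + A * (r - 1) := by nlinarith
  rw [div_lt_iff₀ hA1] at h2
  have k3 : u s Q < u t Q + δ := by
    by_contra hcon
    push Not at hcon
    nlinarith
  rw [Real.dist_eq, abs_lt]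
  constructor <;> linarith

theorem tendsto_gradient (B : BoundedFlow n k p T C₀ Ω u f) (ht : t ∈ Ico 0 T) {Q : En n}
    (hQ : Q ∈ interior (Ω t)) :
    Tendsto (fun s => gradient (u s) Q) (𝓝[Ico 0 T] t) (𝓝 (gradient (u t) Q)) := by
  have hC := B.pos
  have hmem : ∀ {z : En n}, z ∈ interior (Ω t) → ∀ᶠ s in 𝓝[Ico 0 T] t, z ∈ Ω s := by
    intro z hz
    have c3 : ContinuousAt (fun r : ℝ => r • z) 1 := by fun_prop
    have e3 : ∀ᶠ r in 𝓝 (1 : ℝ), r • z ∈ interior (Ω t) :=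
      c3.eventually (isOpen_interior.mem_nhds (by simpa using hz))
    obtain ⟨r, h1, h2⟩ := ((e3.filter_mono (nhdsWithin_le_nhds (s := Ioi 1))).and
      self_mem_nhdsWithin).exists
    have h2' : 1 < r := h2
    filter_upwards [B.eventually_inv_smul_mem ht h2'] with s hs
    have := hs.2 _ (interior_subset h1)
    rwa [inv_smul_smul₀ (by linarith)] at this
  have hcoord : ∀ ξ : En n, ‖ξ‖ = 1 →
      Tendsto (fun s => ⟪gradient (u s) Q, ξ⟫) (𝓝[Ico 0 T] t) (𝓝 ⟪gradient (u t) Q, ξ⟫) := by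
    intro ξ hξ
    rw [Metric.tendsto_nhds]
    intro δ hδ
    have c3 : ContinuousAt (fun r : ℝ => Q + r • ξ) 0 := by fun_prop
    have e3 : ∀ᶠ r in 𝓝 (0 : ℝ), Q + r • ξ ∈ interior (Ω t) :=
      c3.eventually (isOpen_interior.mem_nhds (by simpa using hQ))
    have e4 : ∀ᶠ r in 𝓝 (0 : ℝ), r < δ / (8 * C₀) := eventually_lt_nhds (by positivity)
    obtain ⟨r, ⟨h1, h2⟩, h3⟩ := (((e3.and e4).filter_mono (nhdsWithin_le_nhds (s := Ioi 0))).and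
      self_mem_nhdsWithin).exists
    have h3' : 0 < r := h3
    rw [lt_div_iff₀ (by positivity)] at h2
    have hd : 0 < r * δ / 8 := by positivity
    filter_upwards [hmem hQ, hmem h1, (Metric.tendsto_nhds.1 (B.tendsto_solution ht hQ)) _ hd,
      (Metric.tendsto_nhds.1 (B.tendsto_solution ht h1)) _ hd, self_mem_nhdsWithin]
      with s s1 s2 s3 s4 hsI
    have t1 := abs_taylor_le (B.adm hsI).smooth (B.body hsI).conv hC.le (B.hess_le s hsI) s1 s2
    have t2 := abs_taylor_le (B.adm ht).smooth (B.body ht).conv hC.le (B.hess_le t ht)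
      (interior_subset hQ) (interior_subset h1)
    rw [add_sub_cancel_left, norm_smul, hξ, mul_one, real_inner_smul_right,
      Real.norm_of_nonneg h3'.le, abs_le] at t1 t2
    rw [Real.dist_eq, abs_lt] at s3 s4 ⊢
    have hr2 : C₀ * r ^ 2 ≤ r * (δ / 8) := by nlinarith
    constructor
    · refine lt_of_mul_lt_mul_left ?_ h3'.le
      linarith [t1.1, t1.2, t2.1, t2.2, s3.1, s3.2, s4.1, s4.2]
    · refine lt_of_mul_lt_mul_left ?_ h3'.le
      linarith [t1.1, t1.2, t2.1, t2.2, s3.1, s3.2, s4.1, s4.2]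
  have hsum : ∀ w : En n, w = ∑ i, ⟪w, EuclideanSpace.single i (1 : ℝ)⟫ •
      EuclideanSpace.single i (1 : ℝ) := by
    intro w
    ext j
    simp [Finset.sum_apply, EuclideanSpace.inner_single_right, Pi.single_apply]
  rw [hsum (gradient (u t) Q)]
  have : (fun s => gradient (u s) Q) = fun s => ∑ i, ⟪gradient (u s) Q,
      EuclideanSpace.single i (1 : ℝ)⟫ • EuclideanSpace.single i (1 : ℝ) := by
    funext s
    exact hsum _
  rw [this]
  exact tendsto_finsetSum _ fun i _ => (hcoord _ (by simp)).smul_const _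

end BoundedFlow

namespace BoundedFlow

variable {n k : ℕ} {p T C₀ : ℝ} {Ω : ℝ → Set (En n)} {u : ℝ → En n → ℝ} {f : En n → ℝ} {t : ℝ}

theorem radialFun_le_mul {K L : Set (En n)} (hK : IsConvexBodyO n K) (hL : IsConvexBodyO n L)
    {v : En n} (hv : ‖v‖ = 1) {r : ℝ} (hr : 0 < r) (h : ∀ z ∈ L, r⁻¹ • z ∈ K) :
    radialFun L v ≤ r * radialFun K v := by
  have h1 := h _ (radialFun_smul_mem hL hv)
  rw [smul_smul] at h1
  have := le_radialFun hK.comp hv (mul_pos (inv_pos.2 hr) (radialFun_pos hL hv)) h1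
  rwa [inv_mul_le_iff₀ hr] at this

theorem tendsto_radialFun (B : BoundedFlow n k p T C₀ Ω u f) (ht : t ∈ Ico 0 T) {v : En n}
    (hv : ‖v‖ = 1) :
    Tendsto (fun s => radialFun (Ω s) v) (𝓝[Ico 0 T] t) (𝓝 (radialFun (Ω t) v)) := by
  have hC := B.pos
  rw [Metric.tendsto_nhds]
  intro δ hδ
  filter_upwards [B.eventually_inv_smul_mem ht (r := 1 + δ / (2 * C₀))
    (by linarith [show 0 < δ / (2 * C₀) by positivity]), self_mem_nhdsWithin] with s hs hsI
  have hp : 0 < δ / (2 * C₀) := by positivity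
  have he : δ / (2 * C₀) * C₀ = δ / 2 := by field_simp
  have h1 := radialFun_le_mul (B.body ht) (B.body hsI) hv (by linarith) hs.1
  have h2 := radialFun_le_mul (B.body hsI) (B.body ht) hv (by linarith) hs.2
  have h3 := (B.bounds t ht v hv).2.1.2
  have h4 := (B.bounds s hsI v hv).2.1.2
  rw [Real.dist_eq, abs_lt]
  constructor <;> nlinarith

theorem tendsto_gradient_radial (B : BoundedFlow n k p T C₀ Ω u f) (ht : t ∈ Ico 0 T) {v : En n}
    (hv : ‖v‖ = 1) :
    Tendsto (fun s => gradient (u s) (radialFun (Ω s) v • v)) (𝓝[Ico 0 T] t)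
      (𝓝 (gradient (u t) (radialFun (Ω t) v • v))) := by
  have hC := B.pos
  have hρ := radialFun_pos (B.body ht) hv
  have hρC := (B.bounds t ht v hv).2.1.2
  rw [Metric.tendsto_nhds]
  intro δ hδ
  obtain ⟨r, h1, h2⟩ : ∃ r : ℝ, r < 1 ∧ 1 - min 1 (δ / (8 * C₀ ^ 2)) < r :=
    ⟨1 - min 1 (δ / (8 * C₀ ^ 2)) / 2, by
      have : 0 < min 1 (δ / (8 * C₀ ^ 2)) := by positivity
      constructor <;> linarith⟩
  have hr0 : 0 < r := by linarith [min_le_left 1 (δ / (8 * C₀ ^ 2))]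
  have hr1 : (1 - r) * (8 * C₀ ^ 2) < δ := by
    rw [← lt_div_iff₀ (by positivity)]
    linarith [min_le_right 1 (δ / (8 * C₀ ^ 2))]
  obtain ⟨Q, hQ⟩ : ∃ Q, Q = (r * radialFun (Ω t) v) • v := ⟨_, rfl⟩
  have hXm := radialFun_smul_mem (B.body ht) hv
  have hQi : Q ∈ interior (Ω t) := by
    refine mem_interior_of_smul_mem (B.body ht) ((one_lt_inv₀ hr0).2 h1) ?_
    rw [hQ, smul_smul, inv_mul_cancel_left₀ hr0.ne']
    exact hXm
  have hdist : ∀ c : ℝ, ‖c • v - Q‖ = |c - r * radialFun (Ω t) v| := by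
    intro c
    rw [hQ, ← sub_smul, norm_smul, hv, mul_one, Real.norm_eq_abs]
  have c3 : ContinuousAt (fun r : ℝ => r • Q) 1 := by fun_prop
  have e3 : ∀ᶠ r in 𝓝 (1 : ℝ), r • Q ∈ interior (Ω t) :=
    c3.eventually (isOpen_interior.mem_nhds (by simpa using hQi))
  obtain ⟨r', h1', h2'⟩ := ((e3.filter_mono (nhdsWithin_le_nhds (s := Ioi 1))).and
    self_mem_nhdsWithin).exists
  have h3' : 1 < r' := h2'
  filter_upwards [B.eventually_inv_smul_mem ht h3', self_mem_nhdsWithin,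
    Metric.tendsto_nhds.1 (B.tendsto_gradient ht hQi) (δ / 4) (by positivity),
    Metric.tendsto_nhds.1 (B.tendsto_radialFun ht hv) (δ / (8 * C₀)) (by positivity)]
    with s s1 hsI s2 s3
  have hQs : Q ∈ Ω s := by
    have := s1.2 _ (interior_subset h1')
    rwa [inv_smul_smul₀ (by linarith)] at this
  have k1 := norm_gradient_sub_le (B.adm ht).smooth (B.body ht).conv (B.hess_le t ht)
    (interior_subset hQi) hXm
  have k2 := norm_gradient_sub_le (B.adm hsI).smooth (B.body hsI).conv (B.hess_le s hsI)
    hQs (radialFun_smul_mem (B.body hsI) hv)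
  rw [hdist] at k1 k2
  rw [Real.dist_eq, lt_div_iff₀ (by positivity)] at s3
  have m1 : radialFun (Ω t) v - r * radialFun (Ω t) v ≤ (1 - r) * C₀ := by nlinarith
  have m2 : 0 ≤ radialFun (Ω t) v - r * radialFun (Ω t) v := by nlinarith
  have m3 : |radialFun (Ω s) v - r * radialFun (Ω t) v| ≤
      |radialFun (Ω s) v - radialFun (Ω t) v| + (1 - r) * C₀ := by
    refine (abs_sub_le _ (radialFun (Ω t) v) _).trans ?_
    rw [abs_of_nonneg m2]
    linarith
  rw [abs_of_nonneg m2] at k1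
  have n1 := dist_triangle4 (gradient (u s) (radialFun (Ω s) v • v)) (gradient (u s) Q)
    (gradient (u t) Q) (gradient (u t) (radialFun (Ω t) v • v))
  have k3 := mul_le_mul_of_nonneg_left m3 hC.le
  have k4 := mul_le_mul_of_nonneg_left m1 hC.le
  rw [← dist_eq_norm] at k1 k2
  rw [dist_comm (gradient (u t) Q)] at n1
  linarith

theorem continuousOn_eta (B : BoundedFlow n k p T C₀ Ω u f) :
    ContinuousOn (etaFn n k p Ω u f) (Ico 0 T) := by
  have hC := B.pos
  intro t ht
  unfold ContinuousWithinAt etaFn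
  refine Tendsto.div_const ?_ _
  have hunit : ∀ v : Sph n, ‖(v : En n)‖ = 1 := fun v => mem_sphere_zero_iff_norm.1 v.2
  obtain ⟨q, hq⟩ : ∃ q : ℝ, q = p + 1 - k := ⟨_, rfl⟩
  have : IsFiniteMeasure (sphMeasure n) := by unfold sphMeasure; infer_instance
  refine tendsto_integral_filter_of_dominated_convergence
    (fun _ => (C₀ ^ q + (1 / C₀) ^ q) * (C₀ + 2 * C₀ ^ 2) ^ (k + 1)) ?_ ?_ (integrable_const _) ?_
  · filter_upwards [self_mem_nhdsWithin] with s hs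
    have h1 := continuous_radialFun_sphere (B.body hs)
    have h2 : Continuous (gradient (u s)) := by
      have : Continuous (fderiv ℝ (u s)) := (B.adm hs).smooth.continuous_fderiv (by simp)
      exact (InnerProductSpace.toDual ℝ (En n)).symm.continuous.comp this
    have h3 : Continuous (QdualIntegrand n k p (Ω s) (u s)) := by
      unfold QdualIntegrand
      refine (h1.rpow_const fun v => Or.inl (radialFun_pos (B.body hs) (hunit v)).ne').mul ?_
      exact ((h2.comp (h1.smul continuous_subtype_val)).norm).pow _
    exact h3.aestronglyMeasurable
  · filter_upwards [self_mem_nhdsWithin] with s hs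
    refine Eventually.of_forall fun v => ?_
    have hρ := radialFun_pos (B.body hs) (hunit v)
    have hb := (B.bounds s hs v (hunit v)).2.1
    have hg := B.norm_gradient_le hs (radialFun_smul_mem (B.body hs) (hunit v))
    unfold QdualIntegrand
    rw [← hq, norm_mul, norm_pow, norm_norm, Real.norm_of_nonneg (by positivity)]
    refine mul_le_mul ?_ (pow_le_pow_left₀ (norm_nonneg _) hg _) (by positivity) (by positivity)
    rcases le_total 0 q with h0 | h0
    · have := rpow_le_rpow hρ.le hb.2 h0
      have : 0 ≤ (1 / C₀) ^ q := by positivity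
      linarith
    · have := rpow_le_rpow_of_nonpos (by positivity) hb.1 h0
      have : 0 ≤ C₀ ^ q := by positivity
      linarith
  · refine Eventually.of_forall fun v => ?_
    unfold QdualIntegrand
    exact ((B.tendsto_radialFun ht (hunit v)).rpow_const
      (Or.inl (radialFun_pos (B.body ht) (hunit v)).ne')).mul
      ((B.tendsto_gradient_radial ht (hunit v)).norm.pow _)

end BoundedFlow

theorem exp_le_one_add_mul_exp (x : ℝ) : exp x ≤ 1 + x * exp x := by
  have h1 := add_one_le_exp (-x)
  have h2 : exp x * exp (-x) = 1 := by rw [← exp_add]; simp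
  nlinarith [mul_le_mul_of_nonneg_left h1 (exp_pos x).le]

theorem rpow_le_add_rpow {C r : ℝ} (q : ℝ) (hC : 0 < C) (h1 : 1 / C ≤ r) (h2 : r ≤ C) :
    r ^ q ≤ C ^ q + (1 / C) ^ q := by
  have hr : 0 < r := (one_div_pos.2 hC).trans_le h1
  rcases le_total 0 q with h0 | h0
  · have := rpow_le_rpow hr.le h2 h0
    have : 0 ≤ (1 / C) ^ q := by positivity
    linarith
  · have := rpow_le_rpow_of_nonpos (by positivity) h1 h0
    have : 0 ≤ C ^ q := by positivity
    linarith

theorem inv_add_rpow_le_rpow {C r : ℝ} (q : ℝ) (hC : 0 < C) (h1 : 1 / C ≤ r) (h2 : r ≤ C) :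
    (C ^ (-q) + (1 / C) ^ (-q))⁻¹ ≤ r ^ q := by
  have hr : 0 < r := (one_div_pos.2 hC).trans_le h1
  have := rpow_le_add_rpow (-q) hC h1 h2
  rw [rpow_neg hr.le] at this
  exact inv_le_of_inv_le₀ (by positivity) this

theorem rpow_le_exp_of_log_le {r q c : ℝ} (hr : 0 < r) (h1 : exp (-c) ≤ r) (h2 : r ≤ exp c) :
    r ^ q ≤ exp (|q| * c) := by
  rw [rpow_def_of_pos hr]
  refine exp_le_exp.2 ?_
  have h3 : -c ≤ log r := (le_log_iff_exp_le hr).2 h1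
  have h4 : log r ≤ c := (log_le_iff_le_exp hr).2 h2
  have h5 : |log r| ≤ c := abs_le.2 ⟨h3, h4⟩
  calc log r * q ≤ |log r * q| := le_abs_self _
    _ = |q| * |log r| := by rw [abs_mul, mul_comm]
    _ ≤ |q| * c := mul_le_mul_of_nonneg_left h5 (abs_nonneg q)

/-- A positive smooth function on the sphere is bounded above and below, and its logarithm is
locally Lipschitz with a uniform constant. -/
theorem exists_sphere_bounds {n : ℕ} {f : En n → ℝ} (hpos : ∀ x : En n, ‖x‖ = 1 → 0 < f x)
    (hf : ContDiffOn ℝ (⊤ : ℕ∞) f {(0 : En n)}ᶜ) :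
    ∃ m M : ℝ, 0 < m ∧ 0 < M ∧ (∀ x : En n, ‖x‖ = 1 → m ≤ f x ∧ f x ≤ M) ∧
      ∀ x x' : En n, ‖x‖ = 1 → ‖x'‖ = 1 → ‖x - x'‖ ≤ 1 / 2 →
        f x' ≤ f x * exp (M * ‖x - x'‖) := by
  have hO : IsOpen ({(0 : En n)}ᶜ : Set (En n)) := isOpen_compl_singleton
  have hS : IsCompact (Metric.sphere (0 : En n) 1) := isCompact_sphere _ _
  have hne : ∀ {x : En n}, 1 / 2 ≤ ‖x‖ → x ∈ ({(0 : En n)}ᶜ : Set (En n)) := by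
    rintro x hx rfl
    norm_num at hx
  have hcS : ContinuousOn f (Metric.sphere (0 : En n) 1) := hf.continuousOn.mono fun x hx =>
    hne (by rw [mem_sphere_zero_iff_norm.1 hx]; norm_num)
  obtain ⟨m, hm, hmf⟩ : ∃ m : ℝ, 0 < m ∧ ∀ x : En n, ‖x‖ = 1 → m ≤ f x := by
    rcases (Metric.sphere (0 : En n) 1).eq_empty_or_nonempty with h | h
    · exact ⟨1, one_pos, fun x hx => (h.subset (mem_sphere_zero_iff_norm.2 hx)).elim⟩
    · obtain ⟨x₀, hx₀, hmin⟩ := hS.exists_isMinOn h hcS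
      exact ⟨f x₀, hpos _ (mem_sphere_zero_iff_norm.1 hx₀), fun x hx =>
        hmin (mem_sphere_zero_iff_norm.2 hx)⟩
  obtain ⟨M₁, hM₁⟩ := hS.exists_bound_of_continuousOn hcS
  have hA : IsCompact (Metric.closedBall (0 : En n) 1 ∩ {z : En n | 1 / 2 ≤ ‖z‖}) :=
    (isCompact_closedBall _ _).inter_right (isClosed_le continuous_const continuous_norm)
  have hcd : ContinuousOn (fderiv ℝ f) {(0 : En n)}ᶜ :=
    hf.continuousOn_fderiv_of_isOpen hO (by simp)
  obtain ⟨M₂, hM₂⟩ := hA.exists_bound_of_continuousOn (hcd.mono fun x hx => hne hx.2)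
  refine ⟨m, |M₁| + |M₂| / m + 1, hm, by positivity, fun x hx => ⟨hmf x hx, ?_⟩, ?_⟩
  · have := hM₁ x (mem_sphere_zero_iff_norm.2 hx)
    have h2 := (le_abs_self _).trans ((Real.norm_eq_abs (f x)) ▸ this)
    have h3 : 0 ≤ |M₂| / m := by positivity
    linarith [le_abs_self M₁]
  · intro x x' hx hx' hd
    have hseg : segment ℝ x x' ⊆ Metric.closedBall (0 : En n) 1 ∩ {z : En n | 1 / 2 ≤ ‖z‖} := by
      intro z hz
      refine ⟨(convex_closedBall (0 : En n) 1).segment_subset (by simp [hx]) (by simp [hx']) hz, ?_⟩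
      obtain ⟨r, hr, rfl⟩ := (segment_eq_image' ℝ x x' ▸ hz)
      have h1 : ‖r • (x' - x)‖ ≤ 1 / 2 := by
        rw [norm_smul, Real.norm_of_nonneg hr.1, norm_sub_rev]
        nlinarith [hr.1, hr.2, norm_nonneg (x - x')]
      have h2 := norm_sub_le (x + r • (x' - x)) (r • (x' - x))
      rw [add_sub_cancel_right, hx] at h2
      change 1 / 2 ≤ ‖x + r • (x' - x)‖
      linarith
    have h1 := (convex_segment x x').norm_image_sub_le_of_norm_fderiv_le (𝕜 := ℝ) (f := f)
      (C := |M₂|) (fun w hw => (hf.contDiffAt (hO.mem_nhds (hne (hseg hw).2))).differentiableAt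
        (by simp)) (fun w hw => (hM₂ w (hseg hw)).trans (le_abs_self _))
      (left_mem_segment ℝ x x') (right_mem_segment ℝ x x')
    rw [Real.norm_eq_abs, norm_sub_rev x' x] at h1
    have h2 := (abs_le.1 h1).2
    have h3 := hmf x hx
    have h4 : |M₂| * ‖x - x'‖ ≤ f x * (|M₂| / m * ‖x - x'‖) := by
      have : |M₂| * ‖x - x'‖ = m * (|M₂| / m * ‖x - x'‖) := by field_simp
      rw [this]
      exact mul_le_mul_of_nonneg_right h3 (by positivity)
    have h5 := add_one_le_exp (|M₂| / m * ‖x - x'‖)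
    have h6 : exp (|M₂| / m * ‖x - x'‖) ≤ exp ((|M₁| + |M₂| / m + 1) * ‖x - x'‖) :=
      exp_le_exp.2 (mul_le_mul_of_nonneg_right (by linarith [abs_nonneg M₁]) (norm_nonneg _))
    have h7 := hpos x hx
    nlinarith [mul_le_mul_of_nonneg_left (h5.trans h6) h7.le]

/-- The coefficient of `σ_{n-k}` in the evolution of `log h`. -/
noncomputable def flowCoeff (n k : ℕ) (p : ℝ) (K : Set (En n)) (v : En n → ℝ) (f : En n → ℝ) (x : En n) : ℝ :=
  suppFun K x / f x * ‖gradient (suppFun K) x‖ ^ (p - (n : ℝ)) *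
    ‖gradient v (gradient (suppFun K) x)‖ ^ (k + 1)

namespace BoundedFlow

variable {n k : ℕ} {p T C₀ : ℝ} {Ω : ℝ → Set (En n)} {u : ℝ → En n → ℝ} {f : En n → ℝ} {t : ℝ}

theorem norm_position_bounds (B : BoundedFlow n k p T C₀ Ω u f) (ht : t ∈ Ico 0 T) {x : En n}
    (hx : ‖x‖ = 1) : 1 / C₀ ≤ ‖gradient (suppFun (Ω t)) x‖ ∧
      ‖gradient (suppFun (Ω t)) x‖ ≤ C₀ := by
  have hx0 : x ≠ 0 := norm_ne_zero_iff.1 (by rw [hx]; exact one_ne_zero)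
  refine ⟨?_, B.norm_le ht ((B.smooth ht).gradient_mem hx0)⟩
  have h1 := (B.smooth ht).inner_gradient hx0
  have h2 := real_inner_le_norm x (gradient (suppFun (Ω t)) x)
  rw [h1, hx, one_mul] at h2
  exact (B.bounds t ht x hx).1.1.trans h2

theorem exists_flowCoeff_bounds (B : BoundedFlow n k p T C₀ Ω u f) :
    ∃ s S : ℝ, 0 < s ∧ 0 < S ∧ ∀ t ∈ Ico 0 T, ∀ x : En n, ‖x‖ = 1 →
      s ≤ flowCoeff n k p (Ω t) (u t) f x ∧ flowCoeff n k p (Ω t) (u t) f x ≤ S := by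
  have hC := B.pos
  obtain ⟨m, M, hm, hM, hf, -⟩ := exists_sphere_bounds B.f_pos B.f_smooth
  refine ⟨1 / C₀ / M * (C₀ ^ (-(p - (n : ℝ))) + (1 / C₀) ^ (-(p - (n : ℝ))))⁻¹ *
    (1 / C₀) ^ (k + 1), C₀ / m * (C₀ ^ (p - (n : ℝ)) + (1 / C₀) ^ (p - (n : ℝ))) * C₀ ^ (k + 1),
    by positivity, by positivity, fun t ht x hx => ?_⟩
  have hb := B.bounds t ht x hx
  have hY := B.norm_position_bounds ht hx
  have hYp : 0 < ‖gradient (suppFun (Ω t)) x‖ := (one_div_pos.2 hC).trans_le hY.1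
  have hfx := hf x hx
  have hfp := B.f_pos x hx
  have hhp := B.supp_pos ht hx
  unfold flowCoeff
  constructor
  · refine mul_le_mul (mul_le_mul (div_le_div₀ hhp.le hb.1.1 hfp hfx.2)
      (inv_add_rpow_le_rpow _ hC hY.1 hY.2) (by positivity) (by positivity))
      (pow_le_pow_left₀ (by positivity) hb.2.2.2.1 _) (by positivity) (by positivity)
  · refine mul_le_mul (mul_le_mul (div_le_div₀ hC.le hb.1.2 hm hfx.1)
      (rpow_le_add_rpow _ hC hY.1 hY.2) (by positivity) (by positivity))
      (pow_le_pow_left₀ (by positivity) hb.2.2.2.2 _) (by positivity) (by positivity)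

end BoundedFlow

/-- The two-point function comparing the support functions of `K` and `L`. -/
noncomputable def twoPointGap {n : ℕ} (ε θ : ℝ) (K L : Set (En n)) (a b : En n) : ℝ :=
  √(1 + 4 * ε * (θ * suppFun K b) ^ 2) - ⟪a, b⟫ - 2 * ε * (θ * suppFun K b) * suppFun L a

theorem exp_neg_two_mul_le {y : ℝ} (h0 : 0 ≤ y) (h1 : y ≤ 1 / 4) : exp (-(2 * y)) ≤ 1 - y := by
  have h2 := add_one_le_exp (2 * y)
  have h3 : exp (2 * y) * exp (-(2 * y)) = 1 := by rw [← exp_add]; simp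
  have h4 := exp_pos (-(2 * y))
  nlinarith

theorem sqrt_one_add_le (a : ℝ) (ha : 0 ≤ a) : √(1 + 2 * a) ≤ 1 + a := by
  rw [Real.sqrt_le_left (by linarith)]
  nlinarith [sq_nonneg a]

namespace BoundedFlow

variable {n k : ℕ} {p T C₀ : ℝ} {Ω : ℝ → Set (En n)} {u : ℝ → En n → ℝ} {f : En n → ℝ}

/-- Elementary estimates at a contact point of the two-point function. -/
theorem touching_estimates (B : BoundedFlow n k p T C₀ Ω u f) {c : ℝ} (hc : 0 ≤ c) {s t τ θ : ℝ}
    (hs : s ∈ Ico 0 T) (ht : t ∈ Ico 0 T) (hτ : 0 < τ) (hτ1 : τ ≤ 1) (hθ1 : exp (-(c * τ)) ≤ θ)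
    (hθ2 : θ ≤ exp (c * τ)) {x x' : En n} (hx : ‖x‖ = 1) (hx' : ‖x'‖ = 1) {R κ h y : ℝ} {X Y : En n}
    (hR : R = √(1 + 4 * (τ / (4 * C₀ ^ 2)) * (θ * suppFun (Ω s) x') ^ 2))
    (hκ : κ = θ * suppFun (Ω s) x') (hh : h = suppFun (Ω t) x)
    (hX : X = gradient (suppFun (Ω s)) x') (hY : Y = gradient (suppFun (Ω t)) x)
    (hy : y = τ / (4 * C₀ ^ 2) * ‖Y‖ ^ 2)
    (D : TouchingData n (Ω s) (Ω t) (τ / (4 * C₀ ^ 2)) θ x x' R κ h y X Y) :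
    1 ≤ R ∧ R ≤ 1 + exp (2 * c) / 2 * τ ∧
      suppFun (Ω t) x ≤ exp ((c + 1) * τ) * suppFun (Ω s) x' ∧
      suppFun (Ω s) x' ≤ exp ((exp (2 * c) / 2 + c) * τ) * suppFun (Ω t) x ∧
      ‖Y‖ ^ (p - (n : ℝ)) ≤ exp (|p - n| * ((c + 1) * τ)) * ‖X‖ ^ (p - (n : ℝ)) ∧
      ‖x - x'‖ ≤ (exp (2 * c) / 2 + exp c) * τ := by
  have hC := B.pos
  have hθ : 0 < θ := (exp_pos _).trans_le hθ1
  have hcτ : c * τ ≤ c := mul_le_of_le_one_right hc hτ1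
  have hθc : θ ≤ exp c := hθ2.trans (exp_le_exp.2 hcτ)
  have hK := B.supp_pos hs hx'
  have hL := B.supp_pos ht hx
  have hKC := (B.bounds s hs x' hx').1.2
  have hκp : 0 < κ := hκ ▸ mul_pos hθ hK
  have hκC : κ ≤ exp c * C₀ := hκ ▸ mul_le_mul hθc hKC hK.le (exp_pos c).le
  have hYC : ‖Y‖ ≤ C₀ := hY ▸ (B.norm_position_bounds ht hx).2
  have hXp : 0 < ‖X‖ := hX ▸ (one_div_pos.2 hC).trans_le (B.norm_position_bounds hs hx').1
  have hy0 : 0 ≤ y := by rw [hy]; positivity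
  have hyτ : y ≤ τ / 4 := by
    have : ‖Y‖ ^ 2 ≤ C₀ ^ 2 := pow_le_pow_left₀ (norm_nonneg _) hYC 2
    calc y ≤ τ / (4 * C₀ ^ 2) * C₀ ^ 2 := hy ▸ mul_le_mul_of_nonneg_left this (by positivity)
      _ = τ / 4 := by field_simp
  have hR1 : 1 ≤ R := by
    rw [hR]
    exact Real.one_le_sqrt.2 (by linarith [show 0 ≤ 4 * (τ / (4 * C₀ ^ 2)) *
      (θ * suppFun (Ω s) x') ^ 2 by positivity])
  have hexp2 : exp c ^ 2 = exp (2 * c) := by rw [← exp_nat_mul]; norm_num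
  have hR2 : R ≤ 1 + exp (2 * c) / 2 * τ := by
    have h1 := sqrt_one_add_le (2 * (τ / (4 * C₀ ^ 2)) * κ ^ 2) (by positivity)
    have h2 : R = √(1 + 2 * (2 * (τ / (4 * C₀ ^ 2)) * κ ^ 2)) := by rw [hR, ← hκ]; ring_nf
    have h3 : κ ^ 2 ≤ (exp c * C₀) ^ 2 := pow_le_pow_left₀ hκp.le hκC 2
    calc R ≤ 1 + 2 * (τ / (4 * C₀ ^ 2)) * κ ^ 2 := h2 ▸ h1
      _ ≤ 1 + 2 * (τ / (4 * C₀ ^ 2)) * (exp c * C₀) ^ 2 := by gcongr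
      _ = 1 + exp (2 * c) / 2 * τ := by rw [mul_pow, hexp2]; field_simp; ring
  have hht := D.height
  rw [hκ, hh] at hht
  have hy14 : y ≤ 1 / 4 := by linarith
  refine ⟨hR1, hR2, ?_, ?_, ?_, ?_⟩
  · have h1 : suppFun (Ω t) x ≤ R * suppFun (Ω t) x := le_mul_of_one_le_left hL.le hR1
    have h2 : 1 + y ≤ exp τ := by linarith [add_one_le_exp τ]
    calc suppFun (Ω t) x ≤ θ * suppFun (Ω s) x' * (1 + y) := h1.trans hht.le
      _ ≤ exp (c * τ) * suppFun (Ω s) x' * exp τ := by gcongr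
      _ = exp ((c + 1) * τ) * suppFun (Ω s) x' := by rw [add_mul, exp_add, one_mul]; ring
  · have h2 : R ≤ exp (exp (2 * c) / 2 * τ) := by linarith [add_one_le_exp (exp (2 * c) / 2 * τ)]
    have h3 : exp (-(c * τ)) * suppFun (Ω s) x' ≤ exp (exp (2 * c) / 2 * τ) * suppFun (Ω t) x :=
      calc exp (-(c * τ)) * suppFun (Ω s) x' ≤ θ * suppFun (Ω s) x' := by gcongr
        _ ≤ θ * suppFun (Ω s) x' * (1 + y) := le_mul_of_one_le_right (by positivity) (by linarith)
        _ = R * suppFun (Ω t) x := hht.symm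
        _ ≤ exp (exp (2 * c) / 2 * τ) * suppFun (Ω t) x := by gcongr
    rw [exp_neg, inv_mul_le_iff₀ (exp_pos _)] at h3
    rwa [add_mul, exp_add, mul_comm (exp (exp (2 * c) / 2 * τ)), mul_assoc]
  · have h1y : 0 < 1 - y := by linarith
    have hYX : ‖Y‖ = (1 - y) * θ * ‖X‖ := by
      rw [D.parallel, norm_smul, Real.norm_of_nonneg (by positivity)]
    rw [hYX, mul_rpow (by positivity) hXp.le]
    refine mul_le_mul_of_nonneg_right (rpow_le_exp_of_log_le (by positivity) ?_ ?_) (by positivity)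
    · have h1 := exp_neg_two_mul_le hy0 hy14
      have h2 : exp (-τ) ≤ exp (-(2 * y)) := exp_le_exp.2 (by linarith)
      calc exp (-((c + 1) * τ)) = exp (-τ) * exp (-(c * τ)) := by rw [← exp_add]; ring_nf
        _ ≤ (1 - y) * θ := mul_le_mul (h2.trans h1) hθ1 (exp_pos _).le h1y.le
    · calc (1 - y) * θ ≤ θ := mul_le_of_le_one_left hθ.le (by linarith)
        _ ≤ exp (c * τ) := hθ2
        _ ≤ exp ((c + 1) * τ) := exp_le_exp.2 (by linarith)
  · have h1 : x - x' = (2 * (τ / (4 * C₀ ^ 2)) * κ) • Y - (R - 1) • x := by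
      rw [sub_smul, D.xdir, one_smul]; abel
    have h2 : ‖(2 * (τ / (4 * C₀ ^ 2)) * κ) • Y‖ ≤ exp c / 2 * τ := by
      rw [norm_smul, Real.norm_of_nonneg (by positivity)]
      calc 2 * (τ / (4 * C₀ ^ 2)) * κ * ‖Y‖ ≤ 2 * (τ / (4 * C₀ ^ 2)) * (exp c * C₀) * C₀ := by gcongr
        _ = exp c / 2 * τ := by field_simp; ring
    have h3 : ‖(R - 1) • x‖ ≤ exp (2 * c) / 2 * τ := by
      rw [norm_smul, hx, mul_one, Real.norm_of_nonneg (by linarith)]; linarith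
    have h4 := norm_sub_le ((2 * (τ / (4 * C₀ ^ 2)) * κ) • Y) ((R - 1) • x)
    rw [h1]
    have : 0 ≤ exp c / 2 * τ := by positivity
    linarith

end BoundedFlow

theorem div_le_exp_mul_div {h h' i i' a b : ℝ} (hh : 0 ≤ h) (hi : 0 ≤ i⁻¹) (h1 : h ≤ exp a * h')
    (h2 : i⁻¹ ≤ exp b * i'⁻¹) : h / i ≤ exp (a + b) * (h' / i') := by
  rw [div_eq_mul_inv, div_eq_mul_inv, exp_add]
  calc h * i⁻¹ ≤ exp a * h' * (exp b * i'⁻¹) := mul_le_mul h1 h2 hi (hh.trans h1)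
    _ = _ := by ring

theorem mul_exp_le (m : ℕ) {q q' r r' d d' a b e : ℝ} (hq : 0 ≤ q) (hr : 0 ≤ r) (hd : 0 ≤ d)
    (h1 : q ≤ exp a * q') (h2 : r ≤ exp b * r') (h3 : d ≤ exp e * d') :
    q * r * d ^ m ≤ exp (a + b + m * e) * (q' * r' * d' ^ m) := by
  have h4 : d ^ m ≤ (exp e * d') ^ m := pow_le_pow_left₀ hd h3 m
  calc q * r * d ^ m ≤ exp a * q' * (exp b * r') * (exp e * d') ^ m :=
        mul_le_mul (mul_le_mul h1 h2 hr (hq.trans h1)) h4 (pow_nonneg hd m)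
          (mul_nonneg (hq.trans h1) (hr.trans h2))
    _ = exp (a + b + m * e) * (q' * r' * d' ^ m) := by
        rw [exp_add, exp_add, exp_nat_mul, mul_pow]; ring

namespace BoundedFlow

variable {n k : ℕ} {p T C₀ : ℝ} {Ω : ℝ → Set (En n)} {u : ℝ → En n → ℝ} {f : En n → ℝ}

set_option maxHeartbeats 1000000 in
theorem exists_flowCoeff_comparison (B : BoundedFlow n k p T C₀ Ω u f) {c : ℝ} (hc : 0 ≤ c) :
    ∃ a τ₀ : ℝ, 0 ≤ a ∧ 0 < τ₀ ∧ τ₀ ≤ 1 ∧ ∀ s ∈ Ico 0 T, ∀ t ∈ Ico 0 T, ∀ τ θ : ℝ, 0 < τ → τ ≤ τ₀ →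
      exp (-(c * τ)) ≤ θ → θ ≤ exp (c * τ) →
      (∀ b b' : En n, ‖b‖ = 1 → ‖b'‖ = 1 →
        0 ≤ twoPointGap (τ / (4 * C₀ ^ 2)) θ (Ω s) (Ω t) b b') →
      ∀ x x' : En n, ‖x‖ = 1 → ‖x'‖ = 1 → ∀ (R κ h y : ℝ) (X Y : En n),
      R = √(1 + 4 * (τ / (4 * C₀ ^ 2)) * (θ * suppFun (Ω s) x') ^ 2) →
      κ = θ * suppFun (Ω s) x' → h = suppFun (Ω t) x → X = gradient (suppFun (Ω s)) x' →
      Y = gradient (suppFun (Ω t)) x → y = τ / (4 * C₀ ^ 2) * ‖Y‖ ^ 2 →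
      TouchingData n (Ω s) (Ω t) (τ / (4 * C₀ ^ 2)) θ x x' R κ h y X Y →
      flowCoeff n k p (Ω t) (u t) f x ≤ (1 + a * τ) * flowCoeff n k p (Ω s) (u s) f x' := by
  have hC := B.pos
  obtain ⟨m, M, hm, hM, -, hf⟩ := exists_sphere_bounds B.f_pos B.f_smooth
  obtain ⟨A, τ₁, hA, hτ₁, -, H⟩ := exists_hessian_comparison n k B.one_le B.le_sub_one
    (C₀ + 2 * C₀ ^ 2) (by positivity)
  have hle : C₀ ≤ C₀ + 2 * C₀ ^ 2 := by nlinarith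
  obtain ⟨g, hg⟩ : ∃ g, g = c * exp c + c + 1 / (4 * C₀ ^ 2) := ⟨_, rfl⟩
  have hg0 : 0 < g := by rw [hg]; positivity
  obtain ⟨d, hd⟩ : ∃ d, d = exp (2 * c) / 2 + exp c := ⟨_, rfl⟩
  have hd0 : 0 < d := by rw [hd]; positivity
  obtain ⟨a4, ha4⟩ : ∃ a4, a4 = A * g + 1 + (exp (2 * c) / 2 + c) := ⟨_, rfl⟩
  obtain ⟨e, he⟩ : ∃ e, e = (c + 1) + M * d + |p - n| * (c + 1) + (k + 1 : ℕ) * a4 := ⟨_, rfl⟩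
  have he0 : 0 ≤ e := by rw [he, ha4]; positivity
  refine ⟨e * exp e, min 1 (min (τ₁ / g) (1 / (2 * d))), by positivity, by positivity,
    min_le_left _ _, ?_⟩
  intro s hs t ht τ θ hτ hττ hθ1 hθ2 hF x x' hx hx' R κ h y X Y hR hκ hh hX hY hy D
  have hτ1 : τ ≤ 1 := hττ.trans (min_le_left _ _)
  have hτg : g * τ ≤ τ₁ := by
    have := hττ.trans ((min_le_right _ _).trans (min_le_left _ _))
    rwa [le_div_iff₀ hg0, mul_comm] at this
  have hτd : d * τ ≤ 1 / 2 := by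
    have := hττ.trans ((min_le_right _ _).trans (min_le_right _ _))
    rw [le_div_iff₀ (by positivity)] at this
    linarith
  obtain ⟨-, -, e3, e4, e5, e6⟩ := B.touching_estimates hc hs ht hτ hτ1 hθ1 hθ2 hx hx' hR hκ hh
    hX hY hy D
  rw [← hd] at e6
  have hθ : 0 < θ := (exp_pos _).trans_le hθ1
  have hK := B.supp_pos hs hx'
  have hL := B.supp_pos ht hx
  have hy0 : 0 ≤ y := by rw [hy]; positivity
  have hball : ∀ z ∈ Ω t, τ / (4 * C₀ ^ 2) * ‖z‖ ^ 2 ≤ τ / 4 := by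
    intro z hz
    have : ‖z‖ ^ 2 ≤ C₀ ^ 2 := pow_le_pow_left₀ (norm_nonneg _) (B.norm_le ht hz) 2
    calc τ / (4 * C₀ ^ 2) * ‖z‖ ^ 2 ≤ τ / (4 * C₀ ^ 2) * C₀ ^ 2 := by gcongr
      _ = τ / 4 := by field_simp
  have hx0 : x ≠ 0 := norm_ne_zero_iff.1 (by rw [hx]; exact one_ne_zero)
  have hyτ : y ≤ τ / 4 := hy ▸ hball Y (hY ▸ (B.smooth ht).gradient_mem hx0)
  have hθinv : |θ⁻¹ - 1| ≤ g * τ := by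
    have h1 : θ⁻¹ ≤ exp (c * τ) := by
      rw [← inv_inv (exp (c * τ)), ← exp_neg]
      exact inv_anti₀ (exp_pos _) hθ1
    have h2 : exp (-(c * τ)) ≤ θ⁻¹ := by
      rw [exp_neg]
      exact inv_anti₀ hθ hθ2
    have h3 := exp_le_one_add_mul_exp (c * τ)
    have h4 : exp (c * τ) ≤ exp c := exp_le_exp.2 (mul_le_of_le_one_right hc hτ1)
    have h5 := add_one_le_exp (-(c * τ))
    have h6 : c * τ * exp (c * τ) ≤ c * τ * exp c := by gcongr
    have h7 : c * exp c * τ ≤ g * τ := by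
      rw [hg]; gcongr
      linarith [show 0 ≤ 1 / (4 * C₀ ^ 2) by positivity]
    have h8 : c * τ ≤ g * τ := by
      rw [hg]; gcongr
      linarith [show 0 ≤ 1 / (4 * C₀ ^ 2) by positivity, show 0 ≤ c * exp c by positivity]
    rw [abs_le]
    constructor <;> linarith
  have hεg : τ / (4 * C₀ ^ 2) ≤ g * τ := by
    rw [div_eq_mul_one_div, mul_comm, hg]
    gcongr
    linarith [show 0 ≤ c * exp c by positivity]
  have hcmp := H (Ω s) (Ω t) (u s) (u t) θ⁻¹ (τ / (4 * C₀ ^ 2)) (g * τ) (B.body hs) (B.body ht)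
    (B.adm hs) (B.adm ht) (fun z hz => (B.norm_le ht hz).trans hle)
    (fun z hz => (B.hess_le s hs z hz).trans hle) (fun z hz => B.norm_gradient_le hs hz)
    hθinv (by positivity) hεg (by positivity) hτg (fun z hz => projective_image_mem (B.body hs)
      (B.body ht) (by positivity) hθ (fun x hx => B.supp_pos hs hx) hF hz (by
        have := hball z hz
        rw [real_inner_self_eq_norm_sq]; linarith))
  have hgrad := D.norm_gradient_mul_le B.one_le B.le_sub_one (B.smooth hs) (B.smooth ht) (B.adm hs)
    (B.adm ht) hx hx' hX hY hK hL hθ hy (by linarith) hcmp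
  have hfac : (1 + A * (g * τ)) * ((1 + y) / (1 - y)) ≤ exp ((A * g + 1) * τ) := by
    have h1 : (1 + y) / (1 - y) ≤ exp τ := by
      rw [div_le_iff₀ (by linarith)]
      have := exp_neg_two_mul_le hy0 (by linarith)
      have h2 : exp (-(τ / 2)) ≤ 1 - y := (exp_le_exp.2 (by linarith)).trans this
      have h3 : exp τ * exp (-(τ / 2)) = exp (τ / 2) := by rw [← exp_add]; ring_nf
      have h4 := add_one_le_exp (τ / 2)
      nlinarith [mul_le_mul_of_nonneg_left h2 (exp_pos τ).le]
    have h2 : 1 + A * (g * τ) ≤ exp (A * g * τ) := by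
      have := add_one_le_exp (A * g * τ)
      linarith
    rw [add_mul (A * g) 1 τ, exp_add, one_mul]
    exact mul_le_mul h2 h1 (div_nonneg (by linarith) (by linarith)) (exp_pos _).le
  have hsplit : exp (a4 * τ) = exp ((A * g + 1) * τ) * exp ((exp (2 * c) / 2 + c) * τ) := by
    rw [ha4, ← exp_add]; ring_nf
  have hDu : ‖gradient (u t) Y‖ ≤ exp (a4 * τ) * ‖gradient (u s) X‖ := by
    refine le_of_mul_le_mul_right ?_ hL
    calc ‖gradient (u t) Y‖ * suppFun (Ω t) x
        ≤ (1 + A * (g * τ)) * ((1 + y) / (1 - y)) * (‖gradient (u s) X‖ * suppFun (Ω s) x') := hgrad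
      _ ≤ exp ((A * g + 1) * τ) * (‖gradient (u s) X‖ *
          (exp ((exp (2 * c) / 2 + c) * τ) * suppFun (Ω t) x)) := by gcongr
      _ = exp (a4 * τ) * ‖gradient (u s) X‖ * suppFun (Ω t) x := by
        rw [hsplit]; ring
  have hff : (f x)⁻¹ ≤ exp (M * d * τ) * (f x')⁻¹ := by
    have h1 := hf x x' hx hx' (e6.trans hτd)
    have h2 : exp (M * ‖x - x'‖) ≤ exp (M * d * τ) := exp_le_exp.2 (by
      rw [mul_assoc]; gcongr)
    have hp := B.f_pos x hx
    have hp' := B.f_pos x' hx'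
    rw [← div_eq_mul_inv, inv_le_comm₀ hp (by positivity), inv_div, div_le_iff₀ (exp_pos _)]
    exact h1.trans (by gcongr)
  have hexp : flowCoeff n k p (Ω t) (u t) f x ≤
      exp (e * τ) * flowCoeff n k p (Ω s) (u s) f x' := by
    have hp := B.f_pos x hx
    have hp' := B.f_pos x' hx'
    unfold flowCoeff
    rw [← hX, ← hY]
    refine (mul_exp_le (k + 1) (div_nonneg hL.le hp.le) (by positivity) (by positivity)
      (div_le_exp_mul_div hL.le (inv_pos.2 hp).le e3 hff) e5 hDu).trans_eq ?_
    rw [he]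
    congr 2
    push_cast
    ring
  refine hexp.trans (mul_le_mul_of_nonneg_right ?_ ?_)
  · have h1 := exp_le_one_add_mul_exp (e * τ)
    have h2 : exp (e * τ) ≤ exp e := exp_le_exp.2 (mul_le_of_le_one_right he0 hτ1)
    have h3 : e * τ * exp (e * τ) ≤ e * τ * exp e := by gcongr
    linarith
  · obtain ⟨σ, S, hσ, -, hb⟩ := B.exists_flowCoeff_bounds
    exact hσ.le.trans (hb s hs x' hx').1

set_option maxHeartbeats 1000000 in
/-- At a contact point of the two-point function, the normal speeds are comparable. -/
theorem exists_contact_bound (B : BoundedFlow n k p T C₀ Ω u f) {c : ℝ} (hc : 0 ≤ c) :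
    ∃ C τ₀ : ℝ, 0 ≤ C ∧ 0 < τ₀ ∧ τ₀ ≤ 1 ∧ ∀ s ∈ Ico 0 T, ∀ t ∈ Ico 0 T, ∀ τ θ : ℝ, 0 < τ →
      τ ≤ τ₀ → exp (-(c * τ)) ≤ θ → θ ≤ exp (c * τ) →
      (∀ b b' : En n, ‖b‖ = 1 → ‖b'‖ = 1 →
        0 ≤ twoPointGap (τ / (4 * C₀ ^ 2)) θ (Ω s) (Ω t) b b') →
      ∀ x x' : En n, ‖x‖ = 1 → ‖x'‖ = 1 → twoPointGap (τ / (4 * C₀ ^ 2)) θ (Ω s) (Ω t) x x' = 0 →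
      ∃ y : ℝ, 0 ≤ y ∧ y ≤ τ / 4 ∧
        √(1 + 4 * (τ / (4 * C₀ ^ 2)) * (θ * suppFun (Ω s) x') ^ 2) * suppFun (Ω t) x =
          θ * suppFun (Ω s) x' * (1 + y) ∧
        (1 + y) * (flowCoeff n k p (Ω t) (u t) f x * esym n (n - k) (hessMat (suppFun (Ω t)) x)) ≤
          (1 - y) * (flowCoeff n k p (Ω s) (u s) f x' *
            esym n (n - k) (hessMat (suppFun (Ω s)) x')) + C * τ := by
  have hC := B.pos
  have hk1 := B.one_le
  have hkn := B.le_sub_one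
  obtain ⟨a, τ₁, ha, hτ₁, hτ₁1, H⟩ := B.exists_flowCoeff_comparison hc
  obtain ⟨σ, S, hσ, hS, hb⟩ := B.exists_flowCoeff_bounds
  obtain ⟨b, hbd⟩ : ∃ b, b = exp (2 * c) / 2 + c * exp c + exp (2 * c) / 2 * (c * exp c) :=
    ⟨_, rfl⟩
  have hb0 : 0 ≤ b := by rw [hbd]; positivity
  obtain ⟨C, hC0, E⟩ := esym_le_of_touchingData n (n - k) (by omega) (by omega) (2 * a + 1) b
    (exp (-c) / (4 * C₀ ^ 3)) (by positivity) hb0 (by positivity)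
  refine ⟨S * C, τ₁, by positivity, hτ₁, hτ₁1, ?_⟩
  intro s hs t ht τ θ hτ hττ hθ1 hθ2 hF x x' hx hx' h0
  have hτ1 : τ ≤ 1 := hττ.trans hτ₁1
  have hθ : 0 < θ := (exp_pos _).trans_le hθ1
  have hK := B.supp_pos hs hx'
  have hL := B.supp_pos ht hx
  have hx0 : x ≠ 0 := norm_ne_zero_iff.1 (by rw [hx]; exact one_ne_zero)
  have hx0' : x' ≠ 0 := norm_ne_zero_iff.1 (by rw [hx']; exact one_ne_zero)
  obtain ⟨R, hR⟩ : ∃ R, R = √(1 + 4 * (τ / (4 * C₀ ^ 2)) * (θ * suppFun (Ω s) x') ^ 2) := ⟨_, rfl⟩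
  obtain ⟨κ, hκ⟩ : ∃ κ, κ = θ * suppFun (Ω s) x' := ⟨_, rfl⟩
  obtain ⟨h, hh⟩ : ∃ h, h = suppFun (Ω t) x := ⟨_, rfl⟩
  obtain ⟨X, hX⟩ : ∃ X, X = gradient (suppFun (Ω s)) x' := ⟨_, rfl⟩
  obtain ⟨Y, hY⟩ : ∃ Y, Y = gradient (suppFun (Ω t)) x := ⟨_, rfl⟩
  obtain ⟨y, hy⟩ : ∃ y, y = τ / (4 * C₀ ^ 2) * ‖Y‖ ^ 2 := ⟨_, rfl⟩
  have hy0 : 0 ≤ y := by rw [hy]; positivity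
  have hyτ : y ≤ τ / 4 := by
    have : ‖Y‖ ^ 2 ≤ C₀ ^ 2 :=
      pow_le_pow_left₀ (norm_nonneg _) (hY ▸ (B.norm_position_bounds ht hx).2) 2
    calc y ≤ τ / (4 * C₀ ^ 2) * C₀ ^ 2 := hy ▸ mul_le_mul_of_nonneg_left this (by positivity)
      _ = τ / 4 := by field_simp
  have hκp : 0 < κ := hκ ▸ mul_pos hθ hK
  have hhp : 0 < h := hh ▸ hL
  have hhC : 1 / C₀ ≤ h := hh ▸ (B.bounds t ht x hx).1.1
  have D := touchingData (B.smooth hs) (B.smooth ht) hx hx' (by positivity) hF h0 hR hκ hh hX hY hy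
    (by linarith) hκp hhp
  obtain ⟨hR1, hR2, -⟩ := B.touching_estimates hc hs ht hτ hτ1 hθ1 hθ2 hx hx' hR hκ hh hX hY hy D
  have hcoef := H s hs t ht τ θ hτ hττ hθ1 hθ2 hF x x' hx hx' R κ h y X Y hR hκ hh hX hY hy D
  have hθle : θ ≤ 1 + c * exp c * τ := by
    have h1 := exp_le_one_add_mul_exp (c * τ)
    have h2 : exp (c * τ) ≤ exp c := exp_le_exp.2 (mul_le_of_le_one_right hc hτ1)
    have h3 : c * τ * exp (c * τ) ≤ c * τ * exp c := by gcongr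
    linarith
  have hθge : exp (-c) ≤ θ :=
    (exp_le_exp.2 (neg_le_neg (mul_le_of_le_one_right hc hτ1))).trans hθ1
  have h1y : 0 < 1 - y := by linarith
  have m1 : R * (1 - y) * θ ≤ 1 + b * τ := by
    have h1 : R * (1 - y) ≤ R := mul_le_of_le_one_right (by linarith) (by linarith)
    have h2 : R * (1 - y) * θ ≤ (1 + exp (2 * c) / 2 * τ) * (1 + c * exp c * τ) :=
      mul_le_mul (h1.trans hR2) hθle hθ.le (by positivity)
    have h3 : exp (2 * c) / 2 * (c * exp c) * (τ * τ) ≤ exp (2 * c) / 2 * (c * exp c) * τ := by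
      gcongr
      exact mul_le_of_le_one_left hτ.le hτ1
    rw [hbd]
    linarith
  have m2 : exp (-c) / (4 * C₀ ^ 3) * τ ≤
      R * (2 * (τ / (4 * C₀ ^ 2)) * h * (1 - y) / (1 + y) * θ) := by
    have h1 : 1 / 2 ≤ (1 - y) / (1 + y) := by
      rw [le_div_iff₀ (by linarith)]; linarith
    calc exp (-c) / (4 * C₀ ^ 3) * τ
        = 1 * (2 * (τ / (4 * C₀ ^ 2)) * (1 / C₀) * (1 / 2) * exp (-c)) := by field_simp
      _ ≤ R * (2 * (τ / (4 * C₀ ^ 2)) * h * ((1 - y) / (1 + y)) * θ) := by gcongr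
      _ = _ := by ring
  have hmat := E (Ω s) (Ω t) (τ / (4 * C₀ ^ 2)) θ x x' R κ h y X Y τ (B.smooth hs) (B.smooth ht) hx0
    hx0' D (by positivity) hθ hκp hhp (by linarith) hy (by linarith) hτ.le hτ1 m1 m2
  refine ⟨y, hy0, hyτ, ?_, ?_⟩
  · have := D.height
    rwa [hR, hκ, hh] at this
  · obtain ⟨σL, hσL⟩ : ∃ σL, σL = esym n (n - k) (hessMat (suppFun (Ω t)) x) := ⟨_, rfl⟩
    obtain ⟨σK, hσK⟩ : ∃ σK, σK = esym n (n - k) (hessMat (suppFun (Ω s)) x') := ⟨_, rfl⟩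
    have hσL0 : 0 ≤ σL := hσL ▸ esym_nonneg_of_posSemidef (by omega) ((B.smooth ht).posSemidef hx0)
    rw [← hσL, ← hσK] at hmat ⊢
    obtain ⟨cL, hcL⟩ : ∃ cL, cL = flowCoeff n k p (Ω t) (u t) f x := ⟨_, rfl⟩
    obtain ⟨cK, hcK⟩ : ∃ cK, cK = flowCoeff n k p (Ω s) (u s) f x' := ⟨_, rfl⟩
    have hcS := (hb s hs x' hx').2
    have hcσ := hσ.le.trans (hb s hs x' hx').1
    rw [← hcK] at hcS hcσ
    rw [← hcL, ← hcK] at hcoef ⊢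
    have q1 : (1 + y) * (1 + a * τ) ≤ (1 - y) * (1 + (2 * a + 1) * τ) := by
      nlinarith [mul_nonneg ha hτ.le, mul_nonneg (mul_nonneg ha hτ.le) hy0, mul_nonneg hy0 hτ.le,
        mul_le_mul_of_nonneg_right (show y ≤ 1 / 4 by linarith) (mul_nonneg ha hτ.le)]
    calc (1 + y) * (cL * σL) ≤ (1 + y) * ((1 + a * τ) * cK * σL) := by gcongr
      _ = ((1 + y) * (1 + a * τ)) * (cK * σL) := by ring
      _ ≤ ((1 - y) * (1 + (2 * a + 1) * τ)) * (cK * σL) := by gcongr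
      _ = (1 - y) * cK * ((1 + (2 * a + 1) * τ) * σL) := by ring
      _ ≤ (1 - y) * cK * (σK + C * τ) := by gcongr
      _ = (1 - y) * (cK * σK) + (1 - y) * cK * (C * τ) := by ring
      _ ≤ (1 - y) * (cK * σK) + S * (C * τ) := by
        have : (1 - y) * cK ≤ S := (mul_le_of_le_one_left hcσ (by linarith)).trans hcS
        gcongr
      _ = (1 - y) * (cK * σK) + S * C * τ := by ring

end BoundedFlow

/-- A continuous family of functions that is positive at time `0` and fails to be positive later on
vanishes for the first time at some positive time. -/
theorem exists_first_zero {X : Type*} [TopologicalSpace X] {S : Set X} (hS : IsCompact S) {b : ℝ}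
    {F : ℝ → X → ℝ} (hF : ContinuousOn (fun q : ℝ × X => F q.1 q.2) (Icc 0 b ×ˢ S))
    (h0 : ∀ x ∈ S, 0 < F 0 x) {r₁ : ℝ} (hr₁ : r₁ ∈ Icc 0 b) {x₁ : X} (hx₁ : x₁ ∈ S)
    (h₁ : F r₁ x₁ ≤ 0) :
    ∃ r ∈ Ioc 0 b, (∀ x ∈ S, 0 ≤ F r x) ∧ (∀ r' ∈ Ico 0 r, ∀ x ∈ S, 0 < F r' x) ∧
      ∃ x ∈ S, F r x = 0 := by
  have hK : IsCompact (Icc 0 b ×ˢ S) := isCompact_Icc.prod hS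
  have hZ : IsCompact ((Icc 0 b ×ˢ S) ∩ {q : ℝ × X | F q.1 q.2 ≤ 0}) := by
    obtain ⟨Z, hZc, hZ⟩ := continuousOn_iff_isClosed.1 hF (Iic 0) isClosed_Iic
    have : (Icc 0 b ×ˢ S) ∩ {q : ℝ × X | F q.1 q.2 ≤ 0} = (Icc 0 b ×ˢ S) ∩ Z := by
      rw [inter_comm _ Z, ← hZ, inter_comm]; rfl
    rw [this]
    exact hK.inter_right hZc
  obtain ⟨⟨r, x⟩, ⟨⟨hr, hx⟩, hle⟩, hmin⟩ := hZ.exists_isMinOn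
    ⟨(r₁, x₁), ⟨hr₁, hx₁⟩, h₁⟩ (f := Prod.fst) continuous_fst.continuousOn
  have hle' : F r x ≤ 0 := hle
  have hpos : ∀ r' ∈ Ico 0 r, ∀ z ∈ S, 0 < F r' z := by
    intro r' hr' z hz
    by_contra hc
    exact absurd (hmin (show (r', z) ∈ _ from
      ⟨⟨⟨hr'.1, hr'.2.le.trans hr.2⟩, hz⟩, not_lt.1 hc⟩)) (not_le.2 hr'.2)
  have hr0 : 0 < r := by
    rcases hr.1.eq_or_lt with h | h
    · exact absurd (h0 x hx) (not_lt.2 (h ▸ hle'))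
    · exact h
  have hnn : ∀ z ∈ S, 0 ≤ F r z := by
    intro z hz
    have hc : ContinuousOn (fun s => F s z) (Icc 0 b) :=
      hF.comp (f := fun s => (s, z)) (by fun_prop) (fun s hs => ⟨hs, hz⟩)
    have hc' : Tendsto (fun s => F s z) (𝓝[Ico 0 r] r) (𝓝 (F r z)) :=
      ((hc r hr).mono (fun s hs => ⟨hs.1, hs.2.le.trans hr.2⟩))
    have : (𝓝[Ico 0 r] r).NeBot := by
      rw [← mem_closure_iff_nhdsWithin_neBot, closure_Ico hr0.ne]
      exact right_mem_Icc.2 hr0.le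
    exact ge_of_tendsto hc' (by
      filter_upwards [self_mem_nhdsWithin] with s hs using (hpos s hs z hz).le)
  exact ⟨r, ⟨hr0, hr.2⟩, hnn, hpos, x, hx, le_antisymm hle' (hnn x hx)⟩

/-- The time derivative of the two-point expression is nonpositive at a first contact. -/
theorem contact_derivative_le {ε κ h : ℝ → ℝ} {ε' κ' h' r q y : ℝ} (hε : HasDerivAt ε ε' r)
    (hκ : HasDerivAt κ κ' r) (hh : HasDerivAt h h' r) (hε0 : 0 < ε r) (hκ0 : 0 < κ r)
    (hh0 : 0 < h r) (hy : 0 ≤ y)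
    (hc : √(1 + 4 * ε r * κ r ^ 2) * h r = κ r * (1 + y))
    (hle : ∀ᶠ d in 𝓝[<] (0 : ℝ),
      √(1 + 4 * ε r * κ r ^ 2) - q - 2 * ε r * κ r * h r ≤
        √(1 + 4 * ε (r + d) * κ (r + d) ^ 2) - q - 2 * ε (r + d) * κ (r + d) * h (r + d)) :
    (1 - y) * (κ' / κ r) ≤ y * (ε' / ε r) + (1 + y) * (h' / h r) := by
  have hpos : 0 < 1 + 4 * ε r * κ r ^ 2 := by positivity
  have hd := ((((hε.const_mul 4).mul (hκ.pow 2)).const_add 1).sqrt hpos.ne').sub_const q |>.sub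
    (((hε.const_mul 2).mul hκ).mul hh)
  have hn := hd.nonpos_of_eventually_left hle
  simp only [Pi.mul_apply, Pi.pow_apply] at hn
  obtain ⟨R, hR⟩ : ∃ R, R = √(1 + 4 * ε r * κ r ^ 2) := ⟨_, rfl⟩
  have hR0 : 0 < R := hR ▸ Real.sqrt_pos.2 hpos
  rw [← hR] at hn hc
  have hRe : R = κ r * (1 + y) / h r := by field_simp; linarith
  have key : (1 - y) * (κ' / κ r) - (y * (ε' / ε r) + (1 + y) * (h' / h r)) =
      (1 + y) / (2 * ε r * κ r * h r) * ((4 * ε' * κ r ^ 2 +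
        4 * ε r * (((2 : ℕ) : ℝ) * κ r ^ (2 - 1) * κ')) / (2 * R) -
        ((2 * ε' * κ r + 2 * ε r * κ') * h r + 2 * ε r * κ r * h')) := by
    rw [hRe]
    have : 1 + y ≠ 0 := by positivity
    field_simp
    norm_num
    ring
  have : (1 + y) / (2 * ε r * κ r * h r) * ((4 * ε' * κ r ^ 2 +
        4 * ε r * (((2 : ℕ) : ℝ) * κ r ^ (2 - 1) * κ')) / (2 * R) -
        ((2 * ε' * κ r + 2 * ε r * κ') * h r + 2 * ε r * κ r * h')) ≤ 0 :=
    mul_nonpos_of_nonneg_of_nonpos (by positivity) hn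
  linarith

namespace BoundedFlow

variable {n k : ℕ} {p T C₀ : ℝ} {Ω : ℝ → Set (En n)} {u : ℝ → En n → ℝ} {f : En n → ℝ}

/-- The function `η` has a primitive. -/
theorem exists_primitive_eta (B : BoundedFlow n k p T C₀ Ω u f) :
    ∃ N : ℝ → ℝ, ∀ t ∈ Ico 0 T, HasDerivAt N (etaFn n k p Ω u f t) t := by
  have hcont : ContinuousOn (fun t => etaFn n k p Ω u f (max t 0)) (Iio T) := by
    rcases le_or_gt T 0 with hT | hT
    · refine (continuousOn_const (c := etaFn n k p Ω u f 0)).congr fun t ht => ?_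
      simp [max_eq_right ((le_of_lt ht).trans hT)]
    · exact B.continuousOn_eta.comp (by fun_prop) fun t ht => ⟨le_max_right _ _, max_lt ht hT⟩
  refine ⟨fun t => ∫ s in (0 : ℝ)..t, etaFn n k p Ω u f (max s 0), fun t ht => ?_⟩
  have hnhds : Iio T ∈ 𝓝 t := Iio_mem_nhds ht.2
  have h := intervalIntegral.integral_hasDerivAt_right (a := 0)
    (f := fun t => etaFn n k p Ω u f (max t 0)) (b := t) ?_ ?_ (hcont.continuousAt hnhds)
  · simpa [max_eq_left ht.1] using h
  · refine (hcont.mono fun s hs => ?_).intervalIntegrable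
    rw [uIcc_of_le ht.1] at hs
    exact hs.2.trans_lt ht.2
  · exact hcont.stronglyMeasurableAtFilter isOpen_Iio t ht.2

theorem primitive_sub_mem (B : BoundedFlow n k p T C₀ Ω u f) {N : ℝ → ℝ}
    (hN : ∀ t ∈ Ico 0 T, HasDerivAt N (etaFn n k p Ω u f t) t) {s t : ℝ} (hs : s ∈ Ico 0 T)
    (ht : t ∈ Ico 0 T) (hst : s ≤ t) : 0 ≤ N t - N s ∧ N t - N s ≤ C₀ * (t - s) := by
  have hsub : Icc s t ⊆ Ico 0 T := fun r hr => ⟨hs.1.trans hr.1, hr.2.trans_lt ht.2⟩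
  have hc : ContinuousOn N (Icc s t) := fun r hr => (hN r (hsub hr)).continuousAt.continuousWithinAt
  rcases hst.eq_or_lt with h | h
  · simp [h]
  obtain ⟨r, hr, hrN⟩ := exists_hasDerivAt_eq_slope N (etaFn n k p Ω u f) h hc
    (fun r hr => hN r (hsub (Ioo_subset_Icc_self hr)))
  have hr' := hsub (Ioo_subset_Icc_self hr)
  have h1 := B.eta_bounds r hr'
  have h2 : (0 : ℝ) ≤ 1 / C₀ := (one_div_pos.2 B.pos).le
  have h3 : 0 < t - s := by linarith
  rw [eq_div_iff h3.ne'] at hrN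
  rw [← hrN]
  exact ⟨mul_nonneg (h2.trans h1.1) h3.le, mul_le_mul_of_nonneg_right h1.2 h3.le⟩

theorem hasDerivAt_suppFun (B : BoundedFlow n k p T C₀ Ω u f) {t : ℝ} (ht : t ∈ Ico 0 T) {x : En n}
    (hx : ‖x‖ = 1) : HasDerivAt (fun s => suppFun (Ω s) x)
      (suppFun (Ω t) x * (flowCoeff n k p (Ω t) (u t) f x *
        esym n (n - k) (hessMat (suppFun (Ω t)) x) - etaFn n k p Ω u f t)) t := by
  refine (B.flow.flow t ht x hx).congr_deriv ?_
  unfold flowCoeff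
  ring

theorem continuousOn_suppFun (B : BoundedFlow n k p T C₀ Ω u f) :
    ContinuousOn (fun q : ℝ × En n => suppFun (Ω q.1) q.2) (Ico 0 T ×ˢ Metric.sphere 0 1) := by
  refine continuousOn_prod_of_continuousOn_lipschitzOnWith' _ (Real.toNNReal C₀) ?_ ?_
  · intro t ht
    refine LipschitzOnWith.of_dist_le_mul fun x _ x' _ => ?_
    rw [Real.coe_toNNReal _ B.pos.le, Real.dist_eq, dist_eq_norm]
    exact B.abs_supp_sub_le ht x x'
  · intro x hx t ht
    exact (B.continuousAt_supp ht (by simpa using hx)).continuousWithinAt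

end BoundedFlow

/-- The two-point function comparing the bodies at times `α` and `β`, normalised by a primitive
`N` of `η`. -/
noncomputable def flowGap {n : ℕ} (N : ℝ → ℝ) (C₀ : ℝ) (Ω : ℝ → Set (En n)) (τ α β : ℝ)
    (a b : En n) : ℝ :=
  twoPointGap (τ / (4 * C₀ ^ 2)) (exp (-(N β - N α)) / (1 - τ)) (Ω α) (Ω β) a b

theorem exp_div_one_sub_bounds {d c τ : ℝ} (hd : 0 ≤ d) (hdc : d ≤ c * τ) (h0 : 0 < τ)
    (h1 : τ ≤ 1 / 4) :
    exp (-((c + 2) * τ)) ≤ exp (-d) / (1 - τ) ∧ exp (-d) / (1 - τ) ≤ exp ((c + 2) * τ) := by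
  have h2 : 0 < 1 - τ := by linarith
  constructor
  · calc exp (-((c + 2) * τ)) ≤ exp (-d) := exp_le_exp.2 (by linarith)
      _ ≤ exp (-d) / (1 - τ) := le_div_self (exp_pos _).le h2 (by linarith)
  · rw [div_le_iff₀ h2]
    have h3 := exp_neg_two_mul_le h0.le h1
    calc exp (-d) ≤ exp (c * τ) := exp_le_exp.2 (by nlinarith)
      _ = exp ((c + 2) * τ) * exp (-(2 * τ)) := by rw [← exp_add]; ring_nf
      _ ≤ exp ((c + 2) * τ) * (1 - τ) := by gcongr

theorem contact_rate_contradiction {τ τ' y α VK VL ηK ηL M C : ℝ} (hτ : 0 < τ) (hτ1 : τ ≤ 1 / 4)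
    (hτ' : 0 ≤ τ') (hy : 0 ≤ y) (hyτ : y ≤ τ / 4) (hα : α ≤ 1) (hVK : 0 ≤ VK) (hηL : 0 ≤ ηL)
    (h1 : (1 - y) * (τ' / (1 - τ) - (ηL - α * ηK) + α * (VK - ηK)) ≤
      y * (τ' / τ) + (1 + y) * (VL - ηL))
    (h2 : (1 + y) * VL ≤ (1 - y) * VK + C * τ) (hM : (1 - α) * VK ≤ M) :
    3 / 4 * τ' ≤ M + C * τ := by
  have h3 : τ' ≤ (1 - y) * (τ' / (1 - τ)) := by
    rw [← mul_div_assoc, le_div_iff₀ (by linarith)]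
    nlinarith
  have h4 : y * (τ' / τ) ≤ τ' / 4 := by
    rw [← mul_div_assoc, div_le_iff₀ hτ]
    nlinarith
  have h5 : (1 - y) * ((1 - α) * VK) ≤ M :=
    (mul_le_of_le_one_left (mul_nonneg (by linarith) hVK) (by linarith)).trans hM
  have h6 := mul_nonneg hy hηL
  nlinarith

namespace BoundedFlow

variable {n k : ℕ} {p T C₀ : ℝ} {Ω : ℝ → Set (En n)} {u : ℝ → En n → ℝ} {f : En n → ℝ}

theorem continuousOn_flowGap (B : BoundedFlow n k p T C₀ Ω u f) {N : ℝ → ℝ}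
    (hN : ∀ t ∈ Ico 0 T, HasDerivAt N (etaFn n k p Ω u f t) t) {α₁ σ b : ℝ} {τ : ℝ → ℝ}
    (hα : ∀ r ∈ Icc 0 b, α₁ * r ∈ Ico 0 T) (hβ : ∀ r ∈ Icc 0 b, r + σ ∈ Ico 0 T)
    (hτ : ContinuousOn τ (Icc 0 b)) (hτ1 : ∀ r ∈ Icc 0 b, τ r < 1) :
    ContinuousOn (fun q : ℝ × (En n × En n) =>
      flowGap N C₀ Ω (τ q.1) (α₁ * q.1) (q.1 + σ) q.2.1 q.2.2)
      (Icc 0 b ×ˢ (Metric.sphere 0 1 ×ˢ Metric.sphere 0 1)) := by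
  have hfst : MapsTo (Prod.fst : ℝ × (En n × En n) → ℝ)
      (Icc 0 b ×ˢ (Metric.sphere 0 1 ×ˢ Metric.sphere 0 1)) (Icc 0 b) := fun q hq => hq.1
  have hNc : ContinuousOn N (Ico 0 T) := fun t ht => (hN t ht).continuousAt.continuousWithinAt
  have hτc := hτ.comp continuousOn_fst hfst
  have hNα : ContinuousOn (fun q : ℝ × (En n × En n) => N (α₁ * q.1))
      (Icc 0 b ×ˢ (Metric.sphere 0 1 ×ˢ Metric.sphere 0 1)) :=
    hNc.comp (by fun_prop) fun q hq => hα _ hq.1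
  have hNβ : ContinuousOn (fun q : ℝ × (En n × En n) => N (q.1 + σ))
      (Icc 0 b ×ˢ (Metric.sphere 0 1 ×ˢ Metric.sphere 0 1)) :=
    hNc.comp (by fun_prop) fun q hq => hβ _ hq.1
  have hK : ContinuousOn (fun q : ℝ × (En n × En n) => suppFun (Ω (α₁ * q.1)) q.2.2)
      (Icc 0 b ×ˢ (Metric.sphere 0 1 ×ˢ Metric.sphere 0 1)) :=
    B.continuousOn_suppFun.comp (f := fun q : ℝ × (En n × En n) => (α₁ * q.1, q.2.2))
      (by fun_prop) fun q hq => ⟨hα _ hq.1, hq.2.2⟩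
  have hL : ContinuousOn (fun q : ℝ × (En n × En n) => suppFun (Ω (q.1 + σ)) q.2.1)
      (Icc 0 b ×ˢ (Metric.sphere 0 1 ×ˢ Metric.sphere 0 1)) :=
    B.continuousOn_suppFun.comp (f := fun q : ℝ × (En n × En n) => (q.1 + σ, q.2.1))
      (by fun_prop) fun q hq => ⟨hβ _ hq.1, hq.2.1⟩
  have hτc' : ContinuousOn (fun q : ℝ × (En n × En n) => τ q.1)
      (Icc 0 b ×ˢ (Metric.sphere 0 1 ×ˢ Metric.sphere 0 1)) := hτc
  have hθ : ContinuousOn (fun q : ℝ × (En n × En n) =>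
      exp (-(N (q.1 + σ) - N (α₁ * q.1))) / (1 - τ q.1))
      (Icc 0 b ×ˢ (Metric.sphere 0 1 ×ˢ Metric.sphere 0 1)) :=
    ((hNβ.sub hNα).neg.rexp).div (continuousOn_const.sub hτc')
      fun q hq => by have := hτ1 _ hq.1; linarith
  unfold flowGap twoPointGap
  have hκ := hθ.mul hK
  have hε := hτc'.div_const (4 * C₀ ^ 2)
  refine ((continuousOn_const.add ((continuousOn_const.mul hε).mul (hκ.pow 2))).sqrt.sub ?_).sub
    (((continuousOn_const.mul hε).mul hκ).mul hL)
  fun_prop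

set_option maxHeartbeats 1000000 in
/-- The two-point function stays positive as long as its parameter grows fast enough. -/
theorem exists_flowGap_pos (B : BoundedFlow n k p T C₀ Ω u f) {N : ℝ → ℝ}
    (hN : ∀ t ∈ Ico 0 T, HasDerivAt N (etaFn n k p Ω u f t) t) :
    ∃ C τ₀ : ℝ, 0 ≤ C ∧ 0 < τ₀ ∧ τ₀ ≤ 1 / 4 ∧ ∀ (α₁ σ b M : ℝ) (τ τ' : ℝ → ℝ), 0 ≤ α₁ → α₁ ≤ 1 →
      0 ≤ σ →
      (∀ r ∈ Icc 0 b, α₁ * r ∈ Ico 0 T) → (∀ r ∈ Icc 0 b, r + σ ∈ Ico 0 T) →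
      (∀ r ∈ Icc 0 b, HasDerivAt τ (τ' r) r) → (∀ r ∈ Icc 0 b, 0 ≤ τ' r) →
      (∀ r ∈ Icc 0 b, 0 < τ r) → (∀ r ∈ Icc 0 b, τ r ≤ τ₀) →
      (∀ r ∈ Icc 0 b, r + σ - α₁ * r ≤ τ r) →
      (∀ r ∈ Icc 0 b, ∀ x : En n, ‖x‖ = 1 →
        (1 - α₁) * (flowCoeff n k p (Ω (α₁ * r)) (u (α₁ * r)) f x *
          esym n (n - k) (hessMat (suppFun (Ω (α₁ * r))) x)) ≤ M) →
      (∀ r ∈ Icc 0 b, M + C * τ r < 3 / 4 * τ' r) →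
      (∀ x x' : En n, ‖x‖ = 1 → ‖x'‖ = 1 → 0 < flowGap N C₀ Ω (τ 0) (α₁ * 0) (0 + σ) x x') →
      ∀ r ∈ Icc 0 b, ∀ x x' : En n, ‖x‖ = 1 → ‖x'‖ = 1 →
        0 < flowGap N C₀ Ω (τ r) (α₁ * r) (r + σ) x x' := by
  have hC := B.pos
  obtain ⟨C, τ₀, hC0, hτ₀, -, H⟩ := B.exists_contact_bound (c := C₀ + 2) (by linarith)
  obtain ⟨s, S, hs, -, hb⟩ := B.exists_flowCoeff_bounds
  refine ⟨C, min τ₀ (1 / 4), hC0, by positivity, min_le_right _ _, ?_⟩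
  intro α₁ σ b M τ τ' hα0 hα1 hσ hα hβ hτd hτ' hτ0 hττ hττσ hM hrate hinit r₁ hr₁ x₁ x₁' hx₁ hx₁'
  by_contra hcon
  have hτ14 : ∀ r ∈ Icc 0 b, τ r ≤ 1 / 4 := fun r hr => (hττ r hr).trans (min_le_right _ _)
  obtain ⟨r, hr, hnn, hpos, ⟨x, x'⟩, ⟨hx, hx'⟩, h0⟩ := exists_first_zero
    (S := (Metric.sphere (0 : En n) 1) ×ˢ (Metric.sphere (0 : En n) 1))
    (F := fun r q => flowGap N C₀ Ω (τ r) (α₁ * r) (r + σ) q.1 q.2)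
    ((isCompact_sphere 0 1).prod (isCompact_sphere 0 1))
    (B.continuousOn_flowGap hN hα hβ (fun r hr => (hτd r hr).continuousAt.continuousWithinAt)
      (fun r hr => by linarith [hτ14 r hr]))
    (fun q hq => hinit q.1 q.2 (by simpa using hq.1) (by simpa using hq.2)) hr₁
    (x₁ := (x₁, x₁')) ⟨by simpa using hx₁, by simpa using hx₁'⟩ (not_lt.1 hcon)
  have hrI : r ∈ Icc 0 b := ⟨hr.1.le, hr.2⟩
  have hxn : ‖x‖ = 1 := by simpa using hx
  have hxn' : ‖x'‖ = 1 := by simpa using hx'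
  have hατ := hα r hrI
  have hβτ := hβ r hrI
  have hαβ : α₁ * r ≤ r + σ := by nlinarith [hr.1]
  obtain ⟨hΔ0, hΔ⟩ := B.primitive_sub_mem hN hατ hβτ hαβ
  have hΔ' : N (r + σ) - N (α₁ * r) ≤ C₀ * τ r :=
    hΔ.trans (mul_le_mul_of_nonneg_left (hττσ r hrI) hC.le)
  have hτp := hτ0 r hrI
  have hτq := hτ14 r hrI
  obtain ⟨hθ1, hθ2⟩ := exp_div_one_sub_bounds hΔ0 hΔ' hτp hτq
  obtain ⟨y, hy0, hyτ, hheight, hspeed⟩ := H (α₁ * r) hατ (r + σ) hβτ (τ r) _ hτp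
    ((hττ r hrI).trans (min_le_left _ _)) hθ1 hθ2
    (fun a a' ha ha' => hnn (a, a') ⟨by simpa using ha, by simpa using ha'⟩) x x' hxn hxn' h0
  have hK := B.supp_pos hατ hxn'
  have hL := B.supp_pos hβτ hxn
  have hε : HasDerivAt (fun r => τ r / (4 * C₀ ^ 2)) (τ' r / (4 * C₀ ^ 2)) r :=
    (hτd r hrI).div_const _
  have hαd : HasDerivAt (fun r => α₁ * r) α₁ r := by
    simpa using (hasDerivAt_id r).const_mul α₁
  have hβd : HasDerivAt (fun r => r + σ) 1 r := (hasDerivAt_id r).add_const σ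
  have hhL := (B.hasDerivAt_suppFun hβτ hxn).comp r hβd
  have hhK := (B.hasDerivAt_suppFun hατ hxn').comp r hαd
  have hNβ := (hN _ hβτ).comp r hβd
  have hNα := (hN _ hατ).comp r hαd
  obtain ⟨VL, hVL⟩ : ∃ V, V = flowCoeff n k p (Ω (r + σ)) (u (r + σ)) f x *
    esym n (n - k) (hessMat (suppFun (Ω (r + σ))) x) := ⟨_, rfl⟩
  obtain ⟨VK, hVK⟩ : ∃ V, V = flowCoeff n k p (Ω (α₁ * r)) (u (α₁ * r)) f x' *
    esym n (n - k) (hessMat (suppFun (Ω (α₁ * r))) x') := ⟨_, rfl⟩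
  have hMr := hM r hrI x' hxn'
  have hx0' : x' ≠ 0 := norm_ne_zero_iff.1 (by rw [hxn']; exact one_ne_zero)
  have hVK0 : 0 ≤ VK := hVK ▸ mul_nonneg (hs.le.trans (hb _ hατ x' hxn').1)
    (esym_nonneg_of_posSemidef (Nat.sub_le _ _) ((B.smooth hατ).posSemidef hx0'))
  rw [← hVL, ← hVK] at hspeed
  rw [← hVL] at hhL
  rw [← hVK] at hhK hMr
  obtain ⟨κ, hκ⟩ : ∃ κ : ℝ → ℝ, κ = fun r => exp (-(N (r + σ) - N (α₁ * r))) / (1 - τ r) *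
    suppFun (Ω (α₁ * r)) x' := ⟨_, rfl⟩
  have h1τ : 0 < 1 - τ r := by linarith
  have hκ0 : 0 < κ r := by rw [hκ]; positivity
  have hκd : HasDerivAt κ (κ r * (τ' r / (1 - τ r) -
      (etaFn n k p Ω u f (r + σ) - α₁ * etaFn n k p Ω u f (α₁ * r)) +
      α₁ * (VK - etaFn n k p Ω u f (α₁ * r)))) r := by
    have := (((hNβ.sub hNα).neg.exp).div ((hτd r hrI).const_sub 1) h1τ.ne').mul hhK
    rw [hκ]
    refine this.congr_deriv ?_
    simp only [Function.comp, Pi.sub_apply, Pi.neg_apply, Pi.div_apply]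
    field_simp
    ring
  have hle := contact_derivative_le (q := ⟪x, x'⟫) hε hκd hhL (by positivity) hκ0 hL hy0
    (by rw [hκ]; exact hheight) (by
      have hnear : ∀ᶠ d in 𝓝[<] (0 : ℝ), -r < d :=
        nhdsWithin_le_nhds (lt_mem_nhds (by linarith [hr.1]))
      filter_upwards [hnear, self_mem_nhdsWithin] with d hd hd0
      have hd0' : d < 0 := hd0
      have h1 := (hpos (r + d) ⟨by linarith, by linarith⟩ (x, x') ⟨hx, hx'⟩).le
      have h2 := h0.trans_le h1
      rw [hκ]
      exact h2)
  have hηL : 0 ≤ etaFn n k p Ω u f (r + σ) :=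
    (one_div_pos.2 hC).le.trans (B.eta_bounds _ hβτ).1
  refine absurd (contact_rate_contradiction (ηK := etaFn n k p Ω u f (α₁ * r)) hτp hτq (hτ' r hrI)
    hy0 hyτ hα1 hVK0 hηL ?_ hspeed hMr) (not_le.2 (hrate r hrI))
  have e1 : τ' r / (4 * C₀ ^ 2) / (τ r / (4 * C₀ ^ 2)) = τ' r / τ r := by field_simp
  rw [e1, mul_div_cancel_left₀ _ hκ0.ne'] at hle
  refine hle.trans_eq ?_
  simp only [Function.comp, mul_one]
  rw [mul_div_cancel_left₀ _ hL.ne']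

end BoundedFlow

theorem twoPointGap_self_pos {n : ℕ} {K : Set (En n)} (hK : IsSmoothStrictlyConvexBody n K)
    {ε θ r : ℝ} (hε : 0 < ε) (hθ : 0 < θ) (hr : ∀ z ∈ K, ‖z‖ ≤ r) (hθr : θ⁻¹ + ε * r ^ 2 < 1)
    {x x' : En n} (hx : ‖x‖ = 1) (hx' : ‖x'‖ = 1) (hpos : 0 < suppFun K x') :
    0 < twoPointGap ε θ K K x x' := by
  have hx0 : x ≠ 0 := norm_ne_zero_iff.1 (by rw [hx]; exact one_ne_zero)
  obtain ⟨Y, hY⟩ : ∃ Y, Y = gradient (suppFun K) x := ⟨_, rfl⟩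
  have hYK : Y ∈ K := hY ▸ hK.gradient_mem hx0
  have hxY : ⟪x, Y⟫ = suppFun K x := hY ▸ hK.inner_gradient hx0
  have hxY' : ⟪x', Y⟫ ≤ suppFun K x' := inner_le_suppFun hK.body.comp x' hYK
  obtain ⟨κ, hκ⟩ : ∃ κ, κ = θ * suppFun K x' := ⟨_, rfl⟩
  have hκ0 : 0 < κ := hκ ▸ mul_pos hθ hpos
  have hKκ : suppFun K x' = θ⁻¹ * κ := by rw [hκ]; field_simp
  have hYr : ‖Y‖ ^ 2 ≤ r ^ 2 := pow_le_pow_left₀ (norm_nonneg _) (hr Y hYK) 2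
  have h1 : ⟪x, x'⟫ + 2 * ε * κ * suppFun K x ≤ ‖x' + (2 * ε * κ) • Y‖ := by
    rw [← hxY, ← real_inner_smul_right, ← inner_add_right]
    simpa [hx] using real_inner_le_norm x (x' + (2 * ε * κ) • Y)
  have h2 : ‖x' + (2 * ε * κ) • Y‖ < √(1 + 4 * ε * κ ^ 2) := by
    refine Real.lt_sqrt_of_sq_lt ?_
    rw [norm_add_sq_real, hx', real_inner_smul_right, norm_smul,
      Real.norm_of_nonneg (by positivity)]
    have h3 : ε * κ * ⟪x', Y⟫ ≤ ε * κ * (θ⁻¹ * κ) := by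
      rw [← hKκ]; gcongr
    have h4 : (ε * κ) ^ 2 * ‖Y‖ ^ 2 ≤ (ε * κ) ^ 2 * r ^ 2 := by gcongr
    have h5 : ε * κ ^ 2 * (θ⁻¹ + ε * r ^ 2) < ε * κ ^ 2 * 1 := by gcongr
    nlinarith
  unfold twoPointGap
  rw [← hκ]
  linarith

theorem suppFun_lt_of_twoPointGap_pos {n : ℕ} {K L : Set (En n)} {ε θ : ℝ} (hε : 0 < ε) {x : En n}
    (hx : ‖x‖ = 1) (hpos : 0 < θ * suppFun K x) (h : 0 < twoPointGap ε θ K L x x) :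
    suppFun L x < θ * suppFun K x := by
  unfold twoPointGap at h
  obtain ⟨κ, hκ⟩ : ∃ κ, κ = θ * suppFun K x := ⟨_, rfl⟩
  rw [← hκ] at h hpos ⊢
  rw [real_inner_self_eq_norm_sq, hx] at h
  have h1 := sqrt_one_add_le (2 * ε * κ ^ 2) (by positivity)
  rw [show 1 + 2 * (2 * ε * κ ^ 2) = 1 + 4 * ε * κ ^ 2 by ring] at h1
  have h2 : 2 * ε * κ * suppFun L x < 2 * ε * κ * κ := by nlinarith
  exact lt_of_mul_lt_mul_left h2 (by positivity)

theorem exists_esym_hessMat_le {n : ℕ} {K : Set (En n)} (hK : IsSmoothStrictlyConvexBody n K)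
    {m : ℕ} (hm : m ≤ n) :
    ∃ M, ∀ x : En n, ‖x‖ = 1 → esym n m (hessMat (suppFun K) x) ≤ M := by
  have hne : ∀ x ∈ Metric.sphere (0 : En n) 1, x ≠ 0 := fun x hx =>
    norm_ne_zero_iff.1 (by rw [show ‖x‖ = 1 by simpa using hx]; exact one_ne_zero)
  obtain ⟨C, hC⟩ := (isCompact_sphere (0 : En n) 1).exists_bound_of_continuousOn
    (f := iteratedFDeriv ℝ 2 (suppFun K)) fun x hx =>
      ((hK.contDiffAt (hne x hx)).continuousAt_iteratedFDeriv le_rfl).continuousWithinAt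
  refine ⟨n.choose m * C ^ m, fun x hx => ?_⟩
  have hxs : x ∈ Metric.sphere (0 : En n) 1 := by simpa using hx
  refine (le_abs_self _).trans (abs_esym_le hm (isHermitian_hessMat (hK.contDiffAt (hne x hxs)))
    fun ξ => (abs_quadForm_hessMat_le _ x ξ).trans ?_)
  gcongr
  exact hC x hxs

namespace BoundedFlow

variable {n k : ℕ} {p T C₀ : ℝ} {Ω : ℝ → Set (En n)} {u : ℝ → En n → ℝ} {f : En n → ℝ}

set_option maxHeartbeats 1000000 in
/-- The two-point function with parameter proportional to the time lag is positive. -/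
theorem exists_flowGap_lag_pos (B : BoundedFlow n k p T C₀ Ω u f) (hT : 0 < T) {N : ℝ → ℝ}
    (hN : ∀ t ∈ Ico 0 T, HasDerivAt N (etaFn n k p Ω u f t) t) :
    ∃ D s₀ : ℝ, 0 < D ∧ 0 < s₀ ∧ ∀ s t : ℝ, 0 < s → s ≤ s₀ → 0 ≤ t → t + s < T →
      ∃ d, 0 < d ∧ d ≤ D ∧ d * s ≤ 1 / 4 ∧ ∀ x : En n, ‖x‖ = 1 →
        0 < flowGap N C₀ Ω (d * s) t (t + s) x x := by
  have hC := B.pos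
  have h0T : (0 : ℝ) ∈ Ico 0 T := ⟨le_rfl, hT⟩
  obtain ⟨C, τ₀, hC0, hτ₀, hτ₀1, H⟩ := B.exists_flowGap_pos hN
  obtain ⟨c₁, c₂, hc₁, hc₂, hb⟩ := B.exists_flowCoeff_bounds
  obtain ⟨M₁, hM₁⟩ := exists_esym_hessMat_le (B.smooth h0T) (Nat.sub_le n k)
  obtain ⟨M, hMdef⟩ : ∃ M, M = c₂ * |M₁| := ⟨_, rfl⟩
  have hM0 : 0 ≤ M := by rw [hMdef]; positivity
  have hM : ∀ x : En n, ‖x‖ = 1 → flowCoeff n k p (Ω 0) (u 0) f x *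
      esym n (n - k) (hessMat (suppFun (Ω 0)) x) ≤ M := by
    intro x hx
    obtain ⟨h1, h2⟩ := hb 0 h0T x hx
    rw [hMdef]
    exact (mul_le_mul_of_nonneg_left ((hM₁ x hx).trans (le_abs_self _)) (hc₁.le.trans h1)).trans
      (mul_le_mul_of_nonneg_right h2 (abs_nonneg _))
  obtain ⟨K, hK⟩ : ∃ K, K = 2 * (M + C + 1) := ⟨_, rfl⟩
  obtain ⟨A, hA⟩ : ∃ A, A = 2 * C + 1 := ⟨_, rfl⟩
  have hK0 : 0 < K := by rw [hK]; positivity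
  have hA0 : 0 < A := by rw [hA]; positivity
  obtain ⟨D, hD⟩ : ∃ D, D = (K + 1) * exp (A * T) := ⟨_, rfl⟩
  have hD0 : 0 < D := by rw [hD]; positivity
  have hKD : K + 1 ≤ D := by
    rw [hD]; exact le_mul_of_one_le_right (by positivity) (one_le_exp (by positivity))
  refine ⟨D, τ₀ / D, hD0, by positivity, ?_⟩
  intro s t hs hss ht hts
  have hDs : D * s ≤ τ₀ := by rwa [le_div_iff₀ hD0, mul_comm] at hss
  have hKs : (K + 1) * s ≤ τ₀ := (mul_le_mul_of_nonneg_right hKD hs.le).trans hDs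
  have stage1 : ∀ x x' : En n, ‖x‖ = 1 → ‖x'‖ = 1 →
      0 < flowGap N C₀ Ω (K * s + s) (0 * s) (s + 0) x x' := by
    refine H 0 0 s M (fun r => K * r + s) (fun _ => K) le_rfl zero_le_one le_rfl ?_ ?_ ?_ ?_ ?_ ?_
      ?_ ?_ ?_ ?_ s (right_mem_Icc.2 hs.le)
    · intro r _
      rwa [zero_mul]
    · intro r hr
      exact ⟨by linarith [hr.1], by linarith [hr.2]⟩
    · intro r _
      simpa using ((hasDerivAt_id r).const_mul K).add_const s
    · intro r _
      exact hK0.le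
    · intro r hr
      have := mul_nonneg hK0.le hr.1
      linarith
    · intro r hr
      have := mul_le_mul_of_nonneg_left hr.2 hK0.le
      linarith
    · intro r hr
      have : r ≤ K * r := le_mul_of_one_le_left hr.1 (by rw [hK]; linarith)
      linarith
    · intro r _ x hx
      simpa using hM x hx
    · intro r hr
      have h1 := mul_le_mul_of_nonneg_left hr.2 hK0.le
      have h2 : C * (K * r + s) ≤ C * 1 := mul_le_mul_of_nonneg_left (by linarith) hC0
      have h3 : M + C * (K * r + s) < 3 / 4 * K := by linarith
      exact h3
    · intro x x' hx hx'
      have hs1 : s ≤ 1 / 4 := by nlinarith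
      have h1 : 0 < 1 - s := by linarith
      have := twoPointGap_self_pos (B.smooth h0T) (ε := s / (4 * C₀ ^ 2)) (θ := 1 / (1 - s))
        (r := C₀) (by positivity) (by positivity) (fun z hz => B.norm_le h0T hz) (by
          rw [one_div, inv_inv]
          field_simp
          linarith) hx hx' (B.supp_pos h0T hx')
      simpa [flowGap] using this
  have stage2 := H 1 s t 0 (fun r => (K + 1) * s * exp (A * r))
    (fun r => A * ((K + 1) * s * exp (A * r))) zero_le_one le_rfl hs.le
    (fun r hr => ⟨by linarith [hr.1], by linarith [hr.2]⟩)
    (fun r hr => ⟨by linarith [hr.1], by linarith [hr.2]⟩)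
    (fun r _ => by
      refine ((((hasDerivAt_id r).const_mul A).exp).const_mul ((K + 1) * s)).congr_deriv ?_
      simp only [id, mul_one]
      ring)
    (fun r _ => by positivity) (fun r _ => by positivity)
    (fun r hr => by
      have h1 : exp (A * r) ≤ exp (A * T) :=
        exp_le_exp.2 (mul_le_mul_of_nonneg_left (by linarith [hr.2]) hA0.le)
      calc (K + 1) * s * exp (A * r) ≤ (K + 1) * s * exp (A * T) := by gcongr
        _ = D * s := by rw [hD]; ring
        _ ≤ τ₀ := hDs)
    (fun r hr => by
      have h1 : s ≤ (K + 1) * s := le_mul_of_one_le_left hs.le (by linarith)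
      have h2 : (K + 1) * s ≤ (K + 1) * s * exp (A * r) :=
        le_mul_of_one_le_right (by positivity) (one_le_exp (mul_nonneg hA0.le hr.1))
      linarith)
    (fun r _ x _ => by simp)
    (fun r _ => by
      have h1 : 0 < (K + 1) * s * exp (A * r) := by positivity
      have h2 := mul_nonneg hC0 h1.le
      have h3 : A * ((K + 1) * s * exp (A * r)) = 2 * (C * ((K + 1) * s * exp (A * r))) +
          (K + 1) * s * exp (A * r) := by
        rw [hA]; ring
      rw [h3]
      linarith)
    (fun x x' hx hx' => by
      have := stage1 x x' hx hx'
      simp only [mul_zero, exp_zero, mul_one, zero_add]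
      rw [zero_mul, add_zero] at this
      rwa [add_mul, one_mul])
    t (right_mem_Icc.2 ht)
  have hle : (K + 1) * exp (A * t) ≤ D := by
    rw [hD]
    have : A * t ≤ A * T := mul_le_mul_of_nonneg_left (by linarith) hA0.le
    gcongr
  refine ⟨(K + 1) * exp (A * t), by positivity, hle, ?_, ?_⟩
  · exact ((mul_le_mul_of_nonneg_right hle hs.le).trans hDs).trans hτ₀1
  · intro x hx
    have := stage2 x x hx hx
    rw [one_mul] at this
    rwa [mul_right_comm]

/-- The normal speed of the flow is bounded above. -/
theorem exists_speed_le (B : BoundedFlow n k p T C₀ Ω u f) (hT : 0 < T) :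
    ∃ D > 0, ∀ t ∈ Ico 0 T, ∀ x : En n, ‖x‖ = 1 →
      flowCoeff n k p (Ω t) (u t) f x * esym n (n - k) (hessMat (suppFun (Ω t)) x) ≤ D := by
  obtain ⟨N, hN⟩ := B.exists_primitive_eta
  obtain ⟨D, s₀, hD, hs₀, H⟩ := B.exists_flowGap_lag_pos hT hN
  refine ⟨D, hD, fun t ht x hx => ?_⟩
  have hH := B.supp_pos ht hx
  have hE : HasDerivAt (fun s => exp (N s)) (exp (N t) * etaFn n k p Ω u f t) t := (hN t ht).exp
  have hlin : HasDerivAt (fun s => 1 - D * (s - t)) (-D) t := by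
    simpa using (((hasDerivAt_id t).sub_const t).const_mul D).const_sub 1
  have hd := (((B.hasDerivAt_suppFun ht hx).mul hE).mul hlin).nonpos_of_eventually_right ?_
  · simp only [Pi.mul_apply, sub_self, mul_zero, sub_zero, mul_one] at hd
    have h1 : exp (N t) * suppFun (Ω t) x *
        (flowCoeff n k p (Ω t) (u t) f x * esym n (n - k) (hessMat (suppFun (Ω t)) x) - D) ≤ 0 := by
      linarith
    have h2 : 0 < exp (N t) * suppFun (Ω t) x := by positivity
    have h3 := nonpos_of_mul_nonpos_right h1 h2
    linarith
  · have hs1 : ∀ᶠ s in 𝓝[>] (0 : ℝ), s < s₀ := nhdsWithin_le_nhds (gt_mem_nhds hs₀)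
    have hs2 : ∀ᶠ s in 𝓝[>] (0 : ℝ), s < T - t :=
      nhdsWithin_le_nhds (gt_mem_nhds (by linarith [ht.2]))
    have hs3 : ∀ᶠ s in 𝓝[>] (0 : ℝ), s < 1 / D := nhdsWithin_le_nhds (gt_mem_nhds (by positivity))
    filter_upwards [hs1, hs2, hs3, self_mem_nhdsWithin] with s h1 h2 h3 h4
    have hs : 0 < s := h4
    obtain ⟨d, hd0, hdD, hd4, hgap⟩ := H s t hs h1.le ht.1 (by linarith)
    have hds : d * s ≤ D * s := mul_le_mul_of_nonneg_right hdD hs.le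
    have hDs : 0 < 1 - D * s := by
      rw [lt_div_iff₀ hD] at h3
      linarith
    have hpos : 0 < 1 - d * s := by linarith
    have hC := B.pos
    have hlt := suppFun_lt_of_twoPointGap_pos (by positivity) hx (by positivity) (hgap x hx)
    simp only [Pi.mul_apply, sub_self, mul_zero, sub_zero, mul_one, add_sub_cancel_left]
    have h5 : suppFun (Ω (t + s)) x * exp (N (t + s)) ≤ suppFun (Ω t) x * exp (N t) / (1 - d * s) :=
      calc suppFun (Ω (t + s)) x * exp (N (t + s))
          ≤ exp (-(N (t + s) - N t)) / (1 - d * s) * suppFun (Ω t) x * exp (N (t + s)) := by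
            gcongr
        _ = suppFun (Ω t) x * (exp (-(N (t + s) - N t)) * exp (N (t + s))) / (1 - d * s) := by ring
        _ = suppFun (Ω t) x * exp (N t) / (1 - d * s) := by rw [← exp_add]; ring_nf
    calc suppFun (Ω (t + s)) x * exp (N (t + s)) * (1 - D * s)
        ≤ suppFun (Ω t) x * exp (N t) / (1 - d * s) * (1 - d * s) := by gcongr
      _ = suppFun (Ω t) x * exp (N t) := div_mul_cancel₀ _ hpos.ne'

end BoundedFlow

end

/-- **Upper bound for `σ_{n-k}` (Lemma 5.6).** For `p < n-2`, along a smooth strictly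
convex solution of the flow with uniform two-sided bounds on `h`, `ρ`, `|∇h|`, `η(t)`,
`|Du|` and `|D²u|`, the curvature function `σ_{n-k}(h_{ij}+hδ_{ij}) = S_{n-k}(D²H)`
(with `H` the 1-homogeneous extension of the support function) is bounded above by a
constant independent of `t`. -/
theorem sigma_upper_bound_along_flow (n k : ℕ) (p T C₀ : ℝ) (hk1 : 1 ≤ k)
    (hkn : k ≤ n - 1) (hp : p < (n : ℝ) - 2) (hC₀ : 0 < C₀)
    (Ω : ℝ → Set (En n)) (u : ℝ → En n → ℝ) (f : En n → ℝ)
    (hfpos : ∀ x : En n, ‖x‖ = 1 → 0 < f x)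
    (hfsm : ContDiffOn ℝ (⊤ : ℕ∞) f {(0 : En n)}ᶜ)
    (hflow : IsFlowSolution n k p (Set.Ico 0 T) Ω u f)
    (hbnd : ∀ t ∈ Set.Ico (0 : ℝ) T, ∀ x : En n, ‖x‖ = 1 →
      (1 / C₀ ≤ suppFun (Ω t) x ∧ suppFun (Ω t) x ≤ C₀) ∧
      (1 / C₀ ≤ radialFun (Ω t) x ∧ radialFun (Ω t) x ≤ C₀) ∧
      ‖gradient (suppFun (Ω t)) x - suppFun (Ω t) x • x‖ ≤ C₀ ∧
      (1 / C₀ ≤ ‖gradient (u t) (gradient (suppFun (Ω t)) x)‖ ∧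
        ‖gradient (u t) (gradient (suppFun (Ω t)) x)‖ ≤ C₀))
    (heta : ∀ t ∈ Set.Ico (0 : ℝ) T,
      1 / C₀ ≤ etaFn n k p Ω u f t ∧ etaFn n k p Ω u f t ≤ C₀)
    (hD2u : ∀ t ∈ Set.Ico (0 : ℝ) T, ∀ y ∈ Ω t, ‖iteratedFDeriv ℝ 2 (u t) y‖ ≤ C₀)
    :
    ∃ C₁ > (0 : ℝ), ∀ t ∈ Set.Ico (0 : ℝ) T, ∀ x : En n, ‖x‖ = 1 →
      esym n (n - k) (hessMat (suppFun (Ω t)) x) ≤ C₁ := by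
  have B : BoundedFlow n k p T C₀ Ω u f :=
    ⟨hk1, hkn, hC₀, hfpos, hfsm, hflow, hbnd, heta, hD2u⟩
  rcases le_or_gt T 0 with hT | hT
  · exact ⟨1, one_pos, fun t ht => absurd (ht.1.trans_lt ht.2) (not_lt.2 hT)⟩
  obtain ⟨D, hD, hspeed⟩ := B.exists_speed_le hT
  obtain ⟨s, S, hs, -, hb⟩ := B.exists_flowCoeff_bounds
  refine ⟨D / s, by positivity, fun t ht x hx => ?_⟩
  have hx0 : x ≠ 0 := norm_ne_zero_iff.1 (by rw [hx]; exact one_ne_zero)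
  have hσ := esym_nonneg_of_posSemidef (Nat.sub_le n k) ((B.smooth ht).posSemidef hx0)
  rw [le_div_iff₀ hs, mul_comm]
  exact (mul_le_mul_of_nonneg_right (hb t ht x hx).1 hσ).trans (hspeed t ht x hx)
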